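/- arXiv:1301.4016 — 2 statements merged into one kernel-verified Lean document; each statement's English description precedes it below -/
import Mathlib

section
/- Suppose t = p^i·ℓ + 1 where i ≥ 1, ℓ ≥ 3 is odd and not divisible by p, and gcd(ℓ, p^i − 1) < ℓ. If either (p ≥ 5, i ≥ 1 and ℓ > 3), or (p ≥ 5, i ≥ 2 and ℓ ≥ 3), or (p = 3, i ≥ 2 and ℓ ≥ 3), then g_t(x,y) has an absolutely irreducible factor over F_p. -/
section Valuations

open Polynomial

variable {K L Γ₀ : Type*} [Field K] [Field L] [Algebra K L]
  [LinearOrderedCommGroupWithZero Γ₀] {w : Valuation L Γ₀}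

/-- Any transcendental element lies in the maximal ideal of some valuation ring over `K`. -/
lemma exists_valuationSubring_of_transcendental {z : L} (hz : Transcendental K z) :
    ∃ V : ValuationSubring L,
      (∀ c : K, c ≠ 0 → V.valuation (algebraMap K L c) = 1) ∧ V.valuation z < 1 := by
  let A : Subring L := (aeval z : K[X] →ₐ[K] L).toRingHom.range
  have hzA : z ∈ A := ⟨X, by simp⟩
  have hI : Ideal.span {(⟨z, hzA⟩ : A)} ≠ ⊤ := by
    rw [Ne, Ideal.span_singleton_eq_top, isUnit_iff_exists_inv]
    rintro ⟨⟨_, r, rfl⟩, hr⟩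
    have h1 : aeval z (X * r - 1) = 0 := by
      have := congrArg Subtype.val hr
      simp only [Subring.coe_mul, Subring.coe_one] at this
      simp only [map_sub, map_mul, aeval_X, map_one]
      exact sub_eq_zero.2 this
    have h2 : X * r - 1 = 0 := by
      by_contra h
      exact hz ⟨_, h, h1⟩
    have := congrArg (eval 0) h2
    simp at this
  obtain ⟨V, hAV, hV⟩ := Ideal.image_subset_nonunits_valuationSubring _ hI
  refine ⟨V, fun c hc ↦ ?_, ?_⟩
  · have hmem : ∀ d : K, V.valuation (algebraMap K L d) ≤ 1 := fun d ↦
      (V.valuation_le_one_iff _).2 (hAV ⟨C d, by simp⟩)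
    refine le_antisymm (hmem c) ?_
    have h := hmem c⁻¹
    rw [map_inv₀, map_inv₀] at h
    exact (inv_le_one₀ (by simpa [zero_lt_iff] using hc)).1 h
  · exact (V.mem_nonunits_iff).1
      (hV ⟨⟨z, hzA⟩, Ideal.subset_span rfl, rfl⟩)

lemma Valuation.algebraMap_le_one (hK : ∀ c : K, c ≠ 0 → w (algebraMap K L c) = 1) (c : K) :
    w (algebraMap K L c) ≤ 1 := by
  by_cases hc : c = 0
  · simp [hc]
  · exact (hK c hc).le

lemma Valuation.map_aeval_le_one (hK : ∀ c : K, c ≠ 0 → w (algebraMap K L c) = 1)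
    {x : L} (hx : w x ≤ 1) (r : K[X]) : w (aeval x r) ≤ 1 := by
  rw [aeval_eq_sum_range]
  refine w.map_sum_le fun k _ ↦ ?_
  rw [Algebra.smul_def, map_mul, map_pow]
  exact mul_le_one' (w.algebraMap_le_one hK _) (pow_le_one' hx k)

lemma Valuation.map_aeval_eq_pow_rootMultiplicity
    (hK : ∀ c : K, c ≠ 0 → w (algebraMap K L c) = 1) {x : L} {b : K}
    (hx : w (x - algebraMap K L b) < 1) {r : K[X]} (hr : r ≠ 0) :
    w (aeval x r) = w (x - algebraMap K L b) ^ r.rootMultiplicity b := by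
  have hx1 : w x ≤ 1 := by
    have := w.map_add_le hx.le (w.algebraMap_le_one hK b)
    simpa using this
  obtain ⟨s, hs, hsb⟩ := exists_eq_pow_rootMultiplicity_mul_and_not_dvd r hr b
  have hsb' : s.eval b ≠ 0 := fun h ↦ hsb (dvd_iff_isRoot.2 h)
  obtain ⟨s', hs'⟩ := X_sub_C_dvd_sub_C_eval (p := s) (a := b)
  have h1 : aeval x s = algebraMap K L (s.eval b) + (x - algebraMap K L b) * aeval x s' := by
    have := congrArg (aeval x) hs'
    simp only [_root_.map_sub, aeval_C, _root_.map_mul, aeval_X] at this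
    rw [← this]; ring
  have h2 : w (aeval x s) = 1 := by
    rw [h1, w.map_add_eq_of_lt_left, hK _ hsb']
    rw [hK _ hsb', map_mul]
    exact mul_lt_one_of_lt_of_le hx (w.map_aeval_le_one hK hx1 s')
  conv_lhs => rw [hs]
  simp [h2]

lemma Valuation.map_aeval_eq_pow_natDegree
    (hK : ∀ c : K, c ≠ 0 → w (algebraMap K L c) = 1) {x : L}
    (hx : 1 < w x) {r : K[X]} (hr : r ≠ 0) : w (aeval x r) = w x ^ r.natDegree := by
  have hx0 : x ≠ 0 := by rintro rfl; simp at hx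
  have hxi : w (x⁻¹ - algebraMap K L 0) < 1 := by
    simpa using (inv_lt_one₀ (zero_lt_one.trans hx)).2 hx
  have h := w.map_aeval_eq_pow_rootMultiplicity hK hxi (r := r.reverse) (by simpa using hr)
  have h0 : r.reverse.rootMultiplicity 0 = 0 := by
    rw [rootMultiplicity_eq_zero]
    simpa [IsRoot, ← coeff_zero_eq_eval_zero] using hr
  have h2 : aeval x r = x ^ r.natDegree * aeval x⁻¹ r.reverse := by
    let _ := invertibleOfNonzero hx0
    have := eval₂_reverse_mul_pow (algebraMap K L) x r
    rw [aeval_def, aeval_def, ← this, invOf_eq_inv, mul_comm]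
  rw [h2, map_mul, h, h0, map_pow]; simp

lemma Valuation.exists_add_pow_eq (w : Valuation L Γ₀) {a b : L} (ha : w a ≤ 1) (hb : w b ≤ 1)
    (n : ℕ) :
    ∃ k : L, w k ≤ 1 ∧ (a + b) ^ n = a ^ n + n * a ^ (n - 1) * b + k * b ^ 2 := by
  obtain ⟨k, hk⟩ := powAddExpansion (⟨a, ha⟩ : w.integer) ⟨b, hb⟩ n
  exact ⟨k, k.2, by simpa using congrArg Subtype.val hk⟩

/-- Comparing valuations on clusters of `S × T` indexed by distinct residues. -/
lemma Valuation.pow_sum_le_prod_prod (hK : ∀ c : K, c ≠ 0 → w (algebraMap K L c) = 1)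
    [DecidableEq L] (S T : Finset L) (Z : Finset K) (B : K → ℕ) {θ : Γ₀}
    (hle : ∀ x ∈ S, ∀ x' ∈ T, w (x - x') ≤ 1)
    (hlt : ∀ x ∈ S, ∀ x' ∈ T, w (x - x') < 1 → ∃ c ∈ Z, w (x - algebraMap K L c) < 1)
    (hB : ∀ c ∈ Z, θ ^ B c ≤ ∏ x ∈ S with w (x - algebraMap K L c) < 1,
      ∏ x' ∈ T with w (x' - algebraMap K L c) < 1, w (x - x')) :
    θ ^ ∑ c ∈ Z, B c ≤ ∏ x ∈ S, ∏ x' ∈ T, w (x - x') := by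
  classical
  have huniq : ∀ x : L, ∀ c d : K, w (x - algebraMap K L c) < 1 →
      w (x - algebraMap K L d) < 1 → c = d := by
    intro x c d hc hd
    by_contra hcd
    have h := w.map_sub_lt hd hc
    rw [sub_sub_sub_cancel_left, ← _root_.map_sub, hK _ (sub_ne_zero.2 hcd)] at h
    exact lt_irrefl _ h
  have key : ∀ x ∈ S, ∀ x' ∈ T, w (x - x') = ∏ c ∈ Z,
      if w (x - algebraMap K L c) < 1 then
        (if w (x' - algebraMap K L c) < 1 then w (x - x') else 1) else 1 := by
    intro x hx x' hx'
    rcases (hle x hx x' hx').lt_or_eq with h | h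
    · obtain ⟨c, hc, hxc⟩ := hlt x hx x' hx' h
      have hxc' : w (x' - algebraMap K L c) < 1 := by
        have := w.map_sub_lt hxc h
        rwa [sub_sub_sub_cancel_left] at this
      rw [Finset.prod_eq_single c]
      · simp [hxc, hxc']
      · intro d _ hd
        rw [if_neg]
        intro h'
        exact hd (huniq x d c h' hxc)
      · exact fun h ↦ (h hc).elim
    · simp [h]
  calc θ ^ ∑ c ∈ Z, B c = ∏ c ∈ Z, θ ^ B c := (Finset.prod_pow_eq_pow_sum _ _ _).symm
    _ ≤ ∏ c ∈ Z, ∏ x ∈ S with w (x - algebraMap K L c) < 1,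
          ∏ x' ∈ T with w (x' - algebraMap K L c) < 1, w (x - x') :=
        Finset.prod_le_prod' hB
    _ = ∏ c ∈ Z, ∏ x ∈ S, ∏ x' ∈ T, if w (x - algebraMap K L c) < 1 then
        (if w (x' - algebraMap K L c) < 1 then w (x - x') else 1) else 1 := by
        refine Finset.prod_congr rfl fun c _ ↦ ?_
        rw [Finset.prod_filter]
        refine Finset.prod_congr rfl fun x _ ↦ ?_
        split_ifs
        · rw [Finset.prod_filter]
        · simp
    _ = ∏ x ∈ S, ∏ x' ∈ T, ∏ c ∈ Z, if w (x - algebraMap K L c) < 1 then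
        (if w (x' - algebraMap K L c) < 1 then w (x - x') else 1) else 1 := by
        rw [Finset.prod_comm]
        exact Finset.prod_congr rfl fun x _ ↦ Finset.prod_comm
    _ = ∏ x ∈ S, ∏ x' ∈ T, w (x - x') :=
        Finset.prod_congr rfl fun x hx ↦ Finset.prod_congr rfl fun x' hx' ↦ (key x hx x' hx').symm

lemma dvd_card_of_prod_eq_pow {ι : Type*} (T : Finset ι) (v : ι → Γ₀) {θ : Γ₀} (h0 : θ ≠ 0)
    (h1 : θ < 1) {A B N : ℕ} (hAB : A.Coprime B) (hv : ∀ i ∈ T, v i ^ A = θ ^ B)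
    (hprod : ∏ i ∈ T, v i = θ ^ N) : A ∣ T.card := by
  have h : θ ^ (B * T.card) = θ ^ (N * A) := by
    rw [pow_mul, pow_mul, ← hprod, ← Finset.prod_pow, Finset.prod_congr rfl hv,
      Finset.prod_const]
  have := (pow_right_strictAnti₀ (zero_lt_iff.2 h0) h1).injective h
  exact hAB.dvd_of_dvd_mul_left (this ▸ Dvd.intro_left N rfl)

/-- If factors `≤ θ` multiply to `θ ^ n` with `n` the number of factors, all equal `θ`. -/
lemma eq_of_prod_eq_pow_card {ι : Type*} (T : Finset ι) (v : ι → Γ₀) {θ : Γ₀}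
    (h0 : θ ≠ 0) (hv : ∀ i ∈ T, v i ≤ θ) (hprod : ∏ i ∈ T, v i = θ ^ T.card) :
    ∀ i ∈ T, v i = θ := by
  classical
  intro i hi
  refine le_antisymm (hv i hi) ?_
  have h1 : ∏ j ∈ T.erase i, v j ≤ θ ^ (T.erase i).card := Finset.prod_le_pow_card _ _ _
    fun j hj ↦ hv j (Finset.mem_of_mem_erase hj)
  rw [← Finset.mul_prod_erase T v hi, ← Finset.card_erase_add_one hi, pow_succ'] at hprod
  by_contra hlt
  push Not at hlt
  have := mul_lt_mul'' hlt (lt_of_le_of_ne h1 ?_) zero_le zero_le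
  · exact this.ne hprod
  · intro he
    rw [he] at hprod
    exact hlt.ne (mul_right_cancel₀ (pow_ne_zero _ h0) hprod)

end Valuations

section DiffPow

open Polynomial

/-- The difference `(x + 1) ^ t - x ^ t`. -/
def diffPow {R : Type*} [CommRing R] (t : ℕ) (x : R) : R := (x + 1) ^ t - x ^ t

lemma map_diffPow {R S : Type*} [CommRing R] [CommRing S] (f : R →+* S) (t : ℕ) (x : R) :
    f (diffPow t x) = diffPow t (f x) := by
  simp [diffPow]

lemma sub_pow_of_add_pow {R : Type*} [CommRing R] {q : ℕ}
    (hadd : ∀ a b : R, (a + b) ^ q = a ^ q + b ^ q) (a b : R) :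
    (a - b) ^ q = a ^ q - b ^ q := by
  rw [eq_sub_iff_add_eq, ← hadd, sub_add_cancel]

lemma diffPow_mul_add_one {R : Type*} [CommRing R] {q : ℕ}
    (hadd : ∀ a b : R, (a + b) ^ q = a ^ q + b ^ q) (l : ℕ) (x : R) :
    diffPow (q * l + 1) x = x * diffPow l x ^ q + ((x + 1) ^ l) ^ q := by
  simp only [diffPow, sub_pow_of_add_pow hadd, pow_succ, ← pow_mul, mul_comm q l]
  ring

variable {K L Γ₀ : Type*} [Field K] [Field L] [Algebra K L]
  [LinearOrderedCommGroupWithZero Γ₀] {w : Valuation L Γ₀} {q l : ℕ}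

/-- Taylor expansions of `diffPow` at a critical point. -/
lemma exists_diffPow_expansion (hK : ∀ c : K, c ≠ 0 → w (algebraMap K L c) = 1)
    (hadd : ∀ a b : L, (a + b) ^ q = a ^ q + b ^ q) (hq : Odd q)
    (hl : (l : K) ≠ 0) {c : K} (hc : diffPow l c = 0) :
    ∃ α β δ : K, β ≠ 0 ∧ δ ≠ 0 ∧ (α = 0 ↔ c ^ q = c) ∧ ∀ h : L, w h ≤ 1 →
      (∃ ρ, w ρ ≤ 1 ∧ diffPow (q * l + 1) (algebraMap K L c + h) =
        algebraMap K L (diffPow (q * l + 1) c) + algebraMap K L α * h ^ q +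
          algebraMap K L β * h ^ (q + 1) + ρ * h ^ (2 * q)) ∧
      ∃ ρ, w ρ ≤ 1 ∧ diffPow l (algebraMap K L c + h) = algebraMap K L δ * h + ρ * h ^ 2 := by
  have haddK : ∀ a b : K, (a + b) ^ q = a ^ q + b ^ q := fun a b ↦
    (algebraMap K L).injective (by simpa using hadd (algebraMap K L a) (algebraMap K L b))
  obtain ⟨m, rfl⟩ : ∃ m, l = m + 1 := Nat.exists_eq_succ_of_ne_zero (by rintro rfl; simp at hl)
  have hq0 : q ≠ 0 := by rintro rfl; simp at hq
  have hA : (c + 1) ^ (m + 1) = c ^ (m + 1) := sub_eq_zero.1 hc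
  have hc0 : c ≠ 0 := by rintro rfl; simp at hA
  have hc1 : c + 1 ≠ 0 := by
    intro h
    rw [h] at hA
    exact hc0 (by simpa using hA.symm)
  set n : K := ((m + 1 : ℕ) : K) with hn
  have h1 : n * ((c + 1) ^ m - c ^ m) * (c * (c + 1)) = - (n * c ^ (m + 1)) := by
    linear_combination n * c * hA
  have h2 : n * (c + 1) ^ m * (c * (c + 1)) = n * c ^ (m + 1) * c := by
    linear_combination n * c * hA
  have hδ : n * ((c + 1) ^ m - c ^ m) ≠ 0 := by
    intro h
    rw [h, zero_mul, zero_eq_neg] at h1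
    exact mul_ne_zero hl (pow_ne_zero _ hc0) h1
  set δ := n * ((c + 1) ^ m - c ^ m) with hδd
  refine ⟨c * δ ^ q + (n * (c + 1) ^ m) ^ q, δ ^ q, δ, pow_ne_zero _ hδ, hδ, ?_, ?_⟩
  · have h3 : (c * δ ^ q + (n * (c + 1) ^ m) ^ q) * (c * (c + 1)) ^ q =
        (n * c ^ (m + 1)) ^ q * (c ^ q - c) := by
      rw [add_mul, mul_assoc, ← mul_pow, ← mul_pow, h1, h2, hq.neg_pow, mul_pow _ c]
      ring
    have h4 : (c * (c + 1)) ^ q ≠ 0 := pow_ne_zero _ (mul_ne_zero hc0 hc1)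
    have h5 : (n * c ^ (m + 1)) ^ q ≠ 0 := pow_ne_zero _ (mul_ne_zero hl (pow_ne_zero _ hc0))
    rw [← mul_left_inj' h4, zero_mul, h3, mul_eq_zero, or_iff_right h5, sub_eq_zero]
  · intro h hh
    obtain ⟨k₁, hk₁, e₁⟩ := w.exists_add_pow_eq (a := algebraMap K L (c + 1)) (b := h)
      (w.algebraMap_le_one hK _) hh (m + 1)
    obtain ⟨k₀, hk₀, e₀⟩ := w.exists_add_pow_eq (a := algebraMap K L c) (b := h)
      (w.algebraMap_le_one hK _) hh (m + 1)
    have hP : diffPow (m + 1) (algebraMap K L c + h) =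
        algebraMap K L δ * h + (k₁ - k₀) * h ^ 2 := by
      have hA' := congrArg (algebraMap K L) hA
      rw [diffPow, e₀, show algebraMap K L c + h + 1 = algebraMap K L (c + 1) + h by
        rw [map_add, map_one]; ring, e₁, hδd]
      simp only [map_mul, map_sub, map_pow, hn, map_natCast, Nat.add_sub_cancel] at hA' ⊢
      linear_combination hA'
    have hk : w (k₁ - k₀) ≤ 1 := w.map_sub_le hk₁ hk₀
    refine ⟨⟨(algebraMap K L c + h) * (k₁ - k₀) ^ q + k₁ ^ q, ?_, ?_⟩, k₁ - k₀, hk, hP⟩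
    · refine w.map_add_le ?_ ?_
      · rw [map_mul, map_pow]
        exact mul_le_one' (w.map_add_le (w.algebraMap_le_one hK _) hh) (pow_le_one' hk q)
      · rw [map_pow]; exact pow_le_one' hk₁ q
    · rw [diffPow_mul_add_one hadd, diffPow_mul_add_one haddK, hP, hc,
        show algebraMap K L c + h + 1 = algebraMap K L (c + 1) + h by
        rw [map_add, map_one]; ring, e₁]
      simp only [hadd, mul_pow, map_add, map_mul, map_pow, zero_pow hq0, hn, map_natCast,
        Nat.add_sub_cancel, mul_zero, zero_add, ← pow_mul, map_one, map_natCast]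
      ring

lemma Valuation.map_const_mul_pow_add (hK : ∀ c : K, c ≠ 0 → w (algebraMap K L c) = 1) {α : K}
    (hα : α ≠ 0) {x r : L} (hr : x ≠ 0 → w r < w x) (hr0 : x = 0 → r = 0) :
    w (algebraMap K L α * x + r) = w x := by
  by_cases hx : x = 0
  · simp [hx, hr0 hx]
  · rw [w.map_add_eq_of_lt_left] <;> simp [hK α hα, hr hx]

/-- Ramification index of `diffPow (q * l + 1)` at a critical point. -/
def critIndex [DecidableEq K] (q : ℕ) (c : K) : ℕ := if c ^ q = c then q + 1 else q

lemma Valuation.map_diffPow_sub [DecidableEq K]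
    (hK : ∀ c : K, c ≠ 0 → w (algebraMap K L c) = 1)
    (hadd : ∀ a b : L, (a + b) ^ q = a ^ q + b ^ q) (hq : Odd q) (hq2 : 2 ≤ q)
    (hl : (l : K) ≠ 0) {c : K} (hc : diffPow l c = 0) {x : L}
    (hx : w (x - algebraMap K L c) < 1) :
    w (diffPow (q * l + 1) x - algebraMap K L (diffPow (q * l + 1) c)) =
      w (x - algebraMap K L c) ^ critIndex q c ∧
    w (diffPow l x) = w (x - algebraMap K L c) := by
  obtain ⟨α, β, δ, hβ, hδ, hα, hexp⟩ := exists_diffPow_expansion hK hadd hq hl hc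
  obtain ⟨⟨ρ, hρ, e⟩, σ, hσ, e'⟩ := hexp _ hx.le
  set h := x - algebraMap K L c with hh
  rw [show algebraMap K L c + h = x by rw [hh]; ring] at e e'
  have hq0 : q ≠ 0 := by lia
  by_cases h0 : h = 0
  · have : critIndex q c ≠ 0 := by unfold critIndex; split_ifs <;> lia
    simp [e, e', h0, this, hq0]
  have hpow : ∀ {m n : ℕ} {σ : L}, w σ ≤ 1 → m < n → w (σ * h ^ n) < w (h ^ m) := by
    intro m n σ hσ hmn
    rw [map_mul, map_pow, map_pow]
    calc w σ * w h ^ n ≤ 1 * w h ^ n := mul_le_mul_left hσ _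
      _ = w h ^ n := one_mul _
      _ < w h ^ m := pow_lt_pow_right_of_lt_one₀ (zero_lt_iff.2 (w.ne_zero_iff.2 h0)) hx hmn
  constructor
  · rw [e, critIndex, ← map_pow]
    split_ifs with hcq
    · rw [hα.2 hcq]
      have := w.map_const_mul_pow_add hK hβ (x := h ^ (q + 1)) (r := ρ * h ^ (2 * q))
        (fun _ ↦ hpow hρ (by lia)) (fun h1 ↦ absurd h1 (pow_ne_zero _ h0))
      rw [← this]
      congr 1
      rw [map_zero]; ring
    · have := w.map_const_mul_pow_add hK (fun h1 ↦ hcq (hα.1 h1)) (x := h ^ q)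
        (r := algebraMap K L β * h ^ (q + 1) + ρ * h ^ (2 * q))
        (fun _ ↦ w.map_add_lt (hpow (w.algebraMap_le_one hK _) (by lia)) (hpow hρ (by lia)))
        (fun h1 ↦ absurd h1 (pow_ne_zero _ h0))
      rw [← this]
      congr 1
      ring
  · have := w.map_const_mul_pow_add hK hδ (x := h ^ 1) (r := σ * h ^ 2)
        (fun _ ↦ hpow hσ (by lia)) (fun h1 ↦ absurd h1 (pow_ne_zero _ h0))
    rw [pow_one] at this
    rw [e', this]

end DiffPow

section Clusters

open Polynomial

/-- `S` is the set of solutions of `diffPow (q * l + 1) x = diffPow (q * l + 1) y`, all simple. -/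
structure IsFiber {L : Type*} [Field L] [DecidableEq L] (q l : ℕ) (y : L) (S : Finset L) :
    Prop where
  card_eq : S.card = q * l
  prod_sub : ∀ T : L, ∏ x ∈ S, (T - x) = diffPow (q * l + 1) T - diffPow (q * l + 1) y
  prod_erase : ∀ x ∈ S, ∏ x' ∈ S.erase x, (x - x') = diffPow l x ^ q

lemma IsFiber.diffPow_eq {L : Type*} [Field L] [DecidableEq L] {q l : ℕ} {y : L} {S : Finset L}
    (hS : IsFiber q l y S) {x : L} (hx : x ∈ S) :
    diffPow (q * l + 1) x = diffPow (q * l + 1) y := by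
  rw [← sub_eq_zero, ← hS.prod_sub]
  exact Finset.prod_eq_zero hx (sub_self x)

variable {K L Γ₀ : Type*} [Field K] [Field L] [Algebra K L]
  [LinearOrderedCommGroupWithZero Γ₀] {w : Valuation L Γ₀} {q l : ℕ}

/-- The product over `S` of `w (a - x)` only sees the cluster of a residue `c` of `a`. -/
lemma Valuation.prod_sub_eq_prod_filter (hK : ∀ c : K, c ≠ 0 → w (algebraMap K L c) = 1)
    (S : Finset L) (hS : ∀ x ∈ S, w x ≤ 1) {a : L} {c : K} (ha : w (a - algebraMap K L c) < 1) :
    w (∏ x ∈ S, (a - x)) = ∏ x ∈ S with w (x - algebraMap K L c) < 1, w (a - x) := by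
  rw [map_prod, Finset.prod_filter]
  refine Finset.prod_congr rfl fun x hx ↦ ?_
  split_ifs with h
  · rfl
  · have h1 : w (x - algebraMap K L c) = 1 :=
      le_antisymm (w.map_sub_le (hS x hx) (w.algebraMap_le_one hK c)) (not_lt.1 h)
    rw [show a - x = (a - algebraMap K L c) - (x - algebraMap K L c) by ring,
      w.map_sub_eq_of_lt_right (by rwa [h1]), h1]

/-- `T` is stable under the Galois group, in the sense that products over `T` are rational. -/
def IsRationalSet (K : Type*) {L : Type*} [Field K] [Field L] [Algebra K L] (y : L)
    (T : Finset L) : Prop :=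
  ∀ r : K[X], ∃ R : K[X], ∏ x ∈ T, (aeval y r - x) = aeval y R

lemma IsRationalSet.exists_prod_eq_pow (hK : ∀ c : K, c ≠ 0 → w (algebraMap K L c) = 1)
    {b c : K} {y : L} (hy : w (y - algebraMap K L b) < 1) {T : Finset L}
    (hT : IsRationalSet K y T) (hT1 : ∀ x ∈ T, w x ≤ 1) (ε : K)
    (hne : ∀ x ∈ T, w (x - algebraMap K L c) < 1 →
      x - algebraMap K L c - algebraMap K L ε * (y - algebraMap K L b) ≠ 0) :
    ∃ N : ℕ, ∏ x ∈ T with w (x - algebraMap K L c) < 1,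
      w (x - algebraMap K L c - algebraMap K L ε * (y - algebraMap K L b)) =
        w (y - algebraMap K L b) ^ N := by
  obtain ⟨R, hR⟩ := hT (C c + C ε * (X - C b))
  simp only [map_add, aeval_C, map_mul, map_sub, aeval_X] at hR
  set a := algebraMap K L c + algebraMap K L ε * (y - algebraMap K L b) with ha
  have hac : w (a - algebraMap K L c) < 1 := by
    rw [ha, add_sub_cancel_left, map_mul]
    rw [mul_comm]
    exact mul_lt_one_of_lt_of_le hy (w.algebraMap_le_one hK ε)
  have h1 := w.prod_sub_eq_prod_filter hK T hT1 hac
  have h2 : ∀ x : L, x - algebraMap K L c - algebraMap K L ε * (y - algebraMap K L b) =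
      -(a - x) := fun x ↦ by rw [ha]; ring
  simp only [h2, w.map_neg]
  rw [← h1, hR]
  have hR0 : R ≠ 0 := by
    rintro rfl
    rw [map_zero] at hR
    have h3 : ∏ x ∈ T with w (x - algebraMap K L c) < 1, w (a - x) ≠ 0 := by
      rw [Finset.prod_ne_zero_iff]
      intro x hx
      rw [Finset.mem_filter] at hx
      have := hne x hx.1 hx.2
      rw [h2, neg_ne_zero] at this
      exact w.ne_zero_iff.2 this
    exact h3 (by rw [← h1, hR, map_zero])
  exact ⟨_, w.map_aeval_eq_pow_rootMultiplicity hK hy hR0⟩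

variable [DecidableEq K]

lemma Valuation.map_sub_pow_critIndex (hK : ∀ c : K, c ≠ 0 → w (algebraMap K L c) = 1)
    (hadd : ∀ a b : L, (a + b) ^ q = a ^ q + b ^ q) (hq : Odd q) (hq2 : 2 ≤ q)
    (hl : (l : K) ≠ 0) {b c : K} (hb : diffPow l b = 0) (hc : diffPow l c = 0) {x y : L}
    (hy : w (y - algebraMap K L b) < 1) (hx : w (x - algebraMap K L c) < 1)
    (hxy : diffPow (q * l + 1) x = diffPow (q * l + 1) y) :
    diffPow (q * l + 1) c = diffPow (q * l + 1) b ∧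
      w (x - algebraMap K L c) ^ critIndex q c = w (y - algebraMap K L b) ^ critIndex q b := by
  have h1 := (w.map_diffPow_sub hK hadd hq hq2 hl hc hx).1
  have h2 := (w.map_diffPow_sub hK hadd hq hq2 hl hb hy).1
  have hne : ∀ c : K, critIndex q c ≠ 0 := fun c ↦ by unfold critIndex; split_ifs <;> lia
  have h3 : diffPow (q * l + 1) c = diffPow (q * l + 1) b := by
    by_contra h
    have h3 := w.map_sub_lt (h2.trans_lt (pow_lt_one' hy (hne b)))
      (h1.trans_lt (pow_lt_one' hx (hne c)))
    rw [hxy, sub_sub_sub_cancel_left, ← _root_.map_sub, hK _ (sub_ne_zero.2 h)] at h3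
    exact lt_irrefl _ h3
  exact ⟨h3, by rw [← h1, ← h2, hxy, h3]⟩

variable [DecidableEq L]

lemma IsFiber.card_cluster (hK : ∀ c : K, c ≠ 0 → w (algebraMap K L c) = 1)
    (hadd : ∀ a b : L, (a + b) ^ q = a ^ q + b ^ q) (hq : Odd q) (hq2 : 2 ≤ q)
    (hl : (l : K) ≠ 0) {b c : K} (hb : diffPow l b = 0) (hc : diffPow l c = 0) {y : L}
    (hy : w (y - algebraMap K L b) < 1) (hy0 : y ≠ algebraMap K L b) {S : Finset L}
    (hS : IsFiber q l y S) (hS1 : ∀ x ∈ S, w x ≤ 1)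
    (hcb : diffPow (q * l + 1) c = diffPow (q * l + 1) b) :
    (S.filter fun x ↦ w (x - algebraMap K L c) < 1).card = critIndex q c := by
  have h1 := w.prod_sub_eq_prod_filter hK S hS1 (a := algebraMap K L c) (c := c) (by simp)
  rw [hS.prod_sub, w.map_sub_swap, ← map_diffPow, hcb,
    (w.map_diffPow_sub hK hadd hq hq2 hl hb hy).1] at h1
  have h2 := congrArg (· ^ critIndex q c) h1
  simp only [← Finset.prod_pow] at h2
  rw [Finset.prod_congr rfl (g := fun _ ↦ w (y - algebraMap K L b) ^ critIndex q b)] at h2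
  · rw [Finset.prod_const, ← pow_mul, ← pow_mul] at h2
    have h3 := (pow_right_strictAnti₀ (zero_lt_iff.2 (w.ne_zero_iff.2 (sub_ne_zero.2 hy0)))
      hy).injective h2
    have hne : critIndex q b ≠ 0 := by unfold critIndex; split_ifs <;> lia
    exact (mul_left_cancel₀ hne h3).symm
  · intro x hx
    rw [Finset.mem_filter] at hx
    rw [w.map_sub_swap]
    exact (w.map_sub_pow_critIndex hK hadd hq hq2 hl hb hc hy hx.2 (hS.diffPow_eq hx.1)).2

lemma IsFiber.prod_erase_cluster (hK : ∀ c : K, c ≠ 0 → w (algebraMap K L c) = 1)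
    (hadd : ∀ a b : L, (a + b) ^ q = a ^ q + b ^ q) (hq : Odd q) (hq2 : 2 ≤ q)
    (hl : (l : K) ≠ 0) {c : K} (hc : diffPow l c = 0) {y : L} {S : Finset L}
    (hS : IsFiber q l y S) (hS1 : ∀ x ∈ S, w x ≤ 1) {x : L} (hx : x ∈ S)
    (hxc : w (x - algebraMap K L c) < 1) :
    ∏ x' ∈ (S.filter fun x ↦ w (x - algebraMap K L c) < 1).erase x, w (x - x') =
      w (x - algebraMap K L c) ^ q := by
  rw [← (w.map_diffPow_sub hK hadd hq hq2 hl hc hxc).2, ← map_pow, ← hS.prod_erase x hx,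
    w.prod_sub_eq_prod_filter hK _ (fun x' hx' ↦ hS1 x' (Finset.mem_of_mem_erase hx')) hxc,
    Finset.filter_erase]

/-- Bound for the local intersection number at a pair of critical points. -/
def critBound (q : ℕ) (b c : K) : ℕ :=
  if b ^ q = b ∧ c ^ q = c then ((q + 1) / 2) ^ 2 else q

end Clusters

section LocalBound

open Polynomial

variable {K L Γ₀ : Type*} [Field K] [Field L] [Algebra K L]
  [LinearOrderedCommGroupWithZero Γ₀] {w : Valuation L Γ₀} {q l : ℕ}

/-- Comparison of two solutions near critical points of index `q`. -/
lemma Valuation.exists_map_sub_mul_pow [IsAlgClosed K] [DecidableEq K]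
    (hK : ∀ c : K, c ≠ 0 → w (algebraMap K L c) = 1)
    (hadd : ∀ a b : L, (a + b) ^ q = a ^ q + b ^ q) (hq : Odd q) (hq2 : 2 ≤ q)
    (hl : (l : K) ≠ 0) {b c : K} (hb : diffPow l b = 0) (hc : diffPow l c = 0)
    (hbq : b ^ q ≠ b) (hcq : c ^ q ≠ c) {y : L}
    (hy : w (y - algebraMap K L b) < 1) (hy0 : y ≠ algebraMap K L b) :
    ∃ ε : K, (∀ x : L, w (x - algebraMap K L c) < 1 →
        diffPow (q * l + 1) x = diffPow (q * l + 1) y →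
        w (x - algebraMap K L c - algebraMap K L ε * (y - algebraMap K L b)) ^ q =
          w (y - algebraMap K L b) ^ (q + 1)) ∨
      ∀ x : L, w (x - algebraMap K L c) < 1 →
        diffPow (q * l + 1) x = diffPow (q * l + 1) y →
        w (x - algebraMap K L c - algebraMap K L ε * (y - algebraMap K L b)) ^ (q - 1) ≤
          w (y - algebraMap K L b) ^ q := by
  obtain ⟨α, β, _, hβ, -, hα, hexp⟩ := exists_diffPow_expansion hK hadd hq hl hc
  obtain ⟨α', β', _, -, -, -, hexp'⟩ := exists_diffPow_expansion hK hadd hq hl hb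
  replace hα : α ≠ 0 := fun h ↦ hcq (hα.1 h)
  obtain ⟨ε, hε⟩ := IsAlgClosed.exists_pow_nat_eq (α' / α) (by lia : 0 < q)
  replace hε : α * ε ^ q = α' := by rw [hε]; field_simp
  obtain ⟨⟨ρ', hρ', e'⟩, -⟩ := hexp' _ hy.le
  set k := y - algebraMap K L b with hk
  rw [show algebraMap K L b + k = y by rw [hk]; ring] at e'
  have hk0 : 0 < w k := zero_lt_iff.2 (w.ne_zero_iff.2 (sub_ne_zero.2 hy0))
  set κ := β' - β * ε ^ (q + 1) with hκ
  have key : ∀ x : L, w (x - algebraMap K L c) < 1 →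
      diffPow (q * l + 1) x = diffPow (q * l + 1) y →
      w (x - algebraMap K L c - algebraMap K L ε * k) < w k ∧
      ∃ σ, w σ ≤ w k ^ (2 * q) ∧
        w (x - algebraMap K L c - algebraMap K L ε * k) ^ q =
        w (algebraMap K L κ * k ^ (q + 1) + (-(algebraMap K L (β * ε ^ q)) * k ^ q *
          (x - algebraMap K L c - algebraMap K L ε * k) + σ)) := by
    intro x hx hxy
    obtain ⟨hcb, hw⟩ := w.map_sub_pow_critIndex hK hadd hq hq2 hl hb hc hy hx hxy
    rw [critIndex, critIndex, if_neg hbq, if_neg hcq] at hw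
    replace hw := (pow_left_inj₀ zero_le zero_le (by lia)).1 hw
    obtain ⟨⟨ρ, hρ, e⟩, -⟩ := hexp _ hx.le
    set h := x - algebraMap K L c with hh
    rw [show algebraMap K L c + h = x by rw [hh]; ring] at e
    set H := h - algebraMap K L ε * k with hH
    have hHq : H ^ q = h ^ q - algebraMap K L (ε ^ q) * k ^ q := by
      rw [hH, sub_pow_of_add_pow hadd, mul_pow, map_pow]
    have hαε : algebraMap K L α * algebraMap K L (ε ^ q) = algebraMap K L α' := by
      rw [← map_mul, hε]
    rw [← hxy, e, hcb] at e'
    have hσ : w (ρ' * k ^ (2 * q) - ρ * h ^ (2 * q)) ≤ w k ^ (2 * q) := by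
      refine w.map_sub_le ?_ ?_
      · rw [map_mul, map_pow]; exact mul_le_of_le_one_left' hρ'
      · rw [map_mul, map_pow, hw]; exact mul_le_of_le_one_left' hρ
    have hmul : ∀ (a : K) (z : L) (θ : Γ₀), w z ≤ θ → w (algebraMap K L a * z) ≤ θ :=
      fun a z θ hz ↦ by
        rw [map_mul]; exact (mul_le_of_le_one_left' (w.algebraMap_le_one hK a)).trans hz
    have e1 : algebraMap K L α * H ^ q = algebraMap K L β' * k ^ (q + 1) -
        algebraMap K L β * h ^ (q + 1) + (ρ' * k ^ (2 * q) - ρ * h ^ (2 * q)) := by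
      rw [hHq]
      linear_combination e' - k ^ q * hαε
    have e2 : (algebraMap K L α + algebraMap K L β * h) * H ^ q =
        algebraMap K L κ * k ^ (q + 1) + (-(algebraMap K L (β * ε ^ q)) * k ^ q * H +
          (ρ' * k ^ (2 * q) - ρ * h ^ (2 * q))) := by
      rw [add_mul, e1, hκ, hHq, hH]
      simp only [map_mul, _root_.map_sub, map_pow]
      ring
    have hpow : ∀ m n, m ≤ n → w k ^ n ≤ w k ^ m := fun m n hmn ↦
      pow_le_pow_right_of_le_one' hy.le hmn
    refine ⟨?_, _, hσ, ?_⟩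
    · refine lt_of_pow_lt_pow_left₀ q zero_le ?_
      calc w H ^ q = w (algebraMap K L α * H ^ q) := by rw [map_mul, hK α hα, one_mul, map_pow]
        _ ≤ w k ^ (q + 1) := by
          rw [e1]
          refine w.map_add_le (w.map_sub_le ?_ ?_) (hσ.trans (hpow _ _ (by lia)))
          · exact hmul _ _ _ (map_pow _ _ _).le
          · exact hmul _ _ _ (by rw [map_pow, hw])
        _ < w k ^ q := pow_lt_pow_right_of_lt_one₀ hk0 hy (by lia)
    · rw [← e2, map_mul, w.map_add_eq_of_lt_left, hK α hα, one_mul, map_pow]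
      rw [hK α hα, map_mul, mul_comm]
      exact mul_lt_one_of_lt_of_le hx (w.algebraMap_le_one hK β)
  refine ⟨ε, ?_⟩
  by_cases hκ0 : κ = 0
  · right
    intro x hx hxy
    obtain ⟨-, σ, hσ, e⟩ := key x hx hxy
    set H := x - algebraMap K L c - algebraMap K L ε * k
    rw [hκ0, map_zero, zero_mul, zero_add] at e
    have h1 : w (-(algebraMap K L (β * ε ^ q)) * k ^ q * H) ≤ w k ^ q * w H := by
      rw [map_mul, map_mul, w.map_neg, map_pow]
      exact mul_le_mul_left (mul_le_of_le_one_left' (w.algebraMap_le_one hK _)) _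
    rcases le_max_iff.1 (e.le.trans (w.map_add _ _)) with h2 | h2
    · replace h2 := h2.trans h1
      by_cases hH : w H = 0
      · rw [hH, zero_pow (by lia)]; exact zero_le
      · rw [show q = q - 1 + 1 by lia, pow_succ, show q - 1 + 1 = q by lia] at h2
        exact le_of_mul_le_mul_right h2 (zero_lt_iff.2 hH)
    · replace h2 := h2.trans hσ
      rw [pow_mul] at h2
      replace h2 := (pow_le_pow_iff_left₀ zero_le zero_le (by lia)).1 h2
      calc w H ^ (q - 1) ≤ (w k ^ 2) ^ (q - 1) := pow_le_pow_left₀ zero_le h2 _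
        _ = w k ^ (2 * (q - 1)) := (pow_mul _ _ _).symm
        _ ≤ w k ^ q := pow_le_pow_right_of_le_one' hy.le (by lia)
  · left
    intro x hx hxy
    obtain ⟨hlt, σ, hσ, e⟩ := key x hx hxy
    rw [e, w.map_const_mul_pow_add hK hκ0, map_pow]
    · intro _
      refine w.map_add_lt ?_ (hσ.trans_lt ?_)
      · rw [map_mul, map_mul, w.map_neg, map_pow, map_pow, pow_succ]
        exact (mul_le_mul_left (mul_le_of_le_one_left' (w.algebraMap_le_one hK _)) _).trans_lt
          (mul_lt_mul_of_pos_left hlt (pow_pos hk0 q))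
      · rw [map_pow]
        exact pow_lt_pow_right_of_lt_one₀ hk0 hy (by lia)
    · intro h
      exact absurd h (pow_ne_zero _ (sub_ne_zero.2 hy0))

variable [DecidableEq K] [DecidableEq L]

/-- Local bound for the contact of two rational factors along a pair of critical points. -/
lemma IsFiber.pow_critBound_le [IsAlgClosed K]
    (hK : ∀ c : K, c ≠ 0 → w (algebraMap K L c) = 1)
    (hadd : ∀ a b : L, (a + b) ^ q = a ^ q + b ^ q) (hq : Odd q) (hq2 : 2 ≤ q)
    (hl : (l : K) ≠ 0) {b c : K} (hb : diffPow l b = 0) (hc : diffPow l c = 0) {y : L}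
    (hy : w (y - algebraMap K L b) < 1) (hy0 : y ≠ algebraMap K L b) {S U V : Finset L}
    (hS : IsFiber q l y S) (hS1 : ∀ x ∈ S, w x ≤ 1) (hUS : U ⊆ S) (hVS : V ⊆ S)
    (hUV : Disjoint U V) (hU : IsRationalSet K y U) (hV : IsRationalSet K y V) :
    w (y - algebraMap K L b) ^ critBound q b c ≤
      ∏ x ∈ U with w (x - algebraMap K L c) < 1,
        ∏ x' ∈ V with w (x' - algebraMap K L c) < 1, w (x - x') := by
  set θ := w (y - algebraMap K L b) with hθ
  have hθ0 : θ ≠ 0 := w.ne_zero_iff.2 (sub_ne_zero.2 hy0)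
  set cl := S.filter fun x ↦ w (x - algebraMap K L c) < 1 with hcl
  set U' := U.filter fun x ↦ w (x - algebraMap K L c) < 1 with hU'
  set V' := V.filter fun x ↦ w (x - algebraMap K L c) < 1 with hV'
  have hUcl : U' ⊆ cl := Finset.filter_subset_filter _ hUS
  have hVcl : V' ⊆ cl := Finset.filter_subset_filter _ hVS
  have hUV' : Disjoint U' V' := Finset.disjoint_filter_filter hUV
  have htriv : (U'.card = 0 ∨ V'.card = 0) →
      θ ^ critBound q b c ≤ ∏ x ∈ U', ∏ x' ∈ V', w (x - x') := by
    rw [Finset.card_eq_zero, Finset.card_eq_zero]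
    rintro (h | h) <;> simp [h, pow_le_one' hy.le]
  by_cases hcb : diffPow (q * l + 1) c = diffPow (q * l + 1) b
  swap
  · refine htriv (Or.inl (Finset.card_eq_zero.2 (Finset.eq_empty_of_forall_notMem fun x hx ↦ ?_)))
    have hx' := Finset.mem_filter.1 (hUcl hx)
    exact hcb (w.map_sub_pow_critIndex hK hadd hq hq2 hl hb hc hy hx'.2 (hS.diffPow_eq hx'.1)).1
  have hcard : cl.card = critIndex q c :=
    hS.card_cluster hK hadd hq hq2 hl hb hc hy hy0 hS1 hcb
  have hsum : U'.card + V'.card ≤ critIndex q c := by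
    rw [← hcard, ← Finset.card_union_of_disjoint hUV']
    exact Finset.card_le_card (Finset.union_subset hUcl hVcl)
  have hpow : ∀ x ∈ cl, w (x - algebraMap K L c) ^ critIndex q c = θ ^ critIndex q b :=
    fun x hx ↦ (w.map_sub_pow_critIndex hK hadd hq hq2 hl hb hc hy (Finset.mem_filter.1 hx).2
      (hS.diffPow_eq (Finset.mem_filter.1 hx).1)).2
  have hi0 : critIndex q c ≠ 0 := by unfold critIndex; split_ifs <;> lia
  have hprod : ∀ x ∈ cl, ∏ x' ∈ cl.erase x, w (x - x') = w (x - algebraMap K L c) ^ q :=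
    fun x hx ↦ hS.prod_erase_cluster hK hadd hq hq2 hl hc hS1 (Finset.mem_filter.1 hx).1
      (Finset.mem_filter.1 hx).2
  have hdvd : ∀ (T : Finset L) (ε : K) (A B : ℕ), T ⊆ S → IsRationalSet K y T → A.Coprime B →
      A ≠ 0 → (∀ x ∈ T, w (x - algebraMap K L c) < 1 →
      w (x - algebraMap K L c - algebraMap K L ε * (y - algebraMap K L b)) ^ A = θ ^ B) →
      A ∣ (T.filter fun x ↦ w (x - algebraMap K L c) < 1).card := by
    intro T ε A B hTS hT hAB hA h
    obtain ⟨N, hN⟩ := hT.exists_prod_eq_pow hK hy (fun x hx ↦ hS1 x (hTS hx)) ε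
      (fun x hx hxc h0 ↦ by
        have := h x hx hxc
        rw [h0, map_zero, zero_pow hA] at this
        exact pow_ne_zero _ hθ0 this.symm)
    exact dvd_card_of_prod_eq_pow _ _ hθ0 hy hAB
      (fun x hx ↦ h x (Finset.mem_filter.1 hx).1 (Finset.mem_filter.1 hx).2) hN
  have hzero : critIndex q c ∣ U'.card → critIndex q c ∣ V'.card →
      U'.card = 0 ∨ V'.card = 0 := by
    intro h1 h2
    by_contra! h
    have := Nat.le_of_dvd (Nat.pos_of_ne_zero h.1) h1
    have := Nat.le_of_dvd (Nat.pos_of_ne_zero h.2) h2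
    lia
  by_cases hbc : critIndex q c = critIndex q b
  swap
  · have hcop : (critIndex q c).Coprime (critIndex q b) := by
      unfold critIndex at hbc ⊢
      split_ifs at hbc ⊢ <;> first | exact (hbc rfl).elim | simp
    refine htriv (hzero ?_ ?_)
    · refine hdvd U 0 _ _ hUS hU hcop hi0 fun x hx hxc ↦ ?_
      rw [map_zero, zero_mul, sub_zero]
      exact hpow x (Finset.mem_filter.2 ⟨hUS hx, hxc⟩)
    · refine hdvd V 0 _ _ hVS hV hcop hi0 fun x hx hxc ↦ ?_
      rw [map_zero, zero_mul, sub_zero]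
      exact hpow x (Finset.mem_filter.2 ⟨hVS hx, hxc⟩)
  have hwθ : ∀ x ∈ cl, w (x - algebraMap K L c) = θ := fun x hx ↦
    (pow_left_inj₀ zero_le zero_le hi0).1 (by rw [hpow x hx, hbc])
  by_cases hcq : c ^ q = c
  · have hc1 : critIndex q c = q + 1 := if_pos hcq
    have hbq : b ^ q = b := by
      by_contra h
      rw [hc1, critIndex, if_neg h] at hbc
      lia
    have hall : ∀ x ∈ cl, ∀ x' ∈ cl.erase x, w (x - x') = θ := by
      intro x hx
      refine eq_of_prod_eq_pow_card _ _ hθ0 (fun x' hx' ↦ ?_) ?_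
      · rw [← sub_sub_sub_cancel_right x x' (algebraMap K L c)]
        exact w.map_sub_le (hwθ x hx).le (hwθ x' (Finset.mem_of_mem_erase hx')).le
      · rw [hprod x hx, hwθ x hx, Finset.card_erase_of_mem hx, hcard, hc1, Nat.add_sub_cancel]
    rw [Finset.prod_congr rfl fun x hx ↦ Finset.prod_congr rfl fun x' hx' ↦
      hall x (hUcl hx) x' (Finset.mem_erase.2
        ⟨(Finset.disjoint_left.1 hUV' hx <| · ▸ hx'), hVcl hx'⟩)]
    rw [Finset.prod_const, Finset.prod_const, ← pow_mul, critBound, if_pos ⟨hbq, hcq⟩]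
    refine pow_le_pow_right_of_le_one' hy.le ?_
    obtain ⟨m, rfl⟩ := hq
    rw [hc1] at hsum
    rw [show (2 * m + 1 + 1) / 2 = m + 1 by lia]
    have h2 : U'.card + V'.card ≤ 2 * (m + 1) := by lia
    nlinarith [sq_nonneg ((U'.card : ℤ) - V'.card), Nat.pow_le_pow_left h2 2,
      four_mul_le_sq_add U'.card V'.card]
  · have hc1 : critIndex q c = q := if_neg hcq
    have hbq : b ^ q ≠ b := by
      intro h
      rw [hc1, critIndex, if_pos h] at hbc
      lia
    rw [critBound, if_neg fun h ↦ hcq h.2] at htriv ⊢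
    rw [hc1] at hsum hcard
    obtain ⟨ε, hε | hε⟩ := w.exists_map_sub_mul_pow hK hadd hq hq2 hl hb hc hbq hcq hy hy0
    · refine htriv (hzero ?_ ?_) <;> rw [hc1]
      · exact hdvd U ε _ (q + 1) hUS hU (by simp) (by lia)
          fun x hx hxc ↦ hε x hxc (hS.diffPow_eq (hUS hx))
      · exact hdvd V ε _ (q + 1) hVS hV (by simp) (by lia)
          fun x hx hxc ↦ hε x hxc (hS.diffPow_eq (hVS hx))
    · set H : L → L := fun x ↦ x - algebraMap K L c - algebraMap K L ε * (y - algebraMap K L b)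
        with hH
      have hHle : ∀ x ∈ cl, w (H x) ^ (q - 1) ≤ θ ^ q := fun x hx ↦
        hε x (Finset.mem_filter.1 hx).2 (hS.diffPow_eq (Finset.mem_filter.1 hx).1)
      have hHsub : ∀ x x', x - x' = H x - H x' := fun x x' ↦ by simp only [hH]; ring
      have hall : ∀ x ∈ cl, ∀ x' ∈ cl.erase x, w (x - x') ^ (q - 1) = θ ^ q := by
        intro x hx
        refine eq_of_prod_eq_pow_card _ _ (pow_ne_zero _ hθ0) (fun x' hx' ↦ ?_) ?_
        · rw [hHsub]
          rcases le_max_iff.1 (w.map_sub (H x) (H x')) with h | h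
          · exact (pow_le_pow_left₀ zero_le h _).trans (hHle x hx)
          · exact (pow_le_pow_left₀ zero_le h _).trans (hHle x' (Finset.mem_of_mem_erase hx'))
        · rw [Finset.prod_pow, hprod x hx, hwθ x hx, Finset.card_erase_of_mem hx, hcard]
      have hdvd' : ∀ T, T ⊆ S → IsRationalSet K y T →
          (∀ x ∈ T, w (x - algebraMap K L c) < 1 → ¬ w (H x) ^ (q - 1) < θ ^ q) →
          q - 1 ∣ (T.filter fun x ↦ w (x - algebraMap K L c) < 1).card := by
        intro T hTS hT h
        refine hdvd T ε _ q hTS hT ?_ (by lia) fun x hx hxc ↦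
          (hHle x (Finset.mem_filter.2 ⟨hTS hx, hxc⟩)).antisymm (not_lt.1 (h x hx hxc))
        conv_rhs => rw [show q = q - 1 + 1 by lia]
        simp
      have hor : q - 1 ∣ U'.card ∨ q - 1 ∣ V'.card := by
        by_contra! h
        have h1 := mt (hdvd' U hUS hU) h.1
        have h2 := mt (hdvd' V hVS hV) h.2
        push Not at h1 h2
        obtain ⟨x, hx, hxc, hxH⟩ := h1
        obtain ⟨x', hx', hxc', hxH'⟩ := h2
        have := hall x (Finset.mem_filter.2 ⟨hUS hx, hxc⟩) x' (Finset.mem_erase.2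
          ⟨(Finset.disjoint_left.1 hUV hx <| · ▸ hx'), Finset.mem_filter.2 ⟨hVS hx', hxc'⟩⟩)
        refine absurd this (ne_of_lt ?_)
        rw [hHsub]
        rcases le_max_iff.1 (w.map_sub (H x) (H x')) with h | h
        · exact (pow_le_pow_left₀ zero_le h _).trans_lt hxH
        · exact (pow_le_pow_left₀ zero_le h _).trans_lt hxH'
      have hmul : U'.card * V'.card ≤ q - 1 := by
        have aux : ∀ m n : ℕ, m + n ≤ q → q - 1 ∣ m → m * n ≤ q - 1 := by
          intro m n hmn hm
          rcases Nat.eq_zero_or_pos m with rfl | hm0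
          · simp
          · have := Nat.le_of_dvd hm0 hm
            rcases (show n = 0 ∨ n = 1 by lia) with rfl | rfl <;> lia
        rcases hor with h | h
        · exact aux _ _ hsum h
        · rw [mul_comm]; exact aux _ _ (by lia) h
      refine (pow_le_pow_iff_left₀ zero_le zero_le (by lia : q - 1 ≠ 0)).1 ?_
      simp only [← Finset.prod_pow]
      rw [Finset.prod_congr rfl fun x hx ↦ Finset.prod_congr rfl fun x' hx' ↦
        hall x (hUcl hx) x' (Finset.mem_erase.2
          ⟨(Finset.disjoint_left.1 hUV' hx <| · ▸ hx'), hVcl hx'⟩)]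
      rw [Finset.prod_const, Finset.prod_const, ← pow_mul, ← pow_mul,
        ← pow_mul, mul_comm V'.card, pow_mul, pow_mul θ]
      exact pow_le_pow_right_of_le_one' (pow_le_one' hy.le q) hmul

end LocalBound

section FiniteBound

open Polynomial

lemma natDegree_diffPow_X {R : Type*} [CommRing R] {t : ℕ} (ht : (t : R) ≠ 0) :
    (diffPow t (X : R[X])).natDegree = t - 1 := by
  have ht0 : t ≠ 0 := by rintro rfl; simp at ht
  have hcoeff : ∀ k, (diffPow t (X : R[X])).coeff k =
      (t.choose k : R) - if k = t then 1 else 0 := by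
    intro k
    rw [diffPow, coeff_sub, coeff_X_add_one_pow, coeff_X_pow]
  refine natDegree_eq_of_le_of_coeff_ne_zero ?_ ?_
  · rw [natDegree_le_iff_coeff_eq_zero]
    intro k hk
    rw [hcoeff]
    rcases (show k = t ∨ t < k by lia) with rfl | hk
    · simp
    · simp [Nat.choose_eq_zero_of_lt hk, hk.ne']
  · rw [hcoeff, if_neg (by lia), sub_zero, Nat.choose_symm_of_eq_add (b := 1) (by lia)]
    simpa using ht

lemma leadingCoeff_diffPow_X {R : Type*} [CommRing R] {t : ℕ} (ht : (t : R) ≠ 0) :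
    (diffPow t (X : R[X])).leadingCoeff = t := by
  have ht0 : t ≠ 0 := by rintro rfl; simp at ht
  rw [leadingCoeff, natDegree_diffPow_X ht, diffPow, coeff_sub, coeff_X_add_one_pow, coeff_X_pow,
    if_neg (by lia), sub_zero, Nat.choose_symm_of_eq_add (b := 1) (by lia), Nat.choose_one_right]

variable {K L Γ₀ : Type*} [Field K] [Field L] [Algebra K L]
  [LinearOrderedCommGroupWithZero Γ₀] {w : Valuation L Γ₀} {q l : ℕ}

lemma aeval_diffPow_X (t : ℕ) (x : L) : aeval x (diffPow t (X : K[X])) = diffPow t x := by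
  simp [diffPow]

lemma Valuation.exists_isRoot_of_map_aeval_lt_one [IsAlgClosed K]
    (hK : ∀ c : K, c ≠ 0 → w (algebraMap K L c) = 1) {F : K[X]} (hF : F ≠ 0) {x : L}
    (hx : w (aeval x F) < 1) : ∃ c, F.IsRoot c ∧ w (x - algebraMap K L c) < 1 := by
  by_contra! h
  have h1 : aeval x F = algebraMap K L F.leadingCoeff *
      (F.roots.map fun c ↦ x - algebraMap K L c).prod := by
    conv_lhs => rw [(IsAlgClosed.splits F).eq_prod_roots]
    simp [map_multiset_prod]
  rw [h1, map_mul, hK _ (leadingCoeff_ne_zero.2 hF), one_mul, map_multiset_prod,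
    Multiset.map_map] at hx
  refine hx.not_ge (Multiset.one_le_prod_of_one_le ?_)
  intro a ha
  obtain ⟨c, hc, rfl⟩ := Multiset.mem_map.1 ha
  exact h c (isRoot_of_mem_roots hc)

lemma Valuation.map_diffPow_of_one_lt (hK : ∀ c : K, c ≠ 0 → w (algebraMap K L c) = 1)
    {t : ℕ} (ht : (t : K) ≠ 0) {x : L} (hx : 1 < w x) : w (diffPow t x) = w x ^ (t - 1) := by
  have h0 : diffPow t (X : K[X]) ≠ 0 := fun h ↦ by
    have := leadingCoeff_diffPow_X ht
    rw [h, leadingCoeff_zero] at this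
    exact ht this.symm
  rw [← aeval_diffPow_X (K := K), w.map_aeval_eq_pow_natDegree hK hx h0, natDegree_diffPow_X ht]

/-- Solutions of the fiber equation are no larger than `max 1 (w y)`. -/
lemma Valuation.map_le_of_diffPow_eq (hK : ∀ c : K, c ≠ 0 → w (algebraMap K L c) = 1)
    {t : ℕ} (ht : (t : K) ≠ 0) (ht2 : 2 ≤ t) {x y : L} (hxy : diffPow t x = diffPow t y) :
    w x ≤ max 1 (w y) := by
  by_contra! h
  obtain ⟨h1, h2⟩ := max_lt_iff.1 h
  have h3 := w.map_diffPow_of_one_lt hK ht h1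
  rw [hxy] at h3
  rcases le_or_gt (w y) 1 with hy | hy
  · have h4 : w (diffPow t y) ≤ 1 := by
      rw [← aeval_diffPow_X (K := K)]
      exact w.map_aeval_le_one hK hy _
    exact (one_lt_pow₀ h1 (by lia : t - 1 ≠ 0)).not_ge (h3 ▸ h4)
  · rw [w.map_diffPow_of_one_lt hK ht hy] at h3
    exact h2.ne ((pow_left_inj₀ zero_le zero_le (by lia)).1 h3)

variable [DecidableEq K] [DecidableEq L]

/-- Bound for the order of vanishing at a critical point of the resultant of two factors. -/
lemma IsFiber.rootMultiplicity_le [IsAlgClosed K]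
    (hadd : ∀ a b : L, (a + b) ^ q = a ^ q + b ^ q) (hq : Odd q) (hq2 : 2 ≤ q)
    (hl : (l : K) ≠ 0) (hqK : (q : K) = 0) {y : L} (hy : Transcendental K y)
    {S U V : Finset L} (hS : IsFiber q l y S) (hUS : U ⊆ S) (hVS : V ⊆ S)
    (hUV : Disjoint U V) (hU : IsRationalSet K y U) (hV : IsRationalSet K y V)
    {R : K[X]} (hR0 : R ≠ 0) (hR : ∏ x ∈ U, ∏ x' ∈ V, (x - x') = aeval y R)
    {Z : Finset K} (hZ : ∀ c, c ∈ Z ↔ diffPow l c = 0) {b : K} (hb : b ∈ Z) :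
    R.rootMultiplicity b ≤ ∑ c ∈ Z, critBound q b c := by
  have hyb : Transcendental K (y - algebraMap K L b) := by
    intro h
    exact hy (by simpa using h.add (isAlgebraic_algebraMap b))
  obtain ⟨A, hK, hyb1⟩ := exists_valuationSubring_of_transcendental hyb
  set w := A.valuation
  have hy0 : y ≠ algebraMap K L b := by
    rintro rfl
    exact hy (isAlgebraic_algebraMap b)
  have hl0 : l ≠ 0 := by rintro rfl; simp at hl
  have hy1 : w y ≤ 1 := by
    have := w.map_add_le hyb1.le (w.algebraMap_le_one hK b)
    simpa using this
  have hS1 : ∀ x ∈ S, w x ≤ 1 := fun x hx ↦ by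
    have := w.map_le_of_diffPow_eq hK (by simp [hqK] : ((q * l + 1 : ℕ) : K) ≠ 0)
      (by nlinarith [Nat.pos_of_ne_zero hl0]) (hS.diffPow_eq hx)
    rwa [max_eq_left hy1] at this
  have h := w.pow_sum_le_prod_prod hK U V Z (critBound q b) (θ := w (y - algebraMap K L b))
    (fun x hx x' hx' ↦ w.map_sub_le (hS1 x (hUS hx)) (hS1 x' (hVS hx'))) ?_
    (fun c hc ↦ hS.pow_critBound_le hK hadd hq hq2 hl ((hZ b).1 hb) ((hZ c).1 hc) hyb1 hy0 hS1
      hUS hVS hUV hU hV)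
  · simp only [← map_prod] at h
    rw [hR, w.map_aeval_eq_pow_rootMultiplicity hK hyb1 hR0] at h
    exact (pow_le_pow_iff_right_of_lt_one₀
      (zero_lt_iff.2 (w.ne_zero_iff.2 (sub_ne_zero.2 hy0))) hyb1).1 h
  · intro x hx x' hx' hlt
    have h1 : w (diffPow l x) < 1 := by
      by_contra! h1
      have h2 := congrArg w (hS.prod_erase x (hUS hx))
      have hmem : x' ∈ S.erase x :=
        Finset.mem_erase.2 ⟨(Finset.disjoint_left.1 hUV hx <| · ▸ hx'), hVS hx'⟩
      rw [map_prod, map_pow, ← Finset.mul_prod_erase _ _ hmem] at h2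
      refine ((one_le_pow₀ h1 (n := q)).trans_eq h2.symm).not_gt (mul_lt_one_of_lt_of_le hlt ?_)
      exact Finset.prod_le_one' fun x'' hx'' ↦ w.map_sub_le (hS1 x (hUS hx))
        (hS1 x'' (Finset.mem_of_mem_erase (Finset.mem_of_mem_erase hx'')))
    rw [← aeval_diffPow_X (K := K)] at h1
    obtain ⟨c, hc, hxc⟩ := w.exists_isRoot_of_map_aeval_lt_one hK (fun h0 ↦ by
      have := leadingCoeff_diffPow_X hl
      rw [h0, leadingCoeff_zero] at this
      exact hl this.symm) h1
    refine ⟨c, (hZ c).2 ?_, hxc⟩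
    simpa [IsRoot, diffPow] using hc

end FiniteBound

section InfiniteBound

open Polynomial

variable {K L Γ₀ : Type*} [Field K] [Field L] [Algebra K L]
  [LinearOrderedCommGroupWithZero Γ₀] {w : Valuation L Γ₀} {q l : ℕ}

lemma Valuation.map_natCast_le_one (w : Valuation L Γ₀) (n : ℕ) : w (n : L) ≤ 1 := by
  rw [← map_natCast w.integer.subtype]
  exact (n : w.integer).2

/-- Expansion of `diffPow` in the coordinate `z` at infinity. -/
lemma Valuation.exists_pow_mul_diffPow (w : Valuation L Γ₀)
    (hadd : ∀ a b : L, (a + b) ^ q = a ^ q + b ^ q) (hq2 : 2 ≤ q) (hl0 : l ≠ 0) {z x : L}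
    (hz : z ≠ 0) (hz1 : w z ≤ 1) (hs : w (x * z) ≤ 1) :
    (∃ ρ, w ρ ≤ 1 ∧ z ^ (q * l) * diffPow (q * l + 1) x = ((x * z) ^ l) ^ q +
      (l : L) ^ q * z ^ (q - 1) * (x * z) ^ (q * (l - 1) + 1) + ρ * z ^ q) ∧
    ∃ k, w k ≤ 1 ∧ z ^ (l - 1) * diffPow l x = l * (x * z) ^ (l - 1) + k * z := by
  obtain ⟨k, hk, e⟩ := w.exists_add_pow_eq hs hz1 l
  obtain ⟨m, rfl⟩ : ∃ m, l = m + 1 := Nat.exists_eq_succ_of_ne_zero hl0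
  obtain ⟨n, rfl⟩ : ∃ n, q = n + 1 := Nat.exists_eq_succ_of_ne_zero (by lia)
  set s := x * z with hsd
  have hP : z ^ m * diffPow (m + 1) x = ((m + 1 : ℕ) : L) * s ^ m + k * z := by
    refine mul_left_cancel₀ hz ?_
    rw [show s + z = (x + 1) * z by rw [hsd]; ring, Nat.add_sub_cancel] at e
    rw [diffPow, ← mul_assoc, ← pow_succ', mul_sub, ← mul_pow, ← mul_pow, mul_comm z, mul_comm z, e,
      hsd]
    ring
  refine ⟨⟨s * z ^ n * k ^ (n + 1) + ((m + 1 : ℕ) * s ^ m + k * z) ^ (n + 1), ?_, ?_⟩, k, hk, hP⟩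
  · have h1 := w.map_natCast_le_one (m + 1)
    refine w.map_add_le ?_ ?_
    · simp only [map_mul, map_pow]
      exact mul_le_one' (mul_le_one' hs (pow_le_one' hz1 _)) (pow_le_one' hk _)
    · rw [map_pow]
      refine pow_le_one' (w.map_add_le ?_ ?_) _
      · simp only [map_mul, map_pow]
        exact mul_le_one' h1 (pow_le_one' hs _)
      · rw [map_mul]
        exact mul_le_one' hk hz1
  · have h2 : z ^ ((n + 1) * (m + 1)) * diffPow ((n + 1) * (m + 1) + 1) x =
        s * z ^ n * (z ^ m * diffPow (m + 1) x) ^ (n + 1) + ((s + z) ^ (m + 1)) ^ (n + 1) := by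
      rw [diffPow_mul_add_one hadd, mul_pow, hsd, show x * z + z = (x + 1) * z by ring, mul_pow]
      simp only [mul_pow, ← pow_mul]
      ring
    have hT := hadd ((m + 1 : ℕ) * s ^ m) (k * z)
    have e' : (s + z) ^ (m + 1) = s ^ (m + 1) + ((m + 1 : ℕ) * s ^ m + k * z) * z := by
      rw [e, Nat.add_sub_cancel]; ring
    rw [h2, hP, e', hadd (s ^ (m + 1))]
    clear_value s
    generalize ((m + 1 : ℕ) : L) * s ^ m + k * z = T at *
    simp only [mul_pow, ← pow_mul, Nat.add_sub_cancel] at hT ⊢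
    linear_combination s * z ^ n * hT

/-- The scaled solutions cluster around `l`-th roots of unity at infinity. -/
lemma Valuation.map_mul_sub_rootOfUnity (hK : ∀ c : K, c ≠ 0 → w (algebraMap K L c) = 1)
    (hadd : ∀ a b : L, (a + b) ^ q = a ^ q + b ^ q) (hq2 : 2 ≤ q)
    (hl : (l : K) ≠ 0) {x y : L} (hy : 1 < w y) (hs : w (x * y⁻¹) ≤ 1)
    (hxy : diffPow (q * l + 1) x = diffPow (q * l + 1) y) :
    w ((x * y⁻¹) ^ l - 1) < 1 ∧ ∀ ζ : K, ζ ^ l = 1 → w (x * y⁻¹ - algebraMap K L ζ) < 1 →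
      (ζ ^ q = ζ → w (x * y⁻¹ - algebraMap K L ζ) ≤ w y⁻¹) ∧
      (ζ ^ q ≠ ζ → w (x * y⁻¹ - algebraMap K L ζ) ^ q = w y⁻¹ ^ (q - 1)) := by
  have hl0 : l ≠ 0 := by rintro rfl; simp at hl
  have hy0 : y ≠ 0 := by rintro rfl; simp at hy
  set z := y⁻¹ with hzd
  have hz : z ≠ 0 := inv_ne_zero hy0
  have hz1 : w z < 1 := by rw [hzd, map_inv₀]; exact inv_lt_one_of_one_lt₀ hy
  have hyz : y * z = 1 := mul_inv_cancel₀ hy0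
  obtain ⟨⟨ρ, hρ, e⟩, -⟩ := w.exists_pow_mul_diffPow hadd hq2 hl0 hz hz1.le hs
  obtain ⟨⟨ρ', hρ', e'⟩, -⟩ := w.exists_pow_mul_diffPow hadd hq2 hl0 hz hz1.le
    (x := y) (by rw [hyz, map_one])
  rw [hxy, e', hyz] at e
  set s := x * z with hsd
  have hz0 : 0 < w z := zero_lt_iff.2 (w.ne_zero_iff.2 hz)
  have e1 : (s ^ l - 1) ^ q = -((l : L) ^ q) * z ^ (q - 1) * (s ^ (q * (l - 1) + 1) - 1) +
      (ρ' - ρ) * z ^ q := by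
    rw [sub_pow_of_add_pow hadd, one_pow]
    linear_combination -e
  have hρz : w ((ρ' - ρ) * z ^ q) ≤ w z ^ q := by
    rw [map_mul, map_pow]
    exact mul_le_of_le_one_left' (w.map_sub_le hρ' hρ)
  have hlq : w (-((l : L) ^ q)) = 1 := by
    rw [w.map_neg, map_pow, ← map_natCast (algebraMap K L), hK _ hl, one_pow]
  have hzq : w z ^ q < w z ^ (q - 1) := pow_lt_pow_right_of_lt_one₀ hz0 hz1 (by lia)
  constructor
  · have h1 : w (s ^ l - 1) ^ q ≤ w z ^ (q - 1) := by
      rw [← map_pow, e1]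
      refine w.map_add_le ?_ (hρz.trans hzq.le)
      rw [map_mul, map_mul, hlq, one_mul, map_pow]
      refine mul_le_of_le_one_right' (w.map_sub_le ?_ w.map_one.le)
      rw [map_pow]
      exact pow_le_one' hs _
    refine lt_of_pow_lt_pow_left₀ q zero_le ?_
    rw [one_pow]
    exact h1.trans_lt (pow_lt_one' hz1 (by lia))
  · intro ζ hζ hη
    set η := s - algebraMap K L ζ with hηd
    have hsη : s = algebraMap K L ζ + η := by rw [hηd]; ring
    have hζ0 : ζ ≠ 0 := by rintro rfl; simp [hl0] at hζ
    obtain ⟨k, hk, f⟩ := w.exists_add_pow_eq (w.algebraMap_le_one hK ζ) hη.le l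
    obtain ⟨k', hk', f'⟩ := w.exists_add_pow_eq (w.algebraMap_le_one hK ζ) hη.le
      (q * (l - 1) + 1)
    rw [← hsη] at f f'
    have hwη : w (s ^ l - 1) = w η := by
      have h1 : s ^ l - 1 = algebraMap K L (l * ζ ^ (l - 1)) * η + k * η ^ 2 := by
        have hζ' := congrArg (algebraMap K L) hζ
        rw [map_pow, map_one] at hζ'
        rw [f, hζ', map_mul, map_pow, map_natCast]
        ring
      rw [h1, w.map_const_mul_pow_add hK (mul_ne_zero hl (pow_ne_zero _ hζ0))]
      · intro h0
        rw [map_mul, map_pow, pow_two, ← mul_assoc]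
        have hη0 : 0 < w η := zero_lt_iff.2 (w.ne_zero_iff.2 h0)
        calc w k * w η * w η ≤ w η * w η := mul_le_mul_left (mul_le_of_le_one_left' hk) _
          _ < 1 * w η := mul_lt_mul_of_pos_right hη hη0
          _ = w η := one_mul _
      · rintro h0; simp [h0]
    have hζq : ζ ^ (q * (l - 1) + 1) = 1 ↔ ζ ^ q = ζ := by
      have h1 : ζ ^ (q * (l - 1) + 1) * ζ ^ q = ζ := by
        rw [← pow_add, show q * (l - 1) + 1 + q = l * q + 1 by
          obtain ⟨m, rfl⟩ := Nat.exists_eq_succ_of_ne_zero hl0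
          simp only [Nat.succ_eq_add_one, Nat.add_sub_cancel]; ring,
          pow_succ, pow_mul, hζ, one_pow, one_mul]
      constructor
      · intro h; rw [h, one_mul] at h1; exact h1
      · intro h
        rw [h] at h1
        exact mul_right_cancel₀ hζ0 (h1.trans (one_mul _).symm)
    obtain ⟨κ, hκ, f''⟩ : ∃ κ, w κ ≤ 1 ∧ s ^ (q * (l - 1) + 1) - 1 =
        algebraMap K L (ζ ^ (q * (l - 1) + 1) - 1) + κ * η := by
      refine ⟨((q * (l - 1) + 1 : ℕ) : L) * algebraMap K L ζ ^ (q * (l - 1) + 1 - 1) + k' * η,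
        w.map_add_le ?_ ?_, ?_⟩
      · rw [map_mul, map_pow]
        exact mul_le_one' (w.map_natCast_le_one _) (pow_le_one' (w.algebraMap_le_one hK ζ) _)
      · rw [map_mul]
        exact mul_le_one' hk' hη.le
      · rw [f', _root_.map_sub, map_pow, map_one]
        ring
    have hκη : w (κ * η) ≤ w η := by rw [map_mul]; exact mul_le_of_le_one_left' hκ
    have e2 := congrArg w e1
    rw [map_pow, hwη] at e2
    constructor
    · intro h
      rw [f'', hζq.2 h, sub_self, map_zero, zero_add] at e2
      have h1 : w (-((l : L) ^ q) * z ^ (q - 1) * (κ * η)) ≤ w z ^ (q - 1) * w η := by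
        rw [map_mul, map_mul, hlq, one_mul, map_pow]
        exact mul_le_mul_right hκη _
      rcases le_max_iff.1 (e2.le.trans (w.map_add _ _)) with h2 | h2
      · replace h2 := h2.trans h1
        by_cases hη0 : w η = 0
        · rw [hη0]; exact zero_le
        · rw [show w η ^ q = w η ^ (q - 1) * w η by
            rw [← pow_succ, Nat.sub_add_cancel (by lia)]] at h2
          exact (pow_le_pow_iff_left₀ zero_le zero_le (by lia)).1
            (le_of_mul_le_mul_right h2 (zero_lt_iff.2 hη0))
      · exact (pow_le_pow_iff_left₀ zero_le zero_le (by lia)).1 (h2.trans hρz)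
    · intro h
      have h1 : ζ ^ (q * (l - 1) + 1) - 1 ≠ 0 := sub_ne_zero.2 (mt hζq.1 h)
      have h2 : w (s ^ (q * (l - 1) + 1) - 1) = 1 := by
        rw [f'', w.map_add_eq_of_lt_left, hK _ h1]
        rw [hK _ h1]
        exact hκη.trans_lt hη
      have h3 : w (-((l : L) ^ q) * z ^ (q - 1) * (s ^ (q * (l - 1) + 1) - 1)) =
          w z ^ (q - 1) := by
        rw [map_mul, map_mul, hlq, h2, map_pow, one_mul, mul_one]
      rw [e2, w.map_add_eq_of_lt_left, h3]
      rw [h3]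
      exact hρz.trans_lt hzq

end InfiniteBound

section InfiniteBound

open Polynomial

variable {K L Γ₀ : Type*} [Field K] [Field L] [Algebra K L]
  [LinearOrderedCommGroupWithZero Γ₀] {w : Valuation L Γ₀} {q l : ℕ}

/-- Bound for the contact at infinity of two factors near a root of unity. -/
def infBound [DecidableEq K] (q : ℕ) (ζ : K) : ℕ :=
  if ζ ^ q = ζ then (q - 1) * ((q - 1) / 2) else 0

lemma IsRationalSet.dvd_card_of_one_lt (hK : ∀ c : K, c ≠ 0 → w (algebraMap K L c) = 1)
    {y : L} (hy : 1 < w y) {T : Finset L} (hT : IsRationalSet K y T)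
    (hT1 : ∀ x ∈ T, w (x * y⁻¹) ≤ 1) (ζ : K) {A B : ℕ} (hA : A ≠ 0) (hAB : A.Coprime B)
    (hw : ∀ x ∈ T, w (x * y⁻¹ - algebraMap K L ζ) < 1 →
      w (x * y⁻¹ - algebraMap K L ζ) ^ A = w y⁻¹ ^ B) :
    A ∣ (T.filter fun x ↦ w (x * y⁻¹ - algebraMap K L ζ) < 1).card := by
  have hy0 : y ≠ 0 := by rintro rfl; simp at hy
  have hz0 : w y⁻¹ ≠ 0 := w.ne_zero_iff.2 (inv_ne_zero hy0)
  have hz1 : w y⁻¹ < 1 := by rw [map_inv₀]; exact inv_lt_one_of_one_lt₀ hy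
  obtain ⟨R, hR⟩ := hT (C ζ * X)
  rw [map_mul, aeval_C, aeval_X] at hR
  have hle : ∀ x ∈ T, w (x * y⁻¹ - algebraMap K L ζ) ≤ 1 := fun x hx ↦
    w.map_sub_le (hT1 x hx) (w.algebraMap_le_one hK ζ)
  have hprod : ∏ x ∈ T with w (x * y⁻¹ - algebraMap K L ζ) < 1,
      w (x * y⁻¹ - algebraMap K L ζ) = w y⁻¹ ^ T.card * w (aeval y R) := by
    rw [← hR, map_prod, ← Finset.prod_const, ← Finset.prod_mul_distrib, Finset.prod_filter]
    refine Finset.prod_congr rfl fun x hx ↦ ?_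
    have h : w y⁻¹ * w (algebraMap K L ζ * y - x) = w (x * y⁻¹ - algebraMap K L ζ) := by
      rw [← map_mul, ← w.map_neg]
      congr 1
      field_simp
      ring
    rw [h]
    split_ifs with h1
    · rfl
    · exact (hle x hx).antisymm' (not_lt.1 h1)
  have hne : ∏ x ∈ T with w (x * y⁻¹ - algebraMap K L ζ) < 1,
      w (x * y⁻¹ - algebraMap K L ζ) ≠ 0 := by
    refine Finset.prod_ne_zero_iff.2 fun x hx h0 ↦ ?_
    have h1 := hw x (Finset.mem_filter.1 hx).1 (Finset.mem_filter.1 hx).2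
    rw [h0, zero_pow hA] at h1
    exact pow_ne_zero _ hz0 h1.symm
  have hR0 : R ≠ 0 := by
    rintro rfl
    rw [hprod, map_zero, map_zero, mul_zero] at hne
    exact hne rfl
  have hmul : (∏ x ∈ T with w (x * y⁻¹ - algebraMap K L ζ) < 1,
      w (x * y⁻¹ - algebraMap K L ζ)) * w y⁻¹ ^ R.natDegree = w y⁻¹ ^ T.card := by
    rw [hprod, w.map_aeval_eq_pow_natDegree hK hy hR0, mul_assoc, ← mul_pow, ← map_mul,
      mul_inv_cancel₀ hy0, map_one, one_pow, mul_one]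
  have hdeg : R.natDegree ≤ T.card := by
    refine (pow_le_pow_iff_right_of_lt_one₀ (zero_lt_iff.2 hz0) hz1).1 ?_
    rw [← hmul]
    exact mul_le_of_le_one_left' (Finset.prod_le_one' fun x hx ↦ hle x (Finset.mem_filter.1 hx).1)
  refine dvd_card_of_prod_eq_pow _ _ (N := T.card - R.natDegree) hz0 hz1 hAB
    (fun x hx ↦ hw x (Finset.mem_filter.1 hx).1 (Finset.mem_filter.1 hx).2) ?_
  refine mul_right_cancel₀ (pow_ne_zero R.natDegree hz0) ?_
  rw [hmul, ← pow_add, Nat.sub_add_cancel hdeg]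

variable [DecidableEq K] [DecidableEq L]

/-- Local bound at infinity for the contact of two rational factors near a root of unity. -/
lemma IsFiber.pow_infBound_le (hK : ∀ c : K, c ≠ 0 → w (algebraMap K L c) = 1)
    (hadd : ∀ a b : L, (a + b) ^ q = a ^ q + b ^ q) (hq : Odd q) (hq2 : 2 ≤ q)
    (hl : (l : K) ≠ 0) {y : L} (hy : 1 < w y) {S U V : Finset L}
    (hS : IsFiber q l y S) (hS1 : ∀ x ∈ S, w (x * y⁻¹) ≤ 1) (hUS : U ⊆ S) (hVS : V ⊆ S)
    (hUV : Disjoint U V) (hU : IsRationalSet K y U) (hV : IsRationalSet K y V)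
    {ζ : K} (hζ : ζ ^ l = 1) :
    w y⁻¹ ^ infBound q ζ ≤ ∏ x ∈ U with w (x * y⁻¹ - algebraMap K L ζ) < 1,
      ∏ x' ∈ V with w (x' * y⁻¹ - algebraMap K L ζ) < 1, w (x * y⁻¹ - x' * y⁻¹) := by
  have hl0 : l ≠ 0 := by rintro rfl; simp at hl
  have hy0 : y ≠ 0 := by rintro rfl; simp at hy
  have hz0 : w y⁻¹ ≠ 0 := w.ne_zero_iff.2 (inv_ne_zero hy0)
  have hz1 : w y⁻¹ < 1 := by rw [map_inv₀]; exact inv_lt_one_of_one_lt₀ hy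
  set cl := S.filter fun x ↦ w (x * y⁻¹ - algebraMap K L ζ) < 1 with hcl
  set U' := U.filter fun x ↦ w (x * y⁻¹ - algebraMap K L ζ) < 1 with hU'
  set V' := V.filter fun x ↦ w (x * y⁻¹ - algebraMap K L ζ) < 1 with hV'
  have hUcl : U' ⊆ cl := Finset.filter_subset_filter _ hUS
  have hVcl : V' ⊆ cl := Finset.filter_subset_filter _ hVS
  have hUV' : Disjoint U' V' := Finset.disjoint_filter_filter hUV
  have hsum : U'.card + V'.card ≤ cl.card := by
    rw [← Finset.card_union_of_disjoint hUV']
    exact Finset.card_le_card (Finset.union_subset hUcl hVcl)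
  have hle : ∀ x ∈ S, ∀ x' ∈ S, w (x * y⁻¹ - x' * y⁻¹) ≤ 1 := fun x hx x' hx' ↦
    w.map_sub_le (hS1 x hx) (hS1 x' hx')
  have hcls : ∀ x ∈ cl, x ∈ S ∧ w (x * y⁻¹ - algebraMap K L ζ) < 1 := fun x hx ↦
    Finset.mem_filter.1 hx
  have hloc : ∀ x ∈ cl, _ := fun x hx ↦
    (w.map_mul_sub_rootOfUnity hK hadd hq2 hl hy (hS1 x (hcls x hx).1)
      (hS.diffPow_eq (hcls x hx).1)).2 ζ hζ (hcls x hx).2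
  have hζ0 : ζ ≠ 0 := by rintro rfl; simp [hl0] at hζ
  have hprod : ∀ x ∈ cl, ∏ x' ∈ cl.erase x, w (x * y⁻¹ - x' * y⁻¹) = w y⁻¹ ^ (q - 1) := by
    intro x hx
    have hone : w (x * y⁻¹) = 1 := by
      have h1 := w.map_add_eq_of_lt_right (x := x * y⁻¹ - algebraMap K L ζ)
        (y := algebraMap K L ζ) (by rw [hK _ hζ0]; exact (hcls x hx).2)
      rwa [sub_add_cancel, hK _ hζ0] at h1
    have hlK : w (l : L) = 1 := by rw [← map_natCast (algebraMap K L), hK _ hl]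
    obtain ⟨-, k, hk, e⟩ := w.exists_pow_mul_diffPow hadd hq2 hl0 (inv_ne_zero hy0) hz1.le
      (hS1 x (hcls x hx).1)
    have h2 : w (y⁻¹ ^ (l - 1) * diffPow l x) = 1 := by
      have h3 : w (l * (x * y⁻¹) ^ (l - 1)) = 1 := by
        rw [map_mul, hlK, map_pow, hone, one_pow, one_mul]
      rw [e, w.map_add_eq_of_lt_left, h3]
      rw [h3, map_mul, mul_comm]
      exact mul_lt_one_of_lt_of_le hz1 hk
    rw [map_mul, map_pow] at h2
    have h4 : ∏ x' ∈ cl.erase x, w (x * y⁻¹ - x' * y⁻¹) =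
        ∏ x' ∈ S.erase x, w (x * y⁻¹ - x' * y⁻¹) := by
      refine Finset.prod_subset (Finset.erase_subset_erase x (Finset.filter_subset _ _))
        fun x' hx' hx'' ↦ ?_
      obtain ⟨hne, hx'S⟩ := Finset.mem_erase.1 hx'
      refine (hle x (hcls x hx).1 x' hx'S).antisymm (not_lt.1 fun hlt ↦ hx'' ?_)
      refine Finset.mem_erase.2 ⟨hne, Finset.mem_filter.2 ⟨hx'S, ?_⟩⟩
      have := w.map_sub_lt (hcls x hx).2 hlt
      rwa [sub_sub_sub_cancel_left] at this
    have h5 : q * l - 1 = (q - 1) + (l - 1) * q := by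
      obtain ⟨m, rfl⟩ := Nat.exists_eq_succ_of_ne_zero hl0
      obtain ⟨n, rfl⟩ : ∃ n, q = n + 1 := Nat.exists_eq_succ_of_ne_zero (by lia)
      rw [show (n + 1) * (m + 1) = n + m * (n + 1) + 1 by ring]
      simp only [Nat.succ_eq_add_one, Nat.add_sub_cancel]
    rw [h4]
    simp only [← sub_mul, map_mul]
    rw [Finset.prod_mul_distrib, Finset.prod_const, Finset.card_erase_of_mem (hcls x hx).1,
      hS.card_eq, h5, pow_add, ← map_prod, hS.prod_erase x (hcls x hx).1, map_pow, pow_mul,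
      mul_left_comm, mul_comm (w (diffPow l x) ^ q), ← mul_pow, h2, one_pow, mul_one]
  have hpair : ∀ x ∈ U', ∀ x' ∈ V', x' ∈ cl.erase x := fun x hx x' hx' ↦
    Finset.mem_erase.2 ⟨(Finset.disjoint_left.1 hUV' hx <| · ▸ hx'), hVcl hx'⟩
  by_cases hζq : ζ ^ q = ζ
  · have hcard : cl.card ≤ q := by
      rcases cl.eq_empty_or_nonempty with h0 | ⟨x, hx⟩
      · simp [h0]
      have h1 : w y⁻¹ ^ (q - 1) ≤ w y⁻¹ ^ (cl.erase x).card := by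
        rw [← hprod x hx]
        refine Finset.prod_le_pow_card _ _ _ fun x' hx' ↦ ?_
        rw [← sub_sub_sub_cancel_right _ _ (algebraMap K L ζ)]
        exact w.map_sub_le ((hloc x hx).1 hζq)
          ((hloc x' (Finset.mem_of_mem_erase hx')).1 hζq)
      have h2 := (pow_le_pow_iff_right_of_lt_one₀ (zero_lt_iff.2 hz0) hz1).1 h1
      rw [Finset.card_erase_of_mem hx] at h2
      lia
    have hUle : w y⁻¹ ^ ((q - 1) * U'.card) ≤
        ∏ x ∈ U', ∏ x' ∈ V', w (x * y⁻¹ - x' * y⁻¹) := by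
      rw [pow_mul]
      refine Finset.pow_card_le_prod _ _ _ fun x hx ↦ ?_
      rw [← hprod x (hUcl hx)]
      exact Finset.prod_le_prod_of_subset_of_le_one' (fun x' hx' ↦ hpair x hx x' hx')
        fun x' hx' _ ↦ hle _ (hcls x (hUcl hx)).1 _ (hcls x' (Finset.mem_of_mem_erase hx')).1
    have hVle : w y⁻¹ ^ ((q - 1) * V'.card) ≤
        ∏ x ∈ U', ∏ x' ∈ V', w (x * y⁻¹ - x' * y⁻¹) := by
      rw [pow_mul, Finset.prod_comm]
      refine Finset.pow_card_le_prod _ _ _ fun x' hx' ↦ ?_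
      rw [← hprod x' (hVcl hx')]
      simp only [w.map_sub_swap (_ * y⁻¹) (x' * y⁻¹)]
      refine Finset.prod_le_prod_of_subset_of_le_one' (fun x hx ↦ Finset.mem_erase.2 ⟨?_, hUcl hx⟩)
        fun x hx _ ↦ hle _ (hcls x' (hVcl hx')).1 _ (hcls x (Finset.mem_of_mem_erase hx)).1
      exact (Finset.mem_erase.1 (hpair x hx x' hx')).1.symm
    rw [infBound, if_pos hζq]
    have hhalf : U'.card ≤ (q - 1) / 2 ∨ V'.card ≤ (q - 1) / 2 := by
      obtain ⟨m, rfl⟩ := hq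
      lia
    rcases hhalf with h | h
    · exact (pow_le_pow_right_of_le_one' hz1.le (Nat.mul_le_mul_left _ h)).trans hUle
    · exact (pow_le_pow_right_of_le_one' hz1.le (Nat.mul_le_mul_left _ h)).trans hVle
  · rw [infBound, if_neg hζq, pow_zero]
    have hcard : cl.card ≤ q + 1 := by
      rcases cl.eq_empty_or_nonempty with h0 | ⟨x, hx⟩
      · simp [h0]
      have h1 : (w y⁻¹ ^ (q - 1)) ^ q ≤ (w y⁻¹ ^ (q - 1)) ^ (cl.erase x).card := by
        conv_lhs => rw [← hprod x hx, ← Finset.prod_pow]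
        refine Finset.prod_le_pow_card _ _ _ fun x' hx' ↦ ?_
        rw [← sub_sub_sub_cancel_right _ _ (algebraMap K L ζ)]
        rcases le_max_iff.1 (w.map_sub (x * y⁻¹ - algebraMap K L ζ)
          (x' * y⁻¹ - algebraMap K L ζ)) with h | h
        · exact (pow_le_pow_left₀ zero_le h _).trans_eq ((hloc x hx).2 hζq)
        · exact (pow_le_pow_left₀ zero_le h _).trans_eq
            ((hloc x' (Finset.mem_of_mem_erase hx')).2 hζq)
      have h2 := (pow_le_pow_iff_right_of_lt_one₀ (zero_lt_iff.2 (pow_ne_zero _ hz0))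
        (pow_lt_one' hz1 (by lia))).1 h1
      rw [Finset.card_erase_of_mem hx] at h2
      lia
    have hcop : q.Coprime (q - 1) := by
      conv_lhs => rw [show q = q - 1 + 1 by lia]
      simp
    have hUd : q ∣ U'.card := hU.dvd_card_of_one_lt hK hy (fun x hx ↦ hS1 x (hUS hx)) ζ
      (by lia) hcop fun x hx hxζ ↦ (hloc x (Finset.mem_filter.2 ⟨hUS hx, hxζ⟩)).2 hζq
    have hVd : q ∣ V'.card := hV.dvd_card_of_one_lt hK hy (fun x hx ↦ hS1 x (hVS hx)) ζ
      (by lia) hcop fun x hx hxζ ↦ (hloc x (Finset.mem_filter.2 ⟨hVS hx, hxζ⟩)).2 hζq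
    have h0 : U'.card = 0 ∨ V'.card = 0 := by
      by_contra! h
      have := Nat.le_of_dvd (Nat.pos_of_ne_zero h.1) hUd
      have := Nat.le_of_dvd (Nat.pos_of_ne_zero h.2) hVd
      lia
    rw [Finset.card_eq_zero, Finset.card_eq_zero] at h0
    rcases h0 with h | h <;> simp [h]

/-- Lower bound for the degree of the resultant of two rational factors. -/
lemma IsFiber.card_mul_card_le [IsAlgClosed K]
    (hadd : ∀ a b : L, (a + b) ^ q = a ^ q + b ^ q) (hq : Odd q) (hq2 : 2 ≤ q)
    (hl : (l : K) ≠ 0) (hqK : (q : K) = 0) {y : L} (hy : Transcendental K y)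
    {S U V : Finset L} (hS : IsFiber q l y S) (hUS : U ⊆ S) (hVS : V ⊆ S)
    (hUV : Disjoint U V) (hU : IsRationalSet K y U) (hV : IsRationalSet K y V)
    {R : K[X]} (hR0 : R ≠ 0) (hR : ∏ x ∈ U, ∏ x' ∈ V, (x - x') = aeval y R)
    {N : Finset K} (hN : ∀ ζ, ζ ∈ N ↔ ζ ^ l = 1) :
    U.card * V.card ≤ R.natDegree + ∑ ζ ∈ N, infBound q ζ := by
  have hyi : Transcendental K y⁻¹ := fun h ↦ hy (by simpa using h.inv)
  obtain ⟨A, hK, hz1⟩ := exists_valuationSubring_of_transcendental hyi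
  set w := A.valuation
  have hl0 : l ≠ 0 := by rintro rfl; simp at hl
  have hy0 : y ≠ 0 := by
    rintro rfl
    exact hy isAlgebraic_zero
  have hz0 : w y⁻¹ ≠ 0 := w.ne_zero_iff.2 (inv_ne_zero hy0)
  have hy1 : 1 < w y := by
    rw [map_inv₀] at hz1
    exact (inv_lt_one₀ (zero_lt_iff.2 (w.ne_zero_iff.2 hy0))).1 hz1
  have hyz : w y * w y⁻¹ = 1 := by rw [← map_mul, mul_inv_cancel₀ hy0, map_one]
  have hS1 : ∀ x ∈ S, w (x * y⁻¹) ≤ 1 := fun x hx ↦ by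
    have := w.map_le_of_diffPow_eq hK (by simp [hqK] : ((q * l + 1 : ℕ) : K) ≠ 0)
      (by nlinarith [Nat.pos_of_ne_zero hl0]) (hS.diffPow_eq hx)
    rw [max_eq_right hy1.le] at this
    rw [map_mul, ← hyz]
    exact mul_le_mul_left this _
  have hinj : Function.Injective fun x : L ↦ x * y⁻¹ := mul_left_injective₀ (inv_ne_zero hy0)
  have h := w.pow_sum_le_prod_prod hK (U.image (· * y⁻¹)) (V.image (· * y⁻¹)) N (infBound q)
    (θ := w y⁻¹) ?_ ?_ ?_
  · rw [Finset.prod_image hinj.injOn] at h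
    simp only [Finset.prod_image hinj.injOn, ← sub_mul, map_mul, Finset.prod_mul_distrib,
      Finset.prod_const] at h
    simp only [← map_prod] at h
    rw [hR, w.map_aeval_eq_pow_natDegree hK hy1 hR0, ← pow_mul] at h
    refine (pow_le_pow_iff_right_of_lt_one₀ (zero_lt_iff.2 hz0) hz1).1 ?_
    rw [pow_add, mul_comm U.card]
    calc w y⁻¹ ^ R.natDegree * w y⁻¹ ^ ∑ ζ ∈ N, infBound q ζ
        ≤ w y⁻¹ ^ R.natDegree * (w y ^ R.natDegree * w y⁻¹ ^ (V.card * U.card)) :=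
          mul_le_mul_right h _
      _ = w y⁻¹ ^ (V.card * U.card) := by
          rw [← mul_assoc, ← mul_pow, mul_comm (w y⁻¹), hyz, one_pow, one_mul]
  · simp only [Finset.forall_mem_image]
    exact fun x hx x' hx' ↦ w.map_sub_le (hS1 x (hUS hx)) (hS1 x' (hVS hx'))
  · simp only [Finset.forall_mem_image]
    intro x hx x' _ _
    have h1 := (w.map_mul_sub_rootOfUnity hK hadd hq2 hl hy1 (hS1 x (hUS hx))
      (hS.diffPow_eq (hUS hx))).1
    have h2 : aeval (x * y⁻¹) (X ^ l - 1 : K[X]) = (x * y⁻¹) ^ l - 1 := by simp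
    rw [← h2] at h1
    obtain ⟨ζ, hζ, hxζ⟩ := w.exists_isRoot_of_map_aeval_lt_one hK
      (X_pow_sub_C_ne_zero (Nat.pos_of_ne_zero hl0) (1 : K)) (by simpa using h1)
    refine ⟨ζ, (hN ζ).2 ?_, hxζ⟩
    simpa [IsRoot, sub_eq_zero] using hζ
  · intro ζ hζ
    simp only [Finset.filter_image, Finset.prod_image hinj.injOn]
    exact hS.pow_infBound_le hK hadd hq hq2 hl hy1 hS1 hUS hVS hUV hU hV ((hN ζ).1 hζ)

end InfiniteBound

section Fiber

open Polynomial

lemma derivative_diffPow_X {R : Type*} [CommRing R] {q : ℕ} (hqR : (q : R) = 0)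
    (hadd : ∀ a b : R[X], (a + b) ^ q = a ^ q + b ^ q) (l : ℕ) :
    derivative (diffPow (q * l + 1) (X : R[X])) = diffPow l X ^ q := by
  simp [diffPow, derivative_pow, sub_pow_of_add_pow hadd, hqR, ← pow_mul, mul_comm l q]

lemma IsFiber.of_isAlgClosed {L : Type*} [Field L] [DecidableEq L] [IsAlgClosed L] {q l : ℕ}
    (hqL : (q : L) = 0) (hadd : ∀ a b : L[X], (a + b) ^ q = a ^ q + b ^ q) {y : L}
    (hy : ∀ x, diffPow (q * l + 1) x = diffPow (q * l + 1) y → diffPow l x ≠ 0) :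
    ((diffPow (q * l + 1) X - C (diffPow (q * l + 1) y) : L[X])).roots.Nodup ∧
    IsFiber q l y (diffPow (q * l + 1) X - C (diffPow (q * l + 1) y) : L[X]).roots.toFinset := by
  have ht : ((q * l + 1 : ℕ) : L) ≠ 0 := by simp [hqL]
  set F : L[X] := diffPow (q * l + 1) X - C (diffPow (q * l + 1) y) with hF
  have hev : ∀ T, F.eval T = diffPow (q * l + 1) T - diffPow (q * l + 1) y := fun T ↦ by
    simp [hF, diffPow]
  have hdeg : F.natDegree = q * l := by
    rw [hF, natDegree_sub_C, natDegree_diffPow_X ht, Nat.add_sub_cancel]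
  have hder : derivative F = diffPow l X ^ q := by
    rw [hF, derivative_sub, derivative_C, sub_zero, derivative_diffPow_X hqL hadd]
  have hderev : ∀ x, (derivative F).eval x = diffPow l x ^ q := fun x ↦ by
    simp [hder, diffPow]
  have hmon : F.Monic := by
    rcases Nat.eq_zero_or_pos (q * l) with h0 | h0
    · exfalso
      rcases Nat.mul_eq_zero.1 h0 with rfl | rfl
      · have := hadd 0 0; simp at this
      · exact hy y rfl (by simp [diffPow])
    · have h1 : (diffPow (q * l + 1) (X : L[X])).leadingCoeff = 1 := by
        rw [leadingCoeff_diffPow_X ht]; simp [hqL]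
      rw [Monic, hF, leadingCoeff_sub_of_degree_lt, h1]
      refine lt_of_le_of_lt degree_C_le (natDegree_pos_iff_degree_pos.1 ?_)
      rwa [natDegree_diffPow_X ht, Nat.add_sub_cancel]
  have hsp := IsAlgClosed.splits F
  have hnd : F.roots.Nodup := by
    refine Multiset.nodup_iff_count_le_one.2 fun x ↦ ?_
    rw [count_roots]
    by_contra! h
    obtain ⟨h1, h2⟩ := (one_lt_rootMultiplicity_iff_isRoot hmon.ne_zero).1 h
    rw [IsRoot, hev, sub_eq_zero] at h1
    rw [IsRoot, hderev] at h2
    exact hy x h1 (eq_zero_of_pow_eq_zero h2)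
  have hprod : ∏ x ∈ F.roots.toFinset, (X - C x) = F := by
    conv_rhs => rw [hsp.eq_prod_roots_of_monic hmon]
    rw [Finset.prod_multiset_map_count]
    refine Finset.prod_congr rfl fun x hx ↦ ?_
    rw [Multiset.count_eq_one_of_mem hnd (Multiset.mem_toFinset.1 hx), pow_one]
  refine ⟨hnd, ?_, ?_, ?_⟩
  · rw [Multiset.toFinset_card_of_nodup hnd, ← hdeg, hsp.natDegree_eq_card_roots]
  · intro T
    rw [← hev]
    conv_rhs => rw [← hprod]
    simp [eval_prod]
  · intro x hx
    rw [← hderev, hsp.eval_root_derivative hmon (Multiset.mem_toFinset.1 hx), Finset.prod]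
    congr 2
    rw [Finset.erase_val, Multiset.toFinset_val, hnd.dedup]

/-- The roots over a field containing `y` of a monic factor. -/
lemma IsRationalSet.roots {K L : Type*} [Field K] [Field L] [Algebra K L] [DecidableEq L]
    [IsAlgClosed L] {y : L} {u : K[X][X]} (hu : u.Monic)
    (hnd : (u.map (aeval y : K[X] →ₐ[K] L).toRingHom).roots.Nodup) :
    IsRationalSet K y (u.map (aeval y : K[X] →ₐ[K] L).toRingHom).roots.toFinset := by
  intro r
  refine ⟨u.eval r, ?_⟩
  have h1 : aeval y (u.eval r) =
      (u.map (aeval y : K[X] →ₐ[K] L).toRingHom).eval (aeval y r) := by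
    rw [eval_map, ← AlgHom.coe_toRingHom, ← eval₂_at_apply]
    rfl
  rw [h1, (IsAlgClosed.splits _).eval_eq_prod_roots_of_monic (hu.map _), Finset.prod,
    Multiset.toFinset_val, hnd.dedup]

/-- The resultant of two factors only vanishes at critical points. -/
lemma diffPow_eq_zero_of_resultant_eq_zero {K : Type*} [Field K] [IsAlgClosed K] {q l : ℕ}
    (hqK : (q : K) = 0) (hadd : ∀ a b : K[X], (a + b) ^ q = a ^ q + b ^ q) {u v : K[X][X]}
    (hu : u.Monic) (hv : v.Monic)
    (huv : diffPow (q * l + 1) (X : K[X][X]) - C (diffPow (q * l + 1) (X : K[X])) =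
      (X - C X) * (u * v)) {b : K} (hb : (u.resultant v).eval b = 0) : diffPow l b = 0 := by
  have h1 : (u.map (evalRingHom b)).resultant (v.map (evalRingHom b)) = 0 := by
    rw [hu.natDegree_map, hv.natDegree_map, resultant_map_map]
    exact hb
  have h2 := (resultant_eq_zero_iff.1 h1).2
  obtain ⟨a, ha1, ha2⟩ : ∃ a, (u.map (evalRingHom b)).eval a = 0 ∧
      (v.map (evalRingHom b)).eval a = 0 := by
    by_contra! h
    refine h2 (isCoprime_of_dvd _ _ (fun h ↦ (hu.map (evalRingHom b)).ne_zero h.1) ?_)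
    intro z hz hz0 hz1 hz2
    obtain ⟨a, ha⟩ := IsAlgClosed.exists_root z (degree_pos_of_ne_zero_of_nonunit hz0 hz).ne'
    exact h a (ha.dvd hz1) (ha.dvd hz2)
  have h3 : ∀ f : K[X][X], (f.map (evalRingHom b)).eval a = (f.eval (C a)).eval b := by
    intro f
    have := eval₂_at_apply (p := f) (evalRingHom b) (C a)
    rw [eval_map]
    simpa using this
  rw [h3] at ha1 ha2
  have h4 := congrArg (fun f : K[X][X] ↦ (derivative (f.eval (C a))).eval b) huv
  have h5 : (derivative (diffPow (q * l + 1) (X : K[X]))).eval b = diffPow l b ^ q := by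
    rw [derivative_diffPow_X hqK hadd]
    simp [diffPow]
  have h6 : (diffPow (q * l + 1) (X : K[X][X])).eval (C a) = C (diffPow (q * l + 1) a) := by
    simp [diffPow]
  simp only [eval_sub, eval_mul, eval_X, eval_C, derivative_mul, derivative_sub, derivative_C,
    h6, h5, eval_add, ha1, ha2] at h4
  exact eq_zero_of_pow_eq_zero (n := q) (by simpa using h4)

end Fiber

section Factorization

open Polynomial

lemma natDegree_mul_natDegree_le {K : Type*} [Field K] [IsAlgClosed K] [DecidableEq K] {p : ℕ}
    [Fact p.Prime] [CharP K p] {i l : ℕ} (hi : i ≠ 0) (hq : Odd (p ^ i)) (hl : (l : K) ≠ 0)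
    {u v : K[X][X]} (hu : u.Monic) (hv : v.Monic)
    (huv : diffPow (p ^ i * l + 1) (X : K[X][X]) - C (diffPow (p ^ i * l + 1) (X : K[X])) =
      (X - C X) * (u * v)) {Z N : Finset K} (hZ : ∀ c, c ∈ Z ↔ diffPow l c = 0)
    (hN : ∀ ζ, ζ ∈ N ↔ ζ ^ l = 1) :
    u.natDegree * v.natDegree ≤
      ∑ b ∈ Z, ∑ c ∈ Z, critBound (p ^ i) b c + ∑ ζ ∈ N, infBound (p ^ i) ζ := by
  classical
  set q := p ^ i with hqd
  let L := AlgebraicClosure (RatFunc K)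
  set y : L := algebraMap (RatFunc K) L RatFunc.X with hyd
  have hy : Transcendental K y := by
    rw [hyd, transcendental_algebraMap_iff (algebraMap (RatFunc K) L).injective]
    exact RatFunc.transcendental_X
  have : CharP L p := charP_of_injective_algebraMap (algebraMap K L).injective p
  have hq2 : 2 ≤ q := (Nat.Prime.two_le Fact.out).trans (Nat.le_self_pow hi p)
  have hqK : (q : K) = 0 := by simp [hqd, hi]
  have hqL : (q : L) = 0 := by simp [hqd, hi]
  have haddL : ∀ a b : L, (a + b) ^ q = a ^ q + b ^ q := fun a b ↦ add_pow_char_pow a b p i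
  have haddLX : ∀ a b : L[X], (a + b) ^ q = a ^ q + b ^ q := fun a b ↦ add_pow_char_pow a b p i
  have haddX : ∀ a b : K[X], (a + b) ^ q = a ^ q + b ^ q := fun a b ↦ add_pow_char_pow a b p i
  have hl0 : l ≠ 0 := by rintro rfl; simp at hl
  have hP0 : diffPow l (X : K[X]) ≠ 0 := fun h ↦ hl <| by
    rw [← leadingCoeff_diffPow_X hl, h, leadingCoeff_zero]
  have hcrit : ∀ x : L, diffPow (q * l + 1) x = diffPow (q * l + 1) y → diffPow l x ≠ 0 := by
    intro x hx h0
    rw [← aeval_diffPow_X (K := K)] at h0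
    have hx' : ¬ Transcendental K x := fun h ↦ h ⟨_, hP0, h0⟩
    have hty : Transcendental K (diffPow (q * l + 1) y) := by
      rw [← aeval_diffPow_X (K := K)]
      refine hy.aeval _ ?_ (mem_nonZeroDivisors_of_ne_zero ?_)
      · rw [natDegree_diffPow_X (by simp [hqK]), Nat.add_sub_cancel]
        exact mul_ne_zero (by lia) hl0
      · rw [leadingCoeff_diffPow_X (by simp [hqK])]
        simp [hqK]
    rw [← hx, ← aeval_diffPow_X (K := K)] at hty
    exact hx' (transcendental_aeval_iff.1 hty).1
  obtain ⟨hnd, hS⟩ := IsFiber.of_isAlgClosed hqL haddLX hcrit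
  set ψ : K[X] →+* L := (aeval y : K[X] →ₐ[K] L).toRingHom with hψ
  have hψi : Function.Injective ψ := transcendental_iff_injective.1 hy
  have hmap : (diffPow (q * l + 1) X - C (diffPow (q * l + 1) y) : L[X]) =
      (X - C y) * (u.map ψ * v.map ψ) := by
    have h1 := congrArg (Polynomial.map ψ) huv
    have h2 : ψ X = y := aeval_X y
    simpa [diffPow, h2] using h1
  have hu' := hu.map ψ
  have hv' := hv.map ψ
  have hroots : (diffPow (q * l + 1) X - C (diffPow (q * l + 1) y) : L[X]).roots =
      {y} + ((u.map ψ).roots + (v.map ψ).roots) := by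
    rw [hmap, roots_mul, roots_mul, roots_X_sub_C]
    · exact (hu'.mul hv').ne_zero
    · exact ((monic_X_sub_C y).mul (hu'.mul hv')).ne_zero
  rw [hroots] at hnd hS
  have hnd1 := (Multiset.nodup_add.1 hnd).2.1
  obtain ⟨hndu, hndv, hdisj⟩ := Multiset.nodup_add.1 hnd1
  set U := (u.map ψ).roots.toFinset with hU
  set V := (v.map ψ).roots.toFinset with hV
  have hUS : U ⊆ ({y} + ((u.map ψ).roots + (v.map ψ).roots)).toFinset := by
    intro x hx; simp [hU] at hx ⊢; tauto
  have hVS : V ⊆ ({y} + ((u.map ψ).roots + (v.map ψ).roots)).toFinset := by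
    intro x hx; simp [hV] at hx ⊢; tauto
  have hUV : Disjoint U V := by
    rw [Finset.disjoint_left]
    intro x hx hx'
    exact Multiset.disjoint_left.1 hdisj (Multiset.mem_toFinset.1 hx) (Multiset.mem_toFinset.1 hx')
  have hUr : IsRationalSet K y U := IsRationalSet.roots hu hndu
  have hVr : IsRationalSet K y V := IsRationalSet.roots hv hndv
  have hUc : U.card = u.natDegree := by
    rw [hU, Multiset.toFinset_card_of_nodup hndu, ← hu.natDegree_map ψ,
      (IsAlgClosed.splits (u.map ψ)).natDegree_eq_card_roots]
  have hVc : V.card = v.natDegree := by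
    rw [hV, Multiset.toFinset_card_of_nodup hndv, ← hv.natDegree_map ψ,
      (IsAlgClosed.splits (v.map ψ)).natDegree_eq_card_roots]
  have hR : ∏ x ∈ U, ∏ x' ∈ V, (x - x') = aeval y (u.resultant v) := by
    have h1 := resultant_eq_prod_roots_sub _ _ hu' hv' (IsAlgClosed.splits _)
      (IsAlgClosed.splits _)
    rw [hu.natDegree_map, hv.natDegree_map, resultant_map_map] at h1
    change _ = ψ _
    rw [h1, ← Finset.prod_product', Finset.prod, Finset.product_val, hU, hV,
      Multiset.toFinset_val, Multiset.toFinset_val, hndu.dedup, hndv.dedup]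
  have hR0 : u.resultant v ≠ 0 := by
    intro h0
    rw [h0, map_zero] at hR
    obtain ⟨x, hx, h1⟩ := Finset.prod_eq_zero_iff.1 hR
    obtain ⟨x', hx', h2⟩ := Finset.prod_eq_zero_iff.1 h1
    rw [sub_eq_zero] at h2
    exact Finset.disjoint_left.1 hUV hx (h2 ▸ hx')
  have hmain := hS.card_mul_card_le haddL hq hq2 hl hqK hy hUS hVS hUV hUr hVr hR0 hR hN
  rw [hUc, hVc] at hmain
  refine hmain.trans (Nat.add_le_add_right ?_ _)
  have hsub : (u.resultant v).roots.toFinset ⊆ Z := fun b hb ↦ (hZ b).2 <|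
    diffPow_eq_zero_of_resultant_eq_zero hqK haddX hu hv huv
      (isRoot_of_mem_roots (Multiset.mem_toFinset.1 hb))
  rw [(IsAlgClosed.splits (u.resultant v)).natDegree_eq_card_roots,
    ← Multiset.sum_count_eq_card (s := Z) fun b hb ↦ hsub (Multiset.mem_toFinset.2 hb)]
  refine Finset.sum_le_sum fun b hb ↦ ?_
  rw [count_roots]
  exact hS.rootMultiplicity_le haddL hq hq2 hl hqK hy hUS hVS hUV hUr hVr hR0 hR hZ hb

end Factorization

section Counting

open Polynomial

variable {K : Type*} [Field K] [DecidableEq K] {q l : ℕ}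

lemma card_filter_pow_eq_self_le (hl : l ≠ 0) {N : Finset K} (hN : ∀ ζ ∈ N, ζ ^ l = 1)
    (hq : q ≠ 0) : (N.filter fun ζ ↦ ζ ^ q = ζ).card ≤ l.gcd (q - 1) := by
  have hpos : 0 < l.gcd (q - 1) := Nat.gcd_pos_of_pos_left _ (Nat.pos_of_ne_zero hl)
  refine (Finset.card_le_card (t := (nthRoots (l.gcd (q - 1)) (1 : K)).toFinset) ?_).trans
    ((Multiset.toFinset_card_le _).trans (card_nthRoots _ _))
  intro ζ hζ
  obtain ⟨h1, h2⟩ := Finset.mem_filter.1 hζ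
  rw [Multiset.mem_toFinset, mem_nthRoots hpos]
  have h0 : ζ ≠ 0 := by rintro rfl; simpa [hl] using hN _ h1
  refine pow_gcd_eq_one.2 ⟨hN ζ h1, mul_right_cancel₀ h0 ?_⟩
  rw [← pow_succ, Nat.sub_add_cancel (Nat.pos_of_ne_zero hq), h2, one_mul]

lemma card_filter_diffPow_lt (hadd : ∀ a b : K, (a + b) ^ q = a ^ q + b ^ q) (hl : l ≠ 0)
    {Z N : Finset K} (hZ : ∀ c ∈ Z, diffPow l c = 0) (hN : ∀ ζ, ζ ∈ N ↔ ζ ^ l = 1) :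
    (Z.filter fun c ↦ c ^ q = c).card < (N.filter fun ζ ↦ ζ ^ q = ζ).card := by
  have hZ0 : ∀ c ∈ Z, c ≠ 0 := by
    rintro _ hc rfl
    simpa [diffPow, hl] using hZ _ hc
  have h1 : (1 : K) ∈ N.filter fun ζ ↦ ζ ^ q = ζ := by simp [hN]
  refine (Finset.card_le_card_of_injOn (t := (N.filter fun ζ ↦ ζ ^ q = ζ).erase 1)
    (fun c ↦ (c + 1) / c) ?_ ?_).trans_lt (Finset.card_erase_lt_of_mem h1)
  · intro c hc
    obtain ⟨hc, hcq⟩ := Finset.mem_filter.1 hc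
    have hc0 := hZ0 c hc
    have h2 : (c + 1) ^ l = c ^ l := sub_eq_zero.1 (hZ c hc)
    simp only [Finset.coe_erase, Set.mem_sdiff, Finset.mem_coe, Finset.mem_filter, hN,
      Set.mem_singleton_iff]
    refine ⟨⟨?_, ?_⟩, ?_⟩
    · rw [div_pow, h2, div_self (pow_ne_zero _ hc0)]
    · rw [div_pow, hadd, hcq, one_pow]
    · rw [div_eq_one_iff_eq hc0]
      simp
  · intro c hc d hd h
    have hc0 := hZ0 c (Finset.mem_filter.1 hc).1
    have hd0 := hZ0 d (Finset.mem_filter.1 hd).1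
    have : (c + 1) / c = (d + 1) / d := h
    field_simp at this
    linear_combination -this

lemma sum_critBound (Z : Finset K) :
    ∑ b ∈ Z, ∑ c ∈ Z, critBound q b c + q * (Z.filter fun c ↦ c ^ q = c).card ^ 2 =
      ((q + 1) / 2) ^ 2 * (Z.filter fun c ↦ c ^ q = c).card ^ 2 + q * Z.card ^ 2 := by
  set Z₁ := Z.filter fun c ↦ c ^ q = c with hZ₁
  have h2 : (Z ×ˢ Z).filter (fun x ↦ x.1 ^ q = x.1 ∧ x.2 ^ q = x.2) = Z₁ ×ˢ Z₁ := by
    ext x; simp [hZ₁]; tauto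
  have h3 := Finset.card_filter_add_card_filter_not (s := Z ×ˢ Z)
    (fun x ↦ x.1 ^ q = x.1 ∧ x.2 ^ q = x.2)
  rw [← Finset.sum_product' (f := critBound q)]
  simp only [critBound]
  rw [Finset.sum_ite, Finset.sum_const, Finset.sum_const]
  rw [h2, Finset.card_product, Finset.card_product] at h3
  rw [h2, Finset.card_product]
  simp only [smul_eq_mul]
  linear_combination q * h3

lemma sum_infBound (N : Finset K) :
    ∑ ζ ∈ N, infBound q ζ =
      (N.filter fun ζ ↦ ζ ^ q = ζ).card * ((q - 1) * ((q - 1) / 2)) := by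
  simp [infBound, Finset.sum_ite]

/-- The quadratic inequality that bounds the degrees of two complementary factors. -/
lemma no_balanced_degrees {r l m z z₁ d e s : ℕ} (hr : 2 ≤ r) (hl : 3 ≤ l) (hm : 3 * m ≤ l)
    (hz : z + 1 ≤ l) (hz₁ : z₁ + 1 ≤ m) (hde : d + e + 1 = (2 * r + 1) * l)
    (hd : d + e ≤ 3 * d) (he : d + e ≤ 3 * e)
    (hs : s + (2 * r + 1) * z₁ ^ 2 = (r + 1) ^ 2 * z₁ ^ 2 + (2 * r + 1) * z ^ 2)
    (h : d * e ≤ s + m * (2 * r * r)) : False := by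
  zify at *
  have h0 : (0 : ℤ) ≤ (2 * d - e) * (2 * e - d) := mul_nonneg (by linarith) (by linarith)
  have h1 : (s : ℤ) = r ^ 2 * z₁ ^ 2 + (2 * r + 1) * z ^ 2 := by linear_combination hs
  have h2 : (z₁ : ℤ) ^ 2 ≤ (m - 1) ^ 2 := pow_le_pow_left₀ (by positivity) (by linarith) 2
  have h3 : (z : ℤ) ^ 2 ≤ (l - 1) ^ 2 := pow_le_pow_left₀ (by positivity) (by linarith) 2
  have h4 : (9 : ℤ) * m ^ 2 ≤ l ^ 2 := by nlinarith
  have h5 : (s : ℤ) + m * (2 * r * r) ≤ r ^ 2 * (m ^ 2 + 1) + (2 * r + 1) * (l - 1) ^ 2 := by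
    rw [h1]
    nlinarith [mul_le_mul_of_nonneg_left h2 (sq_nonneg (r : ℤ)),
      mul_le_mul_of_nonneg_left h3 (show (0 : ℤ) ≤ 2 * r + 1 by positivity)]
  have h6 : (9 : ℤ) * (s + m * (2 * r * r)) ≤
      r ^ 2 * (l ^ 2 + 9) + 9 * (2 * r + 1) * (l - 1) ^ 2 := by
    nlinarith [mul_le_mul_of_nonneg_left h4 (sq_nonneg (r : ℤ))]
  have h7 : (2 : ℤ) * ((2 * r + 1) * l - 1) ^ 2 ≤ 9 * (d * e) := by
    rw [← hde]
    linarith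
  have h8 : (2 : ℤ) * ((2 * r + 1) * l - 1) ^ 2 ≤
      r ^ 2 * (l ^ 2 + 9) + 9 * (2 * r + 1) * (l - 1) ^ 2 := by linarith
  obtain ⟨a, ha⟩ : ∃ a : ℕ, r = a + 2 := ⟨r - 2, by lia⟩
  obtain ⟨b, hb⟩ : ∃ b : ℕ, l = b + 3 := ⟨l - 3, by lia⟩
  subst ha hb
  push_cast at h8
  ring_nf at h8
  nlinarith [mul_nonneg (Int.natCast_nonneg a) (Int.natCast_nonneg b), sq_nonneg (a : ℤ), sq_nonneg (b : ℤ)]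

end Counting

section Descent

open Polynomial

lemma degrees_not_balanced {K : Type*} [Field K] [IsAlgClosed K] {p : ℕ}
    [Fact p.Prime] [CharP K p] {i l : ℕ} (hi : i ≠ 0) (hq : Odd (p ^ i)) (hq5 : 5 ≤ p ^ i)
    (hl3 : 3 ≤ l) (hlodd : Odd l) (hl : (l : K) ≠ 0) (hgcd : l.gcd (p ^ i - 1) < l)
    {u v : K[X][X]} (hu : u.Monic) (hv : v.Monic)
    (huv : diffPow (p ^ i * l + 1) (X : K[X][X]) - C (diffPow (p ^ i * l + 1) (X : K[X])) =
      (X - C X) * (u * v))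
    (hd : u.natDegree + v.natDegree ≤ 3 * u.natDegree)
    (he : u.natDegree + v.natDegree ≤ 3 * v.natDegree) : False := by
  classical
  obtain ⟨r, hr⟩ := hq
  have hadd : ∀ a b : K, (a + b) ^ p ^ i = a ^ p ^ i + b ^ p ^ i :=
    fun a b ↦ add_pow_char_pow a b p i
  have hP0 : diffPow l (X : K[X]) ≠ 0 := fun h ↦ hl <| by
    rw [← leadingCoeff_diffPow_X hl, h, leadingCoeff_zero]
  have hl0 : l ≠ 0 := by lia
  set Z := (diffPow l (X : K[X])).roots.toFinset with hZd
  set N := (nthRoots l (1 : K)).toFinset with hNd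
  have hZ : ∀ c, c ∈ Z ↔ diffPow l c = 0 := fun c ↦ by
    rw [hZd, Multiset.mem_toFinset, mem_roots hP0, IsRoot, ← coe_aeval_eq_eval, aeval_diffPow_X]
  have hN : ∀ ζ, ζ ∈ N ↔ ζ ^ l = 1 := fun ζ ↦ by
    rw [hNd, Multiset.mem_toFinset, mem_nthRoots (by lia)]
  have hmain := natDegree_mul_natDegree_le hi ⟨r, hr⟩ hl hu hv huv hZ hN
  have hZc : Z.card + 1 ≤ l := by
    have := (Multiset.toFinset_card_le _).trans (card_roots' (diffPow l (X : K[X])))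
    rw [natDegree_diffPow_X hl] at this
    lia
  have hm := card_filter_pow_eq_self_le (q := p ^ i) hl0 (fun ζ ↦ (hN ζ).1) (by lia)
  have hZ₁ := card_filter_diffPow_lt hadd hl0 (fun c ↦ (hZ c).1) hN
  have hm3 : 3 * l.gcd (p ^ i - 1) ≤ l := by
    obtain ⟨k, hk⟩ := Nat.gcd_dvd_left l (p ^ i - 1)
    set m := l.gcd (p ^ i - 1)
    have hk2 : k ≠ 2 := by
      rintro rfl
      exact Nat.not_even_iff_odd.2 hlodd ⟨m, by lia⟩
    have hk3 : 3 ≤ k := by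
      by_contra! h
      interval_cases k <;> lia
    calc 3 * m ≤ k * m := Nat.mul_le_mul_right _ hk3
      _ = l := by rw [mul_comm, ← hk]
  have hdeg : u.natDegree + v.natDegree + 1 = p ^ i * l := by
    have h1 := congrArg natDegree huv
    rw [natDegree_sub_C, natDegree_diffPow_X (by simp [hi]),
      (monic_X_sub_C _).natDegree_mul (hu.mul hv), hu.natDegree_mul hv, natDegree_X_sub_C] at h1
    lia
  have hs := sum_critBound (q := p ^ i) Z
  rw [sum_infBound] at hmain
  rw [hr] at hq5 hm hZ₁ hm3 hdeg hs hmain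
  rw [show (2 * r + 1 + 1) / 2 = r + 1 by lia] at hs
  rw [show (2 * r + 1 - 1) / 2 = r by lia, show 2 * r + 1 - 1 = 2 * r by lia] at hmain
  exact no_balanced_degrees (by lia) hl3 hm3 hZc (by lia) hdeg hd he hs
    (hmain.trans (Nat.add_le_add_left (Nat.mul_le_mul_right _ hm) _))

/-- A monic polynomial without balanced factorizations has a dominant irreducible factor. -/
lemma exists_irreducible_of_not_balanced {R : Type*} [CommRing R] [IsDomain R] {g : R[X]}
    (hg : g.Monic) (hg0 : g.natDegree ≠ 0)
    (h : ∀ u v : R[X], u.Monic → v.Monic → g = u * v →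
      u.natDegree + v.natDegree ≤ 3 * u.natDegree →
      u.natDegree + v.natDegree ≤ 3 * v.natDegree → False) :
    ∃ u v : R[X], u.Monic ∧ v.Monic ∧ Irreducible u ∧ g = u * v ∧
      v.natDegree < u.natDegree := by
  classical
  have hex : ∃ d, ∃ u v : R[X], u.Monic ∧ v.Monic ∧ g = u * v ∧ u.natDegree = d ∧
      u.natDegree + v.natDegree ≤ 3 * u.natDegree :=
    ⟨_, g, 1, hg, monic_one, (mul_one g).symm, rfl, by simp; lia⟩
  obtain ⟨u, v, hu, hv, huv, hd, h3⟩ := Nat.find_spec hex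
  have hmin := fun m ↦ @Nat.find_min _ _ hex m
  rw [← hd] at hmin
  have h4 := h u v hu hv huv h3
  have hdeg : g.natDegree = u.natDegree + v.natDegree := by rw [huv, hu.natDegree_mul hv]
  refine ⟨u, v, hu, hv, ?_, huv, by lia⟩
  rw [hu.irreducible_iff_natDegree]
  refine ⟨by rintro rfl; simp at *; lia, fun a b ha hb hab ↦ ?_⟩
  have hab' : u.natDegree = a.natDegree + b.natDegree := by rw [← hab, ha.natDegree_mul hb]
  by_contra! h5
  rcases le_total a.natDegree b.natDegree with h6 | h6
  · refine hmin b.natDegree (by lia) ⟨b, a * v, hb, ha.mul hv, ?_, rfl, ?_⟩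
    · rw [huv, ← hab]; ring
    · rw [ha.natDegree_mul hv]; lia
  · refine hmin a.natDegree (by lia) ⟨a, b * v, ha, hb.mul hv, ?_, rfl, ?_⟩
    · rw [huv, ← hab]; ring
    · rw [hb.natDegree_mul hv]; lia

/-- An automorphism fixing `g` fixes its dominant irreducible factor. -/
lemma map_eq_self_of_irreducible {R : Type*} [CommRing R] [IsDomain R]
    [UniqueFactorizationMonoid R] (σ : R ≃+* R) {u v : R[X]} (hu : u.Monic) (hv : v.Monic)
    (hui : Irreducible u) (huv : v.natDegree < u.natDegree)
    (hσ : (u * v).map (σ : R →+* R) = u * v) : u.map (σ : R →+* R) = u := by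
  have hσi : Irreducible (u.map (σ : R →+* R)) :=
    (MulEquiv.irreducible_iff (mapEquiv σ)).2 hui
  have hdvd : u.map (σ : R →+* R) ∣ u * v := by
    rw [← hσ, Polynomial.map_mul]
    exact dvd_mul_right _ _
  rcases hσi.prime.dvd_or_dvd hdvd with h | h
  · exact eq_of_monic_of_associated (hu.map _) hu (hσi.associated_of_dvd hui h)
  · have := natDegree_le_of_dvd h hv.ne_zero
    rw [hu.natDegree_map] at this
    lia

lemma exists_monic_map_eq {p : ℕ} [Fact p.Prime] {K : Type*} [Field K] [Algebra (ZMod p) K]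
    {u : K[X][X]} (hu : u.Monic) (hfix : ∀ m n, (u.coeff m).coeff n ^ p = (u.coeff m).coeff n) :
    ∃ h : (ZMod p)[X][X], h.Monic ∧ h.map (mapRingHom (algebraMap (ZMod p) K)) = u := by
  have : CharP K p := charP_of_injective_algebraMap (algebraMap (ZMod p) K).injective p
  have hmem : u ∈ lifts (mapRingHom (algebraMap (ZMod p) K)) := by
    rw [lifts_iff_coeff_lifts]
    intro m
    have hm : u.coeff m ∈ lifts (algebraMap (ZMod p) K) := by
      rw [lifts_iff_coeff_lifts]
      intro n
      have h := (Subfield.mem_bot_iff_pow_eq_self K p).2 (hfix m n)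
      rw [← ZMod.fieldRange_castHom_eq_bot p] at h
      obtain ⟨a, ha⟩ := h
      exact ⟨a, by rw [← ha, Subsingleton.elim (algebraMap (ZMod p) K) (ZMod.castHom dvd_rfl K)]⟩
    obtain ⟨f, hf⟩ := hm
    exact ⟨f, hf⟩
  obtain ⟨h, h1, -, h2⟩ := lifts_and_natDegree_eq_and_monic hmem hu
  exact ⟨h, h2, h1⟩

/-- The bivariate form of the main result. -/
lemma exists_dvd_irreducible_map {p : ℕ} [Fact p.Prime] (K : Type*) [Field K] [IsAlgClosed K]
    [Algebra (ZMod p) K] {i l : ℕ} (hi : i ≠ 0)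
    (hp : p ≠ 2) (hq5 : 5 ≤ p ^ i) (hl3 : 3 ≤ l) (hlodd : Odd l) (hlp : ¬ p ∣ l)
    (hgcd : l.gcd (p ^ i - 1) < l) {g : (ZMod p)[X][X]}
    (hg : diffPow (p ^ i * l + 1) (X : (ZMod p)[X][X]) -
      C (diffPow (p ^ i * l + 1) (X : (ZMod p)[X])) = (X - C X) * g) :
    ∃ h : (ZMod p)[X][X], h ∣ g ∧
      Irreducible (h.map (mapRingHom (algebraMap (ZMod p) K))) := by
  have : CharP K p := charP_of_injective_algebraMap (algebraMap (ZMod p) K).injective p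
  have hq : Odd (p ^ i) := ((Fact.out : p.Prime).odd_of_ne_two hp).pow
  have hl : (l : K) ≠ 0 := by rwa [Ne, CharP.cast_eq_zero_iff K p]
  have ht : ((p ^ i * l + 1 : ℕ) : K[X]) ≠ 0 := by simp [hi]
  set f := mapRingHom (algebraMap (ZMod p) K) with hf
  have hgK : diffPow (p ^ i * l + 1) (X : K[X][X]) - C (diffPow (p ^ i * l + 1) (X : K[X])) =
      (X - C X) * g.map f := by
    have h1 := congrArg (Polynomial.map f) hg
    simpa [diffPow, hf] using h1
  have hpos : 0 < p ^ i * l := by positivity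
  have hmon : ((X - C X) * g.map f).Monic := by
    rw [← hgK, Monic, leadingCoeff_sub_of_degree_lt, leadingCoeff_diffPow_X ht]
    · simp [hi]
    · refine lt_of_le_of_lt degree_C_le (natDegree_pos_iff_degree_pos.1 ?_)
      rwa [natDegree_diffPow_X ht, Nat.add_sub_cancel]
  have hgm : (g.map f).Monic := (monic_X_sub_C _).of_mul_monic_left hmon
  have hdeg : (g.map f).natDegree + 1 = p ^ i * l := by
    have h1 := congrArg natDegree hgK
    rw [natDegree_sub_C, natDegree_diffPow_X ht, (monic_X_sub_C _).natDegree_mul hgm,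
      natDegree_X_sub_C] at h1
    lia
  have hbal : ∀ u v : K[X][X], u.Monic → v.Monic → g.map f = u * v →
      u.natDegree + v.natDegree ≤ 3 * u.natDegree →
      u.natDegree + v.natDegree ≤ 3 * v.natDegree → False := by
    intro u v hu hv huv
    rw [huv] at hgK
    exact degrees_not_balanced hi hq hq5 hl3 hlodd hl hgcd hu hv hgK
  have hdeg0 : (g.map f).natDegree ≠ 0 := by
    intro h0
    have := Nat.mul_le_mul hq5 hl3
    lia
  obtain ⟨u, v, hu, hv, hui, huv, hlt⟩ := exists_irreducible_of_not_balanced hgm hdeg0 hbal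
  have hσ := map_eq_self_of_irreducible (mapEquiv (frobeniusEquiv K p)) hu hv hui hlt (by
    rw [← huv, Polynomial.map_map]
    congr 1
    ext <;> simp [hf, frobenius_def, ← map_pow, ZMod.pow_card])
  obtain ⟨h, hm, hh⟩ := exists_monic_map_eq (p := p) hu (fun m n ↦ by
    conv_rhs => rw [← hσ]
    simp [frobenius_def])
  refine ⟨h, ?_, by rwa [hh]⟩
  rw [← map_dvd_map f (map_injective _ (algebraMap (ZMod p) K).injective) hm, hh, huv]
  exact dvd_mul_right _ _

end Descent

section Transfer

open Polynomial

lemma map_equivMvPolynomial {R S : Type*} [CommRing R] [CommRing S] (f : R →+* S) (h : R[X][X]) :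
    MvPolynomial.map f (Bivariate.equivMvPolynomial R h) =
      Bivariate.equivMvPolynomial S (h.map (mapRingHom f)) := by
  have : (MvPolynomial.map f).comp (Bivariate.equivMvPolynomial R : R[X][X] →+* MvPolynomial (Fin 2) R) =
      (Bivariate.equivMvPolynomial S : S[X][X] →+* MvPolynomial (Fin 2) S).comp
        (mapRingHom (mapRingHom f)) := by
    ext <;> simp
  exact congrArg (fun φ ↦ φ h) this

lemma irreducible_map_equivMvPolynomial {R S : Type*} [CommRing R] [CommRing S] (f : R →+* S)
    {h : R[X][X]} (hh : Irreducible (h.map (mapRingHom f))) :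
    Irreducible (MvPolynomial.map f (Bivariate.equivMvPolynomial R h)) := by
  rw [map_equivMvPolynomial]
  exact (MulEquiv.irreducible_iff (Bivariate.equivMvPolynomial S)).2 hh

end Transfer

lemma MvPolynomial.totalDegree_pos_of_irreducible_map {σ R S : Type*} [CommRing R] [Field S]
    (f : R →+* S) {h : MvPolynomial σ R} (hh : Irreducible (map f h)) : 0 < h.totalDegree := by
  rw [Nat.pos_iff_ne_zero]
  intro h0
  rw [totalDegree_eq_zero_iff_eq_C.1 h0, map_C] at hh
  have h1 : f (h.coeff 0) ≠ 0 := fun h2 ↦ hh.ne_zero (by rw [h2, C_0])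
  exact hh.not_isUnit ((isUnit_iff_ne_zero.2 h1).map C)

lemma five_le_pow_of_cases {p i l : ℕ}
    (h : (5 ≤ p ∧ 1 ≤ i ∧ 3 < l) ∨ (5 ≤ p ∧ 2 ≤ i ∧ 3 ≤ l) ∨ (p = 3 ∧ 2 ≤ i ∧ 3 ≤ l)) :
    5 ≤ p ^ i := by
  rcases h with ⟨hp, hi, -⟩ | ⟨hp, hi, -⟩ | ⟨rfl, hi, -⟩
  · exact hp.trans (Nat.le_self_pow (by lia) p)
  · exact hp.trans (Nat.le_self_pow (by lia) p)
  · calc 5 ≤ 3 ^ 2 := by norm_num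
      _ ≤ 3 ^ i := Nat.pow_le_pow_right (by norm_num) hi

open MvPolynomial

noncomputable section

/-- Case (B.1): suppose `t = p^i·ℓ + 1` with `gcd(ℓ, p^i - 1) < ℓ`. If
(`p ≥ 5`, `i ≥ 1`, `ℓ > 3`) or (`p ≥ 5`, `i ≥ 2`, `ℓ ≥ 3`) or
(`p = 3`, `i ≥ 2`, `ℓ ≥ 3`), then `g_t` has an absolutely irreducible factor
over `F_p`. -/
theorem gt_has_abs_irred_factor_case_B1
    (p t : ℕ) [Fact p.Prime] (hp2 : p ≠ 2) (ht : 3 ≤ t) (hpt : ¬ p ∣ t)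
    (g : MvPolynomial (Fin 2) (ZMod p))
    (hg : ((X 0 + 1) ^ t - X 0 ^ t - (X 1 + 1) ^ t + X 1 ^ t : MvPolynomial (Fin 2) (ZMod p))
        = (X 0 - X 1) * g)
    (i l : ℕ) (hi : 1 ≤ i) (hl3 : 3 ≤ l) (hlodd : Odd l) (hlp : ¬ p ∣ l)
    (htval : t = p ^ i * l + 1)
    (hgcd : Nat.gcd l (p ^ i - 1) < l)
    (hcases : (5 ≤ p ∧ 1 ≤ i ∧ 3 < l) ∨ (5 ≤ p ∧ 2 ≤ i ∧ 3 ≤ l) ∨ (p = 3 ∧ 2 ≤ i ∧ 3 ≤ l)) :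
    ∃ h : MvPolynomial (Fin 2) (ZMod p), 0 < h.totalDegree ∧ h ∣ g ∧
      Irreducible (MvPolynomial.map (algebraMap (ZMod p) (AlgebraicClosure (ZMod p))) h) := by
  subst htval
  have hg' := congrArg (Polynomial.Bivariate.equivMvPolynomial (ZMod p)).symm hg
  simp only [map_add, map_sub, map_mul, map_pow, map_one,
    Polynomial.Bivariate.equivMvPolynomial_symm_X_0,
    Polynomial.Bivariate.equivMvPolynomial_symm_X_1] at hg'
  obtain ⟨h, hdvd, hirr⟩ := exists_dvd_irreducible_map (AlgebraicClosure (ZMod p)) (by lia) hp2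
    (five_le_pow_of_cases hcases) hl3 hlodd hlp hgcd
    (g := (Polynomial.Bivariate.equivMvPolynomial (ZMod p)).symm g) (by
      simp only [diffPow, Polynomial.C_sub, Polynomial.C_pow, Polynomial.C_add, Polynomial.C_1]
      linear_combination -hg')
  have hirr' := irreducible_map_equivMvPolynomial _ hirr
  refine ⟨_, totalDegree_pos_of_irreducible_map _ hirr', ?_, hirr'⟩
  simpa using map_dvd (Polynomial.Bivariate.equivMvPolynomial (ZMod p)) hdvd
end
end

section
/- Suppose t = p^i·ℓ + 1 where i ≥ 1, ℓ ≥ 3 is odd and not divisible by p, ℓ divides p^i − 1, and ℓ < p^i − 1. Then g_t(x,y) has an absolutely irreducible factor over F_p. -/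
open MvPolynomial

noncomputable section

namespace Polynomial

open IsLocalRing

theorem Monic.dvd_of_dvd_C_mul {R : Type*} [CommRing R] [IsDomain R] {P F : R[X]} (hP : P.Monic)
    {a : R} (ha : a ≠ 0) (h : P ∣ C a * F) : P ∣ F := by
  rw [← modByMonic_eq_zero_iff_dvd hP] at h ⊢
  rw [← smul_eq_C_mul, smul_modByMonic] at h
  exact (smul_eq_zero.mp h).resolve_left ha

theorem isUnit_sub_of_separable_comp {V : Type*} [CommRing V] [IsDomain V] [IsLocalRing V]
    {s z κ μ : V} (hs : s ≠ 0) {f F : V[X]} {m : ℕ}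
    (hF : f.comp (C z + C s * X) = C (s ^ m) * F) (hsep : (F.map (residue V)).Separable)
    (hdvd : (X - C (z + s * κ)) * (X - C (z + s * μ)) ∣ f) : IsUnit (κ - μ) := by
  obtain ⟨r, rfl⟩ := hdvd
  have h1 : (X - C κ) * (X - C μ) ∣ F := by
    refine Monic.dvd_of_dvd_C_mul ((monic_X_sub_C κ).mul (monic_X_sub_C μ)) (pow_ne_zero m hs) ?_
    rw [← hF]
    refine ⟨C s ^ 2 * r.comp (C z + C s * X), ?_⟩
    simp only [mul_comp, sub_comp, add_comp, X_comp, C_comp, C_add, C_mul]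
    ring
  by_contra hu
  have h2 : residue V κ = residue V μ := by
    rw [← sub_eq_zero, ← map_sub, residue_eq_zero_iff]
    exact hu
  have h3 : (X - C (residue V κ)) * (X - C (residue V κ)) ∣ F.map (residue V) := by
    have := Polynomial.map_dvd (residue V) h1
    simpa [← h2] using this
  exact not_isUnit_X_sub_C _ (hsep.squarefree _ h3)

/-- The polynomial `f` over a local ring, read as a germ of plane curve in the parameter `s` and the
variable, has an ordinary point with non-vertical tangents at `z`. -/
def IsOrdinaryAt {V : Type*} [CommRing V] [IsLocalRing V] (f : V[X]) (s z : V) : Prop :=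
  (∃ (m : ℕ) (F : V[X]), f.comp (C z + C s * X) = C (s ^ m) * F ∧
    (F.map (residue V)).Separable) ∧
  ∀ y ∈ maximalIdeal V, f.eval (z + y) = 0 → s ∣ y

theorem IsOrdinaryAt.sub_dvd {V : Type*} [CommRing V] [IsDomain V] [IsLocalRing V]
    {s z α β : V} (hs : s ≠ 0) {f : V[X]} (hf : f.IsOrdinaryAt s z)
    (hdvd : (X - C α) * (X - C β) ∣ f) (hα : α - z ∈ maximalIdeal V)
    (hβ : β - z ∈ maximalIdeal V) : α - β ∣ s := by
  obtain ⟨⟨m, F, hF, hsep⟩, hy⟩ := hf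
  obtain ⟨κ, hκ⟩ := hy _ hα (by
    obtain ⟨r, rfl⟩ := hdvd
    simp)
  obtain ⟨μ, hμ⟩ := hy _ hβ (by
    obtain ⟨r, rfl⟩ := hdvd
    simp)
  obtain rfl : α = z + s * κ := by linear_combination hκ
  obtain rfl : β = z + s * μ := by linear_combination hμ
  obtain ⟨w, hw⟩ := (isUnit_sub_of_separable_comp hs hF hsep hdvd).exists_right_inv
  exact ⟨w, by linear_combination -s * hw⟩

theorem _root_.Multiset.prod_map_dvd_pow {ι R : Type*} [CommMonoid R] (A : Multiset ι)
    (g : ι → R) (e : ι → ℕ) (s : R) (h : ∀ a ∈ A, g a ∣ s ^ e a) :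
    (A.map g).prod ∣ s ^ (A.map e).sum := by
  induction A using Multiset.induction_on with
  | empty => simp
  | cons a A ih =>
    simp only [Multiset.map_cons, Multiset.prod_cons, Multiset.sum_cons, pow_add]
    exact mul_dvd_mul (h a (by simp)) (ih fun b hb => h b (by simp [hb]))

theorem _root_.Multiset.sum_map_sum_map_ite_mul {ι κ : Type*} (A B : Multiset ι) (Z : Finset κ)
    (x : ι → κ → ℕ) :
    (A.map fun a => (B.map fun b => ∑ z ∈ Z, x a z * x b z).sum).sum =
      ∑ z ∈ Z, (A.map fun a => x a z).sum * (B.map fun b => x b z).sum := by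
  simp only [Multiset.sum_map_sum, Multiset.sum_map_mul_left, Multiset.sum_map_mul_right]

theorem rootMultiplicity_prod_X_sub_C {K : Type*} [Field K] [DecidableEq K] (A : Multiset K)
    (z : K) : ((A.map fun a => X - C a).prod).rootMultiplicity z =
      (A.map fun a => if a = z then 1 else 0).sum := by
  rw [← count_roots, roots_multiset_prod_X_sub_C]
  induction A using Multiset.induction_on with
  | empty => simp
  | cons a A ih =>
    simp only [Multiset.count_cons, ih, Multiset.map_cons, Multiset.sum_cons, eq_comm (a := z)]
    ring

/-- Local upper bound for the order of vanishing of a resultant: at ordinary points it is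
the sum of the products of the multiplicities. -/
theorem prod_sub_dvd_pow {k V : Type*} [Field k] [CommRing V] [IsDomain V] [IsLocalRing V]
    (j : k →+* V) {s : V} (hs : s ≠ 0) {f : V[X]} (Z : Finset k)
    (hZ : ∀ ρ : ResidueField V, (X - C ρ) ^ 2 ∣ f.map (residue V) →
      ∃ z ∈ Z, ρ = residue V (j z) ∧ f.IsOrdinaryAt s (j z))
    (A B : Multiset V)
    (hAB : (A.map fun a => X - C a).prod * (B.map fun b => X - C b).prod ∣ f) (u v : k[X])
    (hu : u.map ((residue V).comp j) = ((A.map fun a => X - C a).prod).map (residue V))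
    (hv : v.map ((residue V).comp j) = ((B.map fun b => X - C b).prod).map (residue V)) :
    (A.map fun a => (B.map fun b => a - b).prod).prod ∣
      s ^ (∑ z ∈ Z, u.rootMultiplicity z * v.rootMultiplicity z) := by
  classical
  have key : ∀ (u : k[X]) (A : Multiset V),
      u.map ((residue V).comp j) = ((A.map fun a => X - C a).prod).map (residue V) →
      ∀ z, u.rootMultiplicity z =
        (A.map fun a => if residue V a = residue V (j z) then 1 else 0).sum := by
    intro u A hu z
    rw [eq_rootMultiplicity_map ((residue V).comp j).injective, hu, Polynomial.map_multiset_prod,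
      Multiset.map_map]
    have := rootMultiplicity_prod_X_sub_C (A.map (residue V)) (residue V (j z))
    simpa [Multiset.map_map, Function.comp_def] using this
  simp only [key u A hu, key v B hv]
  rw [← Multiset.sum_map_sum_map_ite_mul A B Z
    fun a z => if residue V a = residue V (j z) then 1 else 0]
  refine Multiset.prod_map_dvd_pow A _ _ _ fun a ha => Multiset.prod_map_dvd_pow B _ _ _
    fun b hb => ?_
  have hab : (X - C a) * (X - C b) ∣ f := by
    refine (mul_dvd_mul ?_ ?_).trans hAB
    · exact Multiset.dvd_prod (Multiset.mem_map_of_mem _ ha)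
    · exact Multiset.dvd_prod (Multiset.mem_map_of_mem _ hb)
  by_cases hr : residue V a = residue V b
  · obtain ⟨z, hz, h1, h2⟩ := hZ (residue V a) (by
      have := Polynomial.map_dvd (residue V) hab
      simpa [← hr, pow_two] using this)
    have h3 : a - b ∣ s := h2.sub_dvd hs hab
      (by rw [← residue_eq_zero_iff, map_sub, h1, sub_self])
      (by rw [← residue_eq_zero_iff, map_sub, ← hr, h1, sub_self])
    refine h3.trans (dvd_pow_self s ?_)
    have : 1 ≤ ∑ z ∈ Z, (if residue V a = residue V (j z) then 1 else 0) *
        (if residue V b = residue V (j z) then 1 else 0) := by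
      refine le_trans ?_ (Finset.single_le_sum (fun _ _ => Nat.zero_le _) hz)
      simp [← hr, h1]
    omega
  · have : IsUnit (a - b) := by
      by_contra hu
      apply hr
      rw [← sub_eq_zero, ← map_sub, residue_eq_zero_iff]
      exact hu
    exact this.dvd

/-- Every nonzero point of the affine line over `k` specializes: an embedding of `k[X]` in a field
extends to a valuation ring centred at the origin. -/
theorem exists_valuationSubring_X_mem_maximalIdeal {k L : Type*} [Field k] [Field L]
    (ψ : k[X] →+* L) (hψ : Function.Injective ψ) :
    ∃ (V : ValuationSubring L) (ι : k[X] →+* V), (∀ P, (ι P : L) = ψ P) ∧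
      ι X ∈ maximalIdeal V := by
  let e := RingEquiv.ofBijective ψ.rangeRestrict
    ⟨fun a b h => hψ (congrArg Subtype.val h), ψ.rangeRestrict_surjective⟩
  let I : Ideal ψ.range := (Ideal.span {(X : k[X])}).comap e.symm
  have hI : I ≠ ⊤ := by
    rw [Ne, Ideal.eq_top_iff_one, Ideal.mem_comap, map_one, Ideal.mem_span_singleton]
    exact fun h => not_isUnit_X (isUnit_of_dvd_one h)
  obtain ⟨V, hV, hm⟩ := Ideal.image_subset_nonunits_valuationSubring I hI
  refine ⟨V, (Subring.inclusion hV).comp ψ.rangeRestrict, fun P => rfl, ?_⟩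
  have h : ψ X ∈ (V.nonunits : Set L) := by
    refine hm ⟨ψ.rangeRestrict X, ?_, rfl⟩
    change e.symm (e X) ∈ Ideal.span {(X : k[X])}
    rw [e.symm_apply_apply]
    exact Ideal.mem_span_singleton_self X
  rw [← V.image_maximalIdeal] at h
  obtain ⟨y, hy, hyx⟩ := h
  have : y = (Subring.inclusion hV).comp ψ.rangeRestrict X := Subtype.ext hyx
  exact this ▸ hy

end Polynomial

/-- The homogenization `((z + s) ^ t - z ^ t) / s` for `t = q * l + 1`, where `q` is a power of the
characteristic. -/
def homogDiff {R : Type*} [CommRing R] (q l : ℕ) (s z : R) : R :=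
  (z ^ q + s ^ q) ^ l +
    z * s ^ (q - 1) * ∑ i ∈ Finset.range l, (z ^ q + s ^ q) ^ i * (z ^ q) ^ (l - 1 - i)

theorem map_homogDiff {R S : Type*} [CommRing R] [CommRing S] (φ : R →+* S) (q l : ℕ) (s z : R) :
    φ (homogDiff q l s z) = homogDiff q l (φ s) (φ z) := by
  simp [homogDiff]

theorem mul_homogDiff {R : Type*} [CommRing R] (p : ℕ) [Fact p.Prime] [CharP R p] (i l : ℕ)
    (s z : R) : s * homogDiff (p ^ i) l s z =
      (z + s) ^ (p ^ i * l + 1) - z ^ (p ^ i * l + 1) := by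
  have h0 : s * s ^ (p ^ i - 1) = s ^ p ^ i :=
    mul_pow_sub_one (pow_ne_zero _ (Fact.out : p.Prime).ne_zero) s
  have h1 := (Commute.all (z ^ p ^ i + s ^ p ^ i) (z ^ p ^ i)).mul_geom_sum₂ l
  rw [homogDiff, pow_succ, pow_succ, pow_mul, pow_mul, add_pow_char_pow, mul_add]
  rw [add_sub_cancel_left] at h1
  linear_combination z * h1 + z * (∑ j ∈ Finset.range l,
    (z ^ p ^ i + s ^ p ^ i) ^ j * (z ^ p ^ i) ^ (l - 1 - j)) * h0

theorem exists_geomSum_eq {R : Type*} [CommRing R] (l : ℕ) (a b : R) :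
    ∃ d, ∑ i ∈ Finset.range l, (a + b) ^ i * a ^ (l - 1 - i) = l * a ^ (l - 1) + b * d := by
  have h : b ∣ ∑ i ∈ Finset.range l, ((a + b) ^ i - a ^ i) * a ^ (l - 1 - i) :=
    Finset.dvd_sum fun i _ => Dvd.dvd.mul_right
      (by simpa using sub_dvd_pow_sub_pow (a + b) a i) _
  obtain ⟨d, hd⟩ := h
  refine ⟨d, ?_⟩
  rw [← hd]
  simp only [sub_mul, Finset.sum_sub_distrib]
  have : ∑ i ∈ Finset.range l, a ^ i * a ^ (l - 1 - i) = l * a ^ (l - 1) := by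
    rw [Finset.sum_congr rfl (g := fun _ => a ^ (l - 1))]
    · simp
    · intro i hi
      rw [← pow_add]
      congr 1
      have := Finset.mem_range.mp hi
      omega
  rw [this]
  ring

/-- Expansion of `homogDiff` at a point at infinity. -/
theorem exists_homogDiff_sub_eq {R : Type*} [CommRing R] (p : ℕ) [Fact p.Prime] [CharP R p]
    (i l : ℕ) {ω : R} (hl : 1 ≤ l) (hω : ω ^ l = 1) (hωq : ω ^ p ^ i = ω) (s y : R) :
    ∃ a b c d, homogDiff (p ^ i) l s (ω + y) - homogDiff (p ^ i) l s 1 =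
      l * ω ^ (l - 1) * (y ^ p ^ i + s ^ (p ^ i - 1) * y + (1 - ω) * s ^ p ^ i)
      + (y ^ p ^ i + s ^ p ^ i) ^ 2 * a + (s ^ p ^ i) ^ 2 * b
      + s ^ (p ^ i - 1) * (y ^ p ^ i * c + s ^ p ^ i * d) := by
  set q := p ^ i with hq
  have hω' : ω ^ (l - 1) * ω = 1 := by rw [pow_sub_one_mul (by omega), hω]
  obtain ⟨a, ha⟩ := Polynomial.powAddExpansion ω (y ^ q + s ^ q) l
  obtain ⟨b, hb⟩ := Polynomial.powAddExpansion 1 (s ^ q) l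
  obtain ⟨d, hd⟩ := exists_geomSum_eq l (ω + y ^ q) (s ^ q)
  obtain ⟨d', hd'⟩ := exists_geomSum_eq l (1 : R) (s ^ q)
  obtain ⟨c, hc⟩ := sub_dvd_pow_sub_pow (ω + y ^ q) ω (l - 1)
  refine ⟨a, -b, (ω + y) * l * c, (ω + y) * d - d', ?_⟩
  have hy : (ω + y) ^ q = ω + y ^ q := by rw [hq, add_pow_char_pow, ← hq, hωq]
  rw [homogDiff, homogDiff, hy, hd]
  simp only [one_pow, mul_one, one_mul] at hd' hb ⊢
  rw [hd', hb, add_assoc ω, ha, hω]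
  rw [add_sub_cancel_left, sub_eq_iff_eq_add] at hc
  rw [hc]
  linear_combination (l * s ^ q + l * s ^ (q - 1)) * hω'

/-- Expansion of `(x + 1) ^ t - x ^ t` at a critical point. -/
theorem exists_diff_eq {R : Type*} [CommRing R] (p : ℕ) [Fact p.Prime] [CharP R p]
    (i l : ℕ) {z : R} (hz : (z + 1) ^ l = z ^ l) (hzq : z ^ p ^ i = z) (y : R) :
    ∃ b, (z + y + 1) ^ (p ^ i * l + 1) - (z + y) ^ (p ^ i * l + 1) =
      z ^ l + y ^ (p ^ i + 1) * (l * ((z + 1) ^ (l - 1) - z ^ (l - 1)) + y ^ (p ^ i - 1) * b) := by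
  set q := p ^ i with hq
  have hq0 : q ≠ 0 := pow_ne_zero _ (Fact.out : p.Prime).ne_zero
  obtain ⟨a, ha⟩ := Polynomial.powAddExpansion z (y ^ q) l
  obtain ⟨b, hb⟩ := Polynomial.powAddExpansion (z + 1) (y ^ q) l
  refine ⟨(z + y + 1) * b - (z + y) * a, ?_⟩
  have h1 : (z + y) ^ q = z + y ^ q := by rw [hq, add_pow_char_pow, ← hq, hzq]
  have h2 : (z + y + 1) ^ q = z + 1 + y ^ q := by
    rw [hq, add_pow_char_pow, one_pow, ← hq, h1]; ring
  have h3 : y ^ (q - 1) * y = y ^ q := pow_sub_one_mul hq0 y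
  rw [pow_succ, pow_succ, pow_mul, pow_mul, h1, h2, ha, hb, hz, pow_succ]
  have h4 : z ^ (l - 1) * z * l = z ^ l * l := by
    rcases Nat.eq_zero_or_pos l with rfl | h
    · simp
    · rw [pow_sub_one_mul h.ne']
  have h5 : (z + 1) ^ (l - 1) * (z + 1) * l = z ^ l * l := by
    rcases Nat.eq_zero_or_pos l with rfl | h
    · simp
    · rw [pow_sub_one_mul h.ne', hz]
  linear_combination y ^ q * h5 - y ^ q * h4 - y ^ q * ((z + y + 1) * b - (z + y) * a) * h3

namespace Polynomial

open IsLocalRing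

theorem dvd_or_exists_eq_mul {V : Type*} [CommRing V] [IsDomain V] [ValuationRing V] (s y : V) :
    s ∣ y ∨ ∃ r ∈ maximalIdeal V, s = y * r := by
  rcases ValuationRing.dvd_total s y with h | ⟨r, hr⟩
  · exact Or.inl h
  · by_cases hu : IsUnit r
    · obtain ⟨w, hw⟩ := hu.exists_right_inv
      exact Or.inl ⟨w, by rw [hr, mul_assoc, hw, mul_one]⟩
    · exact Or.inr ⟨r, hu, hr⟩

theorem ne_zero_of_isUnit_sub_mem {V : Type*} [CommRing V] [IsLocalRing V] {e x : V}
    (he : IsUnit e) (hx : x - e ∈ maximalIdeal V) : x ≠ 0 := by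
  rintro rfl
  rw [zero_sub, neg_mem_iff] at hx
  exact hx he

theorem isOrdinaryAt_affine {V : Type*} [CommRing V] [IsDomain V] [ValuationRing V] (p : ℕ)
    [Fact p.Prime] [CharP V p] {i l : ℕ} (hi : 1 ≤ i) {s c z : V} (hs : s ∈ maximalIdeal V)
    (hc : (c + 1) ^ l = c ^ l) (hcq : c ^ p ^ i = c) (hz : (z + 1) ^ l = z ^ l)
    (hzq : z ^ p ^ i = z) (hcz : z ^ l = c ^ l)
    (hcu : IsUnit (l * ((c + 1) ^ (l - 1) - c ^ (l - 1))))
    (hzu : IsUnit (l * ((z + 1) ^ (l - 1) - z ^ (l - 1)))) :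
    ((X + 1) ^ (p ^ i * l + 1) - X ^ (p ^ i * l + 1) -
      C ((c + s + 1) ^ (p ^ i * l + 1) - (c + s) ^ (p ^ i * l + 1)) : V[X]).IsOrdinaryAt s z := by
  have hq1 : p ^ i - 1 ≠ 0 := by
    have := Nat.pow_le_pow_right (Fact.out : p.Prime).pos hi
    have := (Fact.out : p.Prime).two_le
    rw [pow_one] at *
    omega
  obtain ⟨b, hb⟩ := exists_diff_eq p i l hc hcq s
  rw [hb]
  refine ⟨⟨p ^ i + 1, ?_⟩, ?_⟩
  · obtain ⟨b', hb'⟩ := exists_diff_eq (R := V[X]) p i l (z := C z)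
      (by rw [← C_1, ← C_add, ← C_pow, hz, C_pow]) (by rw [← C_pow, hzq]) (C s * X)
    refine ⟨X ^ (p ^ i + 1) * (C (l * ((z + 1) ^ (l - 1) - z ^ (l - 1))) +
      (C s * X) ^ (p ^ i - 1) * b') -
      C (l * ((c + 1) ^ (l - 1) - c ^ (l - 1)) + s ^ (p ^ i - 1) * b), ?_, ?_⟩
    · simp only [sub_comp, pow_comp, add_comp, X_comp, one_comp, C_comp]
      rw [hb', ← hcz]
      simp only [C_mul, C_add, C_sub, C_pow, C_1, map_natCast]
      ring
    · have hs0 : residue V s = 0 := (residue_eq_zero_iff s).mpr hs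
      set u := residue V (l * ((z + 1) ^ (l - 1) - z ^ (l - 1)))
      set w := residue V (l * ((c + 1) ^ (l - 1) - c ^ (l - 1)))
      have hu0 : u ≠ 0 := (hzu.map (residue V)).ne_zero
      have hw0 : w ≠ 0 := (hcu.map (residue V)).ne_zero
      have : CharP (ResidueField V) p :=
        .of_ringHom_of_ne_zero (residue V) p (Fact.out : p.Prime).ne_zero
      have hqk : ((p ^ i + 1 : ℕ) : ResidueField V) ≠ 0 := by
        rw [Nat.cast_add, Nat.cast_pow, CharP.cast_eq_zero, zero_pow (by omega)]
        simp
      have h := Separable.unit_mul (isUnit_C.mpr hu0.isUnit)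
        (separable_X_pow_sub_C (w / u) hqk (div_ne_zero hw0 hu0))
      rw [mul_sub, ← C_mul, mul_div_cancel₀ _ hu0] at h
      convert h using 1
      simp only [Polynomial.map_sub, Polynomial.map_mul, Polynomial.map_add, Polynomial.map_pow,
        map_X, map_C, hs0, C_0, zero_mul, zero_pow hq1, add_zero]
      rw [map_add, map_mul (residue V) (s ^ _), map_pow, hs0, zero_pow hq1, zero_mul, add_zero,
        mul_comm]
  · intro y hy h0
    rcases dvd_or_exists_eq_mul s y with h | ⟨r, hr, rfl⟩
    · exact h
    obtain ⟨b', hb'⟩ := exists_diff_eq p i l hz hzq y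
    have h1 : y ^ (p ^ i + 1) * ((l * ((z + 1) ^ (l - 1) - z ^ (l - 1)) + y ^ (p ^ i - 1) * b') -
       r ^ (p ^ i + 1) *
       (l * ((c + 1) ^ (l - 1) - c ^ (l - 1)) + (y * r) ^ (p ^ i - 1) * b)) = 0 := by
      simp only [eval_sub, eval_pow, eval_add, eval_X, eval_one, eval_C] at h0
      rw [hb', ← hcz] at h0
      rw [← h0]
      ring
    rcases mul_eq_zero.mp h1 with h | h
    · rw [eq_zero_of_pow_eq_zero h]
      exact dvd_zero _
    · refine absurd h (ne_zero_of_isUnit_sub_mem hzu ?_)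
      rw [sub_right_comm, add_sub_cancel_left]
      exact sub_mem (Ideal.mul_mem_right _ _ (Ideal.pow_mem_of_mem _ hy _ (by omega)))
        (Ideal.mul_mem_right _ _ (Ideal.pow_mem_of_mem _ hr _ (by omega)))

theorem isOrdinaryAt_infinity {V : Type*} [CommRing V] [IsDomain V] [ValuationRing V] (p : ℕ)
    [Fact p.Prime] [CharP V p] {i l : ℕ} (hi : 1 ≤ i) (hp : 3 ≤ p ^ i) (hl : 1 ≤ l)
    (hlu : IsUnit (l : V)) {s ω : V} (hs : s ∈ maximalIdeal V)
    (hω : ω ^ l = 1) (hωq : ω ^ p ^ i = ω) :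
    (homogDiff (p ^ i) l (C s) X - C (homogDiff (p ^ i) l s 1) : V[X]).IsOrdinaryAt s ω := by
  obtain ⟨q, hq⟩ : ∃ q, p ^ i = q + 3 := ⟨p ^ i - 3, by omega⟩
  have hs0 : residue V s = 0 := (residue_eq_zero_iff s).mpr hs
  have hu : IsUnit (l * ω ^ (l - 1)) := hlu.mul ((IsUnit.of_pow_eq_one hω (by omega)).pow _)
  refine ⟨⟨p ^ i, ?_⟩, ?_⟩
  · obtain ⟨a, b, c, d, h⟩ := exists_homogDiff_sub_eq (R := V[X]) p i l (ω := C ω) hl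
      (by rw [← C_pow, hω, C_1]) (by rw [← C_pow, hωq]) (C s) (C s * X)
    refine ⟨C (l * ω ^ (l - 1)) * (X ^ p ^ i + X + C (1 - ω)) + C s * (C s ^ (q + 2) *
      ((X ^ p ^ i + 1) ^ 2 * a + b) + C s ^ (q + 1) * (X ^ p ^ i * c + d)), ?_, ?_⟩
    · have h1 : ∀ g : V[X], (homogDiff (p ^ i) l (C s) X).comp g = homogDiff (p ^ i) l (C s) g := by
        intro g
        have := map_homogDiff (compRingHom g) (p ^ i) l (C s) X
        simpa using this
      rw [sub_comp, C_comp, h1]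
      have h2 := map_homogDiff (C : V →+* V[X]) (p ^ i) l s 1
      rw [h2, C_1, h]
      simp only [C_mul, C_sub, C_pow, C_1, map_natCast, hq,
        show q + 3 - 1 = q + 2 from rfl]
      ring
    · set u := residue V (l * ω ^ (l - 1))
      have hu0 : IsUnit u := hu.map (residue V)
      have : CharP (ResidueField V) p :=
        .of_ringHom_of_ne_zero (residue V) p (Fact.out : p.Prime).ne_zero
      have h := separable_C_mul_X_pow_add_C_mul_X_add_C (n := p ^ i) u u
        (residue V (l * ω ^ (l - 1) * (1 - ω))) (by
          rw [Nat.cast_pow, CharP.cast_eq_zero, zero_pow (by omega)]) hu0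
      refine (congrArg Separable ?_).mpr h
      simp only [Polynomial.map_mul, Polynomial.map_add, Polynomial.map_pow,
        map_X, map_C, hs0, C_0, zero_mul]
      rw [map_mul (residue V) (_ * _), C_mul]
      ring
  · intro y hy h0
    rcases dvd_or_exists_eq_mul s y with h | ⟨r, hr, rfl⟩
    · exact h
    obtain ⟨a, b, c, d, h⟩ := exists_homogDiff_sub_eq p i l hl hω hωq (y * r) y
    have h1 := map_homogDiff (evalRingHom (ω + y)) (p ^ i) l (C (y * r)) X
    simp only [coe_evalRingHom, eval_C, eval_X] at h1
    rw [eval_sub, eval_C, h1, h, hq, show q + 3 - 1 = q + 2 from rfl] at h0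
    have h2 : y ^ (q + 3) * (l * ω ^ (l - 1) + (l * ω ^ (l - 1) * (r ^ (q + 2)
        + (1 - ω) * r ^ (q + 3))
      + y ^ (q + 3) * ((1 + r ^ (q + 3)) ^ 2 * a + r ^ (2 * q + 6) * b)
      + y ^ (q + 2) * (r ^ (q + 2) * (c + r ^ (q + 3) * d)))) = 0 := by
      rw [← h0]
      ring
    rcases mul_eq_zero.mp h2 with h | h
    · rw [eq_zero_of_pow_eq_zero h, zero_mul]
    · refine absurd h (ne_zero_of_isUnit_sub_mem hu ?_)
      rw [add_sub_cancel_left]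
      have hr' : ∀ n, r ^ (n + 1) ∈ maximalIdeal V := fun n =>
        Ideal.pow_mem_of_mem _ hr _ (by omega)
      have hy' : ∀ n, y ^ (n + 1) ∈ maximalIdeal V := fun n =>
        Ideal.pow_mem_of_mem _ hy _ (by omega)
      exact add_mem (add_mem (Ideal.mul_mem_left _ _ (add_mem (hr' _)
        (Ideal.mul_mem_left _ _ (hr' _)))) (Ideal.mul_mem_right _ _ (hy' _)))
        (Ideal.mul_mem_right _ _ (hy' _))

theorem _root_.ValuationSubring.exists_eq_prod_X_sub_C {L : Type*} [Field L] [IsAlgClosed L]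
    (V : ValuationSubring L) {P : V[X]} (hP : P.Monic) :
    ∃ A : Multiset V, P = (A.map fun a => X - C a).prod := by
  have hs := (IsAlgClosed.splits (P.map V.subtype)).eq_prod_roots_of_monic (hP.map _)
  have hr : ∀ x ∈ (P.map V.subtype).roots, x ∈ V := by
    intro x hx
    have h : IsIntegral V x := ⟨P, hP, by
      have := (mem_roots'.mp hx).2
      rwa [IsRoot.def, eval_map] at this⟩
    obtain ⟨y, rfl⟩ := IsIntegrallyClosed.isIntegral_iff.mp h
    exact y.2
  obtain ⟨A, hA⟩ : ∃ A : Multiset V, A.map V.subtype = (P.map V.subtype).roots :=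
    ⟨(P.map V.subtype).roots.pmap (fun x hx => ⟨x, hx⟩) hr, by
      rw [Multiset.map_pmap]
      exact (Multiset.pmap_eq_map _ _ _ _).trans (Multiset.map_id _)⟩
  refine ⟨A, map_injective V.subtype Subtype.val_injective ?_⟩
  rw [hs, ← hA, Polynomial.map_multiset_prod, Multiset.map_map, Multiset.map_map]
  simp [Function.comp_def]

theorem resultant_prod_X_sub_C {R : Type*} [CommRing R] [IsDomain R] (A B : Multiset R) :
    resultant (A.map fun a => X - C a).prod (B.map fun b => X - C b).prod =
      (A.map fun a => (B.map fun b => a - b).prod).prod := by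
  induction A using Multiset.induction_on with
  | empty => simp
  | cons a A ih =>
    have hA : ((A.map fun a => X - C a).prod).Monic := monic_multisetProd_X_sub_C A
    rw [Multiset.map_cons, Multiset.prod_cons, Multiset.map_cons, Multiset.prod_cons,
      (monic_X_sub_C a).natDegree_mul hA, resultant_mul_left _ _ _ _ le_rfl, ih,
      natDegree_X_sub_C, resultant_X_sub_C_left _ _ _ le_rfl, eval_multiset_prod,
      Multiset.map_map]
    simp

/-- Numerical conditions on `p`, `i` and `l` in the case `t = p ^ i * l + 1`. -/
structure Admissible (p i l : ℕ) : Prop where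
  one_le : 1 ≤ i
  three_le : 3 ≤ l
  not_dvd : ¬ p ∣ l
  dvd : l ∣ p ^ i - 1
  le : 2 * l + 1 ≤ p ^ i

/-- The polynomial `(X + 1) ^ t - X ^ t`. -/
def diffPoly (R : Type*) [CommRing R] (t : ℕ) : R[X] := (X + 1) ^ t - X ^ t

/-- The polynomial `h(Y) - h(X)` in `R[X][Y]` where `h = diffPoly R t`. -/
def diffCurve (R : Type*) [CommRing R] (t : ℕ) : R[X][X] :=
  (diffPoly R t).map C - C (diffPoly R t)

/-- The roots of `(X + 1) ^ l - X ^ l`. -/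
def critPts (k : Type*) [Field k] (l : ℕ) : Finset k := by
  classical exact (diffPoly k l).roots.toFinset

/-- The multiplicity of `z` as a root of the restriction of `u` to the line `X = c`. -/
def affMult {k : Type*} [Field k] (u : k[X][X]) (c z : k) : ℕ :=
  (u.map (evalRingHom c)).rootMultiplicity z

/-- The substitution `Y = Z * X`, with values in `k[Z][X]`. -/
def slopeHom (k : Type*) [Field k] : k[X][X] →+* k[X][X] :=
  eval₂RingHom (mapRingHom C) (C X * X)

/-- The multiplicity of the linear form `Y - ω * X` in the top homogeneous part of `u`. -/
def infMult {k : Type*} [Field k] (u : k[X][X]) (ω : k) : ℕ :=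
  (slopeHom k u).leadingCoeff.rootMultiplicity ω

theorem map_diffPoly {R S : Type*} [CommRing R] [CommRing S] (φ : R →+* S) (t : ℕ) :
    (diffPoly R t).map φ = diffPoly S t := by
  simp [diffPoly]

theorem map_diffCurve {R S : Type*} [CommRing R] [CommRing S] (φ : R[X] →+* S) (t : ℕ) :
    (diffCurve R t).map φ = diffPoly S t - C ((φ X + 1) ^ t - φ X ^ t) := by
  rw [diffCurve, map_diffPoly, Polynomial.map_sub, map_diffPoly, map_C]
  simp [diffPoly]

section crit

variable {k : Type*} [Field k] {p i l : ℕ}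

theorem coeff_pow_add_one_sub_pow (l : ℕ) (hl : 1 ≤ l) : (diffPoly k l).coeff (l - 1) = l := by
  rw [diffPoly, coeff_sub, coeff_X_add_one_pow, coeff_X_pow, if_neg (by omega), sub_zero,
    Nat.choose_symm_of_eq_add (b := 1) (by omega), Nat.choose_one_right]

theorem natDegree_diffPoly_le (R : Type*) [CommRing R] [Nontrivial R] (l : ℕ) :
    (diffPoly R l).natDegree ≤ l - 1 := by
  rw [natDegree_le_iff_coeff_eq_zero]
  intro n hn
  rw [diffPoly, coeff_sub, coeff_X_add_one_pow, coeff_X_pow]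
  rcases (show l ≤ n by omega).eq_or_lt with rfl | h
  · simp
  · rw [Nat.choose_eq_zero_of_lt h, if_neg (by omega)]
    simp

theorem Admissible.natCast_ne_zero (h : Admissible p i l) (R : Type*) [CommRing R] [CharP R p] :
    (l : R) ≠ 0 := fun h0 => h.not_dvd ((CharP.cast_eq_zero_iff R p l).mp h0)

theorem Admissible.diffPoly_ne_zero [CharP k p] (h : Admissible p i l) : diffPoly k l ≠ 0 := by
  intro h0
  have := coeff_pow_add_one_sub_pow (k := k) l (by have := h.three_le; omega)
  rw [h0, coeff_zero] at this
  exact h.natCast_ne_zero k this.symm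

theorem card_critPts_le : (critPts k l).card ≤ l - 1 := by
  classical
  rw [critPts]
  exact (Multiset.toFinset_card_le _).trans ((card_roots' _).trans (natDegree_diffPoly_le k l))

theorem Admissible.mem_critPts [CharP k p] (h : Admissible p i l) {c : k} :
    c ∈ critPts k l ↔ (c + 1) ^ l = c ^ l := by
  classical
  rw [critPts, Multiset.mem_toFinset, mem_roots h.diffPoly_ne_zero]
  simp [diffPoly, sub_eq_zero]

theorem Admissible.ne_zero_of_mem (h : Admissible p i l) {c : k}
    (hc : (c + 1) ^ l = c ^ l) : c ≠ 0 := by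
  rintro rfl
  have := h.three_le
  rw [zero_pow (by omega), zero_add, one_pow] at hc
  exact one_ne_zero hc

theorem Admissible.pow_eq_self [Fact p.Prime] [CharP k p] (h : Admissible p i l) {c : k}
    (hc : (c + 1) ^ l = c ^ l) : c ^ p ^ i = c := by
  have hc0 := h.ne_zero_of_mem hc
  obtain ⟨m, hm⟩ := h.dvd
  have hq := h.le
  have h1 : (c + 1) ^ (p ^ i - 1) = c ^ (p ^ i - 1) := by rw [hm, pow_mul, hc, pow_mul]
  have h2 : (c + 1) ^ p ^ i = c ^ p ^ i + 1 := by rw [add_pow_char_pow, one_pow]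
  rw [← pow_sub_one_mul (by omega), h1, mul_add, pow_sub_one_mul (by omega), mul_one] at h2
  have h3 : c ^ (p ^ i - 1) = 1 := add_left_cancel h2
  rw [← pow_sub_one_mul (by omega), h3, one_mul]

theorem Admissible.deriv_ne_zero [CharP k p] (h : Admissible p i l) {c : k}
    (hc : (c + 1) ^ l = c ^ l) : l * ((c + 1) ^ (l - 1) - c ^ (l - 1)) ≠ 0 := by
  have h3 := h.three_le
  refine mul_ne_zero (h.natCast_ne_zero k) fun h0 => ?_
  rw [sub_eq_zero] at h0
  rw [← pow_sub_one_mul (by omega) (c + 1), h0, mul_add, pow_sub_one_mul (by omega),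
    mul_one, add_eq_left] at hc
  have hc0 : c = 0 := eq_zero_of_pow_eq_zero hc
  subst hc0
  rw [zero_pow (by omega)] at h0
  simp at h0

theorem Admissible.derivative_diffPoly (h : Admissible p i l) (R : Type*) [CommRing R]
    [Fact p.Prime] [CharP R p] :
    derivative (diffPoly R (p ^ i * l + 1)) = (diffPoly R l) ^ p ^ i := by
  have hi := h.one_le
  rw [diffPoly, diffPoly, sub_pow_char_pow]
  simp only [derivative_sub, derivative_pow, derivative_add, derivative_X, derivative_one,
    add_zero, mul_one, add_tsub_cancel_right]
  rw [Nat.cast_add, Nat.cast_mul, Nat.cast_pow, CharP.cast_eq_zero, zero_pow (by omega)]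
  simp [← pow_mul, mul_comm]

end crit

theorem exists_ringHom_X_sub_C_mem {k : Type*} [Field k] (c : k) :
    ∃ (V : ValuationSubring (AlgebraicClosure (RatFunc k))) (ι : k[X] →+* V),
      Function.Injective ι ∧ ι (X - C c) ∈ maximalIdeal V := by
  let ψ : k[X] →+* AlgebraicClosure (RatFunc k) :=
    (algebraMap (RatFunc k) _).comp (algebraMap k[X] (RatFunc k))
  have hψ : Function.Injective ψ :=
    (algebraMap (RatFunc k) _).injective.comp (IsFractionRing.injective k[X] (RatFunc k))
  obtain ⟨V, ι, h1, h2⟩ := exists_valuationSubring_X_mem_maximalIdeal ψ hψ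
  have hι : Function.Injective ι := fun a b hab =>
    hψ (by rw [← h1, ← h1, hab])
  refine ⟨V, ι.comp (algEquivAevalXAddC c : k[X] →+* k[X]), hι.comp
    (algEquivAevalXAddC c).injective, ?_⟩
  simpa using h2

/-- The resultant of two factors of `diffCurve` vanishes at a critical point to the order expected
for curves with ordinary intersections. -/
theorem Admissible.rootMultiplicity_resultant_le {k : Type*} [Field k] [IsAlgClosed k]
    {p i l : ℕ} [Fact p.Prime] [CharP k p] (h : Admissible p i l) {u v : k[X][X]} (hu : u.Monic)
    (hv : v.Monic) (huv : u * v ∣ diffCurve k (p ^ i * l + 1)) {c : k} (hc : c ∈ critPts k l) :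
    (resultant u v).rootMultiplicity c ≤ ∑ z ∈ critPts k l, affMult u c z * affMult v c z := by
  obtain ⟨V, ι, hι, hs⟩ := exists_ringHom_X_sub_C_mem c
  set s := ι (X - C c) with hs_def
  have hs0 : s ≠ 0 := by
    rw [hs_def, Ne, map_eq_zero_iff ι hι]
    exact X_sub_C_ne_zero c
  let j : k →+* V := ι.comp C
  have hιX : ι X = j c + s := by
    rw [hs_def, map_sub]
    simp [j]
  have hVp : CharP V p := charP_of_injective_ringHom j.injective p
  have hκp : CharP (ResidueField V) p :=
    .of_ringHom_of_ne_zero (residue V) p (Fact.out : p.Prime).ne_zero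
  obtain ⟨A, hA⟩ := V.exists_eq_prod_X_sub_C (hu.map ι)
  obtain ⟨B, hB⟩ := V.exists_eq_prod_X_sub_C (hv.map ι)
  have hres : (residue V).comp ι = ((residue V).comp j).comp (evalRingHom c) := by
    ext a
    · simp [j]
    · simp [hιX, (residue_eq_zero_iff s).mpr hs]
  have hmem : ∀ {z}, z ∈ critPts k l → (j z + 1) ^ l = j z ^ l ∧ j z ^ p ^ i = j z ∧
      IsUnit (l * ((j z + 1) ^ (l - 1) - j z ^ (l - 1))) := by
    intro z hz
    rw [h.mem_critPts] at hz
    refine ⟨?_, ?_, ?_⟩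
    · rw [← map_one j, ← map_add, ← map_pow, hz, map_pow]
    · rw [← map_pow, h.pow_eq_self hz]
    · have := (h.deriv_ne_zero hz).isUnit.map j
      simpa using this
  have key := prod_sub_dvd_pow j hs0 (f := (diffCurve k (p ^ i * l + 1)).map ι) (critPts k l)
    (fun ρ hρ => ?_) A B ?_ (u.map (evalRingHom c)) (v.map (evalRingHom c)) ?_ ?_
  · rw [← resultant_prod_X_sub_C, ← hA, ← hB, hu.natDegree_map, hv.natDegree_map,
      resultant_map_map] at key
    refine (pow_dvd_pow_iff hs0 hs).mp (dvd_trans ?_ key)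
    rw [hs_def, ← map_pow]
    exact _root_.map_dvd ι (pow_rootMultiplicity_dvd _ _)
  · obtain ⟨hc1, hcq, hcu⟩ := hmem hc
    rw [Polynomial.map_map, map_diffCurve] at hρ
    have hρ1 : (ρ + 1) ^ l = ρ ^ l := by
      obtain ⟨g, hg⟩ := hρ
      have := congrArg (fun P => (derivative P).eval ρ) hg
      simp only [derivative_sub, h.derivative_diffPoly, derivative_C, derivative_mul,
        derivative_pow] at this
      have h2 : (eval ρ (diffPoly (ResidueField V) l)) ^ p ^ i = 0 := by
        simpa using this
      have h3 := eq_zero_of_pow_eq_zero h2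
      simpa [diffPoly, sub_eq_zero] using h3
    obtain ⟨z, hz⟩ := (IsAlgClosed.splits (diffPoly k l)).mem_range_of_isRoot h.diffPoly_ne_zero
      (i := (residue V).comp j) (x := ρ) (by simp [diffPoly, hρ1])
    have hz1 : (z + 1) ^ l = z ^ l := by
      apply ((residue V).comp j).injective
      rw [map_pow, map_pow, map_add, map_one, hz, hρ1]
    have hz' := h.mem_critPts.mpr hz1
    refine ⟨z, hz', hz.symm, ?_⟩
    obtain ⟨hz2, hzq, hzu⟩ := hmem hz'
    have hzc : z ^ l = c ^ l := by
      apply ((residue V).comp j).injective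
      have h0 := (dvd_pow_self _ two_ne_zero).trans hρ
      rw [dvd_iff_isRoot, IsRoot.def, eval_sub, eval_C, hres, sub_eq_zero, ← hz] at h0
      obtain ⟨b, hb⟩ := exists_diff_eq p i l hz1 (h.pow_eq_self hz1) 0
      obtain ⟨b', hb'⟩ := exists_diff_eq p i l (h.mem_critPts.mp hc)
        (h.pow_eq_self (h.mem_critPts.mp hc)) 0
      rw [add_zero, zero_pow (by omega), zero_mul, add_zero] at hb hb'
      rw [← hb, ← hb']
      simpa [diffPoly] using h0
    rw [map_diffCurve, hιX]
    exact isOrdinaryAt_affine p h.one_le hs hc1 hcq hz2 hzq (by rw [← map_pow, hzc, map_pow]) hcu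
      hzu
  · rw [← hA, ← hB, ← Polynomial.map_mul]
    exact Polynomial.map_dvd ι huv
  · rw [Polynomial.map_map, ← hres, ← Polynomial.map_map, hA]
  · rw [Polynomial.map_map, ← hres, ← Polynomial.map_map, hB]

section infinity

variable {k : Type*} [Field k]

theorem Admissible.monic_diffPoly {p i l : ℕ} [CharP k p] (h : Admissible p i l) :
    (diffPoly k (p ^ i * l + 1)).Monic ∧ (diffPoly k (p ^ i * l + 1)).natDegree = p ^ i * l := by
  have h1 := natDegree_diffPoly_le k (p ^ i * l + 1)
  have h2 := coeff_pow_add_one_sub_pow (k := k) (p ^ i * l + 1) (by omega)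
  have hi := h.one_le
  rw [add_tsub_cancel_right] at h1 h2
  rw [Nat.cast_add, Nat.cast_mul, Nat.cast_pow, CharP.cast_eq_zero, zero_pow (by omega), zero_mul,
    zero_add, Nat.cast_one] at h2
  refine ⟨monic_of_natDegree_le_of_coeff_eq_one _ h1 h2,
    le_antisymm h1 (le_natDegree_of_ne_zero ?_)⟩
  rw [h2]
  exact one_ne_zero

theorem Admissible.degree_C_lt {p i l : ℕ} [CharP k p] (h : Admissible p i l) :
    (C (diffPoly k (p ^ i * l + 1))).degree < ((diffPoly k (p ^ i * l + 1)).map C).degree := by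
  refine degree_C_le.trans_lt ?_
  rw [degree_map_eq_of_injective C_injective, degree_eq_natDegree h.monic_diffPoly.1.ne_zero,
    h.monic_diffPoly.2]
  have := h.le
  have := h.three_le
  exact_mod_cast Nat.mul_pos (by omega) (by omega)

theorem Admissible.monic_diffCurve {p i l : ℕ} [CharP k p] (h : Admissible p i l) :
    (diffCurve k (p ^ i * l + 1)).Monic :=
  (h.monic_diffPoly.1.map C).sub_of_left h.degree_C_lt

theorem Admissible.natDegree_diffCurve {p i l : ℕ} [CharP k p] (h : Admissible p i l) :
    (diffCurve k (p ^ i * l + 1)).natDegree = p ^ i * l := by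
  rw [diffCurve, natDegree_eq_of_degree_eq (degree_sub_eq_left_of_degree_lt h.degree_C_lt),
    natDegree_map_eq_of_injective C_injective, h.monic_diffPoly.2]

theorem exists_ringHom_inv_mem (k : Type*) [Field k] :
    ∃ (V : ValuationSubring (AlgebraicClosure (RatFunc k))) (ι : k[X] →+* V)
      (α : k[X] →+* AlgebraicClosure (RatFunc k)), Function.Injective ι ∧ Function.Injective α ∧
      V.subtype.comp (ι.comp C) = α.comp C ∧ (ι X : AlgebraicClosure (RatFunc k)) = (α X)⁻¹ ∧
      ι X ∈ maximalIdeal V := by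
  let α : k[X] →+* AlgebraicClosure (RatFunc k) :=
    (algebraMap (RatFunc k) _).comp (algebraMap k[X] (RatFunc k))
  have hα : Function.Injective α :=
    (algebraMap (RatFunc k) _).injective.comp (IsFractionRing.injective k[X] (RatFunc k))
  have hx : α X ≠ 0 := by
    rw [Ne, map_eq_zero_iff α hα]
    exact X_ne_zero
  have := invertibleOfNonzero hx
  let ψ : k[X] →+* AlgebraicClosure (RatFunc k) := eval₂RingHom (α.comp C) (⅟(α X))
  have hψ : Function.Injective ψ := by
    rw [injective_iff_map_eq_zero]
    intro P hP
    have h1 : eval₂ (α.comp C) (⅟(α X)) P = 0 := hP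
    rw [← eval₂_reverse_eq_zero_iff, invOf_invOf, ← hom_eval₂, eval₂_C_X, map_eq_zero_iff α hα,
      reverse_eq_zero] at h1
    exact h1
  obtain ⟨V, ι, h1, h2⟩ := exists_valuationSubring_X_mem_maximalIdeal ψ hψ
  refine ⟨V, ι, α, fun a b hab => hψ (by rw [← h1, ← h1, hab]), hα, ?_, ?_, h2⟩
  · ext a
    simp [h1, ψ]
  · simp [h1, ψ]

variable {L : Type*} [Field L] {V : ValuationSubring L} {ι : k[X] →+* V} {α : k[X] →+* L}

theorem coe_map_reverse (hα : Function.Injective α) (hC : V.subtype.comp (ι.comp C) = α.comp C)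
    (hX : (ι X : L) = (α X)⁻¹) (P : k[X]) :
    (ι P.reverse : L) = ι X ^ P.natDegree * α P := by
  have hx : α X ≠ 0 := by
    rw [Ne, map_eq_zero_iff α hα]
    exact X_ne_zero
  have := invertibleOfNonzero hx
  have h1 := eval₂_reverse_mul_pow (α.comp C) (α X) P
  have h2 : eval₂ (α.comp C) (α X) P = α P := by
    rw [← hom_eval₂, eval₂_C_X]
  have h3 : eval₂ (α.comp C) (⅟ (α X)) P.reverse = ι P.reverse := by
    rw [← hC, invOf_eq_inv, ← hX]
    have := hom_eval₂ P.reverse (ι.comp C) V.subtype (ι X)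
    rw [← hom_eval₂, eval₂_C_X] at this
    exact this.symm
  rw [h2, h3] at h1
  rw [← h1, hX, inv_pow, mul_comm, mul_assoc, mul_inv_cancel₀ (pow_ne_zero _ hx), mul_one]

theorem comp_C_mul_X_eq_scaleRoots {P : L[X]} {x : L} (hx : x ≠ 0) :
    P.comp (C x * X) = C (x ^ P.natDegree) * P.scaleRoots x⁻¹ := by
  ext n
  rw [comp_C_mul_X_coeff, coeff_C_mul, coeff_scaleRoots]
  rcases le_or_gt n P.natDegree with h | h
  · obtain ⟨m, hm⟩ := Nat.exists_eq_add_of_le h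
    rw [hm, add_tsub_cancel_left, pow_add, inv_pow]
    field_simp
  · rw [coeff_eq_zero_of_natDegree_lt h]
    ring

/-- The top homogeneous part of a polynomial, monic in `Y`, whose roots have at most a simple pole
at infinity is the reduction at infinity of the polynomial with rescaled roots. -/
theorem map_leadingCoeff_slopeHom (hι : Function.Injective ι) (hα : Function.Injective α)
    (hC : V.subtype.comp (ι.comp C) = α.comp C) (hX : (ι X : L) = (α X)⁻¹)
    (hs : ι X ∈ maximalIdeal V) {u : k[X][X]} {U : V[X]} (hU : U.Monic)
    (huU : U.map V.subtype = (u.map α).scaleRoots (ι X : L)) :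
    (slopeHom k u).leadingCoeff.map ((residue V).comp (ι.comp C)) = U.map (residue V) := by
  have hx : α X ≠ 0 := by
    rw [Ne, map_eq_zero_iff α hα]
    exact X_ne_zero
  have hs0 : ι X ≠ 0 := by
    rw [Ne, map_eq_zero_iff ι hι]
    exact X_ne_zero
  set T := slopeHom k u with hT
  set U' : V[X] := eval₂ (mapRingHom (ι.comp C)) (C (ι X)) T.reverse with hU'
  have hred : U'.map (residue V) = T.leadingCoeff.map ((residue V).comp (ι.comp C)) := by
    have := hom_eval₂ T.reverse (mapRingHom (ι.comp C)) (mapRingHom (residue V)) (C (ι X))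
    rw [coe_mapRingHom, map_C, (residue_eq_zero_iff _).mpr hs, C_0, eval₂_at_zero,
      coeff_zero_reverse, mapRingHom_comp] at this
    exact this
  have hcomp : eval₂ (mapRingHom (α.comp C)) (C (α X)) T = (u.map α).comp (C (α X) * X) := by
    have : (eval₂RingHom (mapRingHom (α.comp C)) (C (α X))).comp (slopeHom k) =
        (compRingHom (C (α X) * X)).comp (mapRingHom α) := by
      ext a
      · simp [slopeHom]
      · simp [slopeHom]
      · simp only [slopeHom, RingHom.comp_apply, coe_eval₂RingHom, eval₂_X, eval₂_mul,
          eval₂_C, coe_mapRingHom, map_X, coe_compRingHom_apply, X_comp]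
        rw [mul_comm]
    exact congrArg (fun φ : k[X][X] →+* L[X] => φ u) this
  have hrev : U'.map V.subtype * C (α X) ^ T.natDegree = (u.map α).comp (C (α X) * X) := by
    have : Invertible (C (α X)) := (isUnit_C.mpr hx.isUnit).invertible
    have hinv : ⅟ (C (α X)) = C (ι X : L) := by
      apply invOf_eq_right_inv
      rw [← C_mul, hX, mul_inv_cancel₀ hx, C_1]
    rw [← hcomp, ← eval₂_reverse_mul_pow, hinv, ← hC]
    congr 1
    have := hom_eval₂ T.reverse (mapRingHom (ι.comp C)) (mapRingHom V.subtype) (C (ι X))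
    rw [coe_mapRingHom, map_C, mapRingHom_comp] at this
    exact this
  have hmain : C (ι X) ^ (u.map α).natDegree * U' = C (ι X) ^ T.natDegree * U := by
    apply map_injective V.subtype Subtype.val_injective
    rw [comp_C_mul_X_eq_scaleRoots hx, ← hX, ← huU] at hrev
    have h1 : C (ι X : L) * C (α X) = 1 := by
      rw [← C_mul, hX, inv_mul_cancel₀ hx, C_1]
    have h2 : ∀ n, C (ι X : L) ^ n * C (α X) ^ n = 1 := fun n => by rw [← mul_pow, h1, one_pow]
    simp only [Polynomial.map_mul, Polynomial.map_pow, map_C, ValuationSubring.subtype_apply]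
    rw [C_pow] at hrev
    linear_combination C (ι X : L) ^ (u.map α).natDegree * C (ι X : L) ^ T.natDegree * hrev +
      (C (ι X : L) ^ T.natDegree * U.map V.subtype) * h2 (u.map α).natDegree -
      (C (ι X : L) ^ (u.map α).natDegree * U'.map V.subtype) * h2 T.natDegree
  have hcancel : ∀ {a b : ℕ} {P Q : V[X]}, C (ι X) ^ (a + b) * P = C (ι X) ^ a * Q →
      C (ι X) ^ b * P = Q := by
    intro a b P Q h
    rw [pow_add, mul_assoc] at h
    exact mul_left_cancel₀ (pow_ne_zero _ (C_ne_zero.mpr hs0)) h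
  have hs1 : residue V (ι X) = 0 := (residue_eq_zero_iff _).mpr hs
  rw [← hred]
  rcases lt_trichotomy (u.map α).natDegree T.natDegree with h | h | h
  · obtain ⟨b, hb⟩ := Nat.exists_eq_add_of_lt h
    rw [hb, add_assoc] at hmain
    have h0 : U'.map (residue V) = 0 := by
      rw [← hcancel hmain.symm]
      simp [hs1]
    rw [hred, Polynomial.map_eq_zero, leadingCoeff_eq_zero] at h0
    rw [h0] at h
    simp at h
  · rw [h] at hmain
    rw [← hcancel (b := 0) hmain, pow_zero, one_mul]
  · obtain ⟨b, hb⟩ := Nat.exists_eq_add_of_lt h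
    rw [hb, add_assoc] at hmain
    have h0 := (hU.map (residue V)).ne_zero
    rw [← hcancel hmain] at h0
    simp [hs1] at h0

end infinity

section infinity

variable {k : Type*} [Field k]

theorem Admissible.pow_eq_self_of_pow_eq_one {p i l : ℕ} (h : Admissible p i l) {R : Type*}
    [CommRing R] {ω : R} (hω : ω ^ l = 1) : ω ^ p ^ i = ω := by
  obtain ⟨m, hm⟩ := h.dvd
  have := h.le
  rw [← pow_sub_one_mul (by omega), hm, pow_mul, hω, one_pow, one_mul]

theorem Admissible.scaleRoots_diffCurve {p i l : ℕ} [Fact p.Prime] [CharP k p]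
    (h : Admissible p i l) {L : Type*} [Field L] [CharP L p] {α : k[X] →+* L} {s : L}
    (hs : s * α X = 1) :
    ((diffCurve k (p ^ i * l + 1)).map α).scaleRoots s =
      homogDiff (p ^ i) l (C s) X - C (homogDiff (p ^ i) l s 1) := by
  have hx : α X ≠ 0 := right_ne_zero_of_mul_eq_one hs
  have hs' : s = (α X)⁻¹ := eq_inv_of_mul_eq_one_left hs
  have h1 := comp_C_mul_X_eq_scaleRoots (P := (diffCurve k (p ^ i * l + 1)).map α) hx
  rw [h.monic_diffCurve.natDegree_map, h.natDegree_diffCurve, ← hs'] at h1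
  apply mul_left_cancel₀ (C_ne_zero.mpr (pow_ne_zero (p ^ i * l) hx))
  rw [← h1, map_diffCurve]
  have h2 := mul_homogDiff p i l (C s) (X : L[X])
  have h3 := congrArg C (mul_homogDiff p i l s 1)
  have h4 : C s * C (α X) = 1 := by rw [← C_mul, hs, C_1]
  have h5 : ∀ a : L[X], (C (α X) * a) ^ (p ^ i * l + 1) =
      C (α X) ^ (p ^ i * l + 1) * a ^ (p ^ i * l + 1) := fun a => mul_pow _ _ _
  have e1 : C (α X) * X + 1 = C (α X) * (X + C s) := by linear_combination -h4
  have e2 : C (α X) + 1 = C (α X) * (1 + C s) := by linear_combination -h4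
  have e3 : (C (α X) : L[X]) = C (α X) * 1 := (mul_one _).symm
  simp only [diffPoly, sub_comp, pow_comp, add_comp, X_comp, one_comp, C_comp, C_sub, C_pow,
    C_add, C_1]
  simp only [C_sub, C_pow, C_add, C_1, C_mul] at h3
  rw [e1, e2, h5, h5, h5]
  have e4 : (C (α X) : L[X]) ^ (p ^ i * l + 1) = (C (α X) * 1) ^ (p ^ i * l + 1) := by rw [mul_one]
  rw [e4, h5, one_pow, mul_one, pow_succ (C (α X))]
  linear_combination C (α X) ^ (p ^ i * l) * C (α X) * (h3 - h2) +
    C (α X) ^ (p ^ i * l) * (homogDiff (p ^ i) l (C s) X - C (homogDiff (p ^ i) l s 1)) * h4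

theorem _root_.ValuationSubring.exists_monic_map_eq_of_dvd {L : Type*} [Field L]
    (V : ValuationSubring L) {F : V[X]} (hF : F.Monic) {g : L[X]} (hg : g.Monic)
    (hd : g ∣ F.map V.subtype) : ∃ U : V[X], U.Monic ∧ U.map V.subtype = g := by
  obtain ⟨U, hU⟩ := IsIntegrallyClosed.eq_map_mul_C_of_dvd L hF hd
  rw [hg.leadingCoeff, C_1, mul_one] at hU
  exact ⟨U, monic_of_injective (f := V.subtype) Subtype.val_injective (by
    rw [← hU] at hg; exact hg), hU⟩

/-- The contribution of the points at infinity to Bézout's inequality for two factors of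
`diffCurve`. -/
theorem Admissible.natDegree_mul_natDegree_le [IsAlgClosed k]
    {p i l : ℕ} [Fact p.Prime] [CharP k p] (h : Admissible p i l) {u v : k[X][X]} (hu : u.Monic)
    (hv : v.Monic) (huv : u * v ∣ diffCurve k (p ^ i * l + 1)) :
    resultant u v ≠ 0 ∧ u.natDegree * v.natDegree ≤ (resultant u v).natDegree +
      ∑ ω ∈ nthRootsFinset l (1 : k), infMult u ω * infMult v ω := by
  obtain ⟨V, ι, α, hι, hα, hC, hX, hs⟩ := exists_ringHom_inv_mem k
  set s := ι X with hs_def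
  have hx : α X ≠ 0 := by
    rw [Ne, map_eq_zero_iff α hα]
    exact X_ne_zero
  have hsx : (s : AlgebraicClosure (RatFunc k)) * α X = 1 := by
    rw [hX, inv_mul_cancel₀ hx]
  have hs0 : s ≠ 0 := by
    rw [hs_def, Ne, map_eq_zero_iff ι hι]
    exact X_ne_zero
  let j : k →+* V := ι.comp C
  have hVp : CharP V p := charP_of_injective_ringHom j.injective p
  have hκp : CharP (ResidueField V) p :=
    .of_ringHom_of_ne_zero (residue V) p (Fact.out : p.Prime).ne_zero
  have hLp : CharP (AlgebraicClosure (RatFunc k)) p :=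
    .of_ringHom_of_ne_zero V.subtype p (Fact.out : p.Prime).ne_zero
  have hl3 := h.three_le
  have hle := h.le
  set F : V[X] := homogDiff (p ^ i) l (C s) X - C (homogDiff (p ^ i) l s 1) with hF
  have hFmap : F.map V.subtype = ((diffCurve k (p ^ i * l + 1)).map α).scaleRoots s := by
    rw [h.scaleRoots_diffCurve hsx, hF, Polynomial.map_sub, map_C, map_homogDiff V.subtype,
      ← coe_mapRingHom, map_homogDiff]
    simp
  have hFm : F.Monic := by
    refine monic_of_injective (f := V.subtype) Subtype.val_injective ?_
    rw [hFmap, monic_scaleRoots_iff]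
    exact h.monic_diffCurve.map α
  obtain ⟨w, hw⟩ := huv
  have hscale : ((u.map α).scaleRoots s * (v.map α).scaleRoots s) ∣ F.map V.subtype := by
    rw [hFmap, hw, Polynomial.map_mul, Polynomial.map_mul, mul_scaleRoots_of_noZeroDivisors,
      mul_scaleRoots_of_noZeroDivisors]
    exact dvd_mul_right _ _
  obtain ⟨U, hUm, hU⟩ := V.exists_monic_map_eq_of_dvd hFm
    ((monic_scaleRoots_iff _).mpr (hu.map α)) ((dvd_mul_right _ _).trans hscale)
  obtain ⟨W, hWm, hW⟩ := V.exists_monic_map_eq_of_dvd hFm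
    ((monic_scaleRoots_iff _).mpr (hv.map α)) ((dvd_mul_left _ _).trans hscale)
  rw [← hU, ← hW, ← Polynomial.map_mul] at hscale
  obtain ⟨A, hA⟩ := V.exists_eq_prod_X_sub_C hUm
  obtain ⟨B, hB⟩ := V.exists_eq_prod_X_sub_C hWm
  have key := prod_sub_dvd_pow j hs0 (f := F) (nthRootsFinset l (1 : k))
    (fun ρ hρ => ?_) A B ?_ (slopeHom k u).leadingCoeff (slopeHom k v).leadingCoeff ?_ ?_
  · rw [← resultant_prod_X_sub_C, ← hA, ← hB] at key
    have hres : ((resultant U W : V) : AlgebraicClosure (RatFunc k)) =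
        s ^ (u.natDegree * v.natDegree) * α (resultant u v) := by
      have h1 := resultant_scaleRoots (u.map α) (v.map α) (s : AlgebraicClosure (RatFunc k))
      rw [← hU, ← hW, hu.natDegree_map, hv.natDegree_map, resultant_map_map, hUm.natDegree_map,
        hWm.natDegree_map, resultant_map_map] at h1
      exact h1
    have hR0 : resultant u v ≠ 0 := by
      intro h0
      rw [h0, map_zero, mul_zero, ZeroMemClass.coe_eq_zero] at hres
      rw [hres, zero_dvd_iff] at key
      exact pow_ne_zero _ hs0 key
    refine ⟨hR0, ?_⟩
    have hrev : s ^ (u.natDegree * v.natDegree) * ι (resultant u v).reverse =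
        s ^ (resultant u v).natDegree * resultant U W := by
      apply Subtype.val_injective
      push_cast
      rw [coe_map_reverse hα hC hX, hres]
      ring
    refine (pow_dvd_pow_iff hs0 hs).mp ((Dvd.intro _ hrev).trans ?_)
    rw [pow_add]
    exact mul_dvd_mul_left _ key
  · have hs1 : residue V s = 0 := (residue_eq_zero_iff s).mpr hs
    have hFr : F.map (residue V) = X ^ (p ^ i * l) - 1 := by
      rw [hF, Polynomial.map_sub, map_C, map_homogDiff (residue V), ← coe_mapRingHom,
        map_homogDiff]
      simp only [coe_mapRingHom, map_C, hs1, map_X, C_0, homogDiff]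
      rw [zero_pow (by omega), zero_pow (by omega), zero_pow (by omega)]
      simp [pow_mul]
      omega
    have h0 := (dvd_pow_self _ two_ne_zero).trans hρ
    rw [dvd_iff_isRoot, IsRoot.def, hFr] at h0
    have h1 : (ρ ^ l - 1) ^ p ^ i = 0 := by
      rw [sub_pow_char_pow, one_pow, ← pow_mul, mul_comm]
      simpa using h0
    have h2 : ρ ^ l = 1 := sub_eq_zero.mp (eq_zero_of_pow_eq_zero h1)
    obtain ⟨ω, hω⟩ := (IsAlgClosed.splits (X ^ l - C 1 : k[X])).mem_range_of_isRoot
      (X_pow_sub_C_ne_zero (by omega) 1) (i := (residue V).comp j) (x := ρ) (by simp [h2])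
    have h3 : ω ^ l = 1 := by
      apply ((residue V).comp j).injective
      rw [map_pow, hω, h2, map_one]
    refine ⟨ω, (mem_nthRootsFinset (by omega) _).mpr h3, hω.symm, ?_⟩
    have h4 : (j ω) ^ l = 1 := by rw [← map_pow, h3, map_one]
    refine isOrdinaryAt_infinity p h.one_le (by omega) (by omega) ?_ hs h4
      (h.pow_eq_self_of_pow_eq_one h4)
    simpa using (h.natCast_ne_zero k).isUnit.map j
  · rw [← hA, ← hB]
    exact (map_dvd_map V.subtype Subtype.val_injective (hUm.mul hWm)).mp hscale
  · rw [← hA]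
    exact map_leadingCoeff_slopeHom hι hα hC hX hs hUm hU
  · rw [← hB]
    exact map_leadingCoeff_slopeHom hι hα hC hX hs hWm hW

/-- Bézout's inequality for two factors of `diffCurve`. -/
theorem Admissible.bezout_le [IsAlgClosed k]
    {p i l : ℕ} [Fact p.Prime] [CharP k p] (h : Admissible p i l) {u v : k[X][X]} (hu : u.Monic)
    (hv : v.Monic) (huv : u * v ∣ diffCurve k (p ^ i * l + 1)) :
    u.natDegree * v.natDegree ≤
      ∑ c ∈ critPts k l, ∑ z ∈ critPts k l, affMult u c z * affMult v c z +
      ∑ ω ∈ nthRootsFinset l (1 : k), infMult u ω * infMult v ω := by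
  classical
  obtain ⟨h0, h1⟩ := h.natDegree_mul_natDegree_le hu hv huv
  refine h1.trans (Nat.add_le_add_right ?_ _)
  have hroots : (resultant u v).roots.toFinset ⊆ critPts k l := by
    intro c hc
    rw [Multiset.mem_toFinset, mem_roots h0, IsRoot.def] at hc
    have h2 : resultant (u.map (evalRingHom c)) (v.map (evalRingHom c)) = 0 := by
      rw [hu.natDegree_map, hv.natDegree_map, resultant_map_map]
      exact hc
    have h3 := (resultant_eq_zero_iff.mp h2).2
    rw [isCoprime_iff_aeval_ne_zero_of_isAlgClosed k k] at h3
    push Not at h3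
    obtain ⟨ρ, h4, h5⟩ := h3
    rw [aeval_def, Algebra.algebraMap_self, eval₂_id, map_evalRingHom_eval, evalEval, ← IsRoot.def,
      ← dvd_iff_isRoot] at h4 h5
    obtain ⟨w, hw⟩ := huv
    have h6 := congrArg (fun P => (derivative (P.eval (C ρ))).eval c) hw
    obtain ⟨a, ha⟩ := h4
    obtain ⟨b, hb⟩ := h5
    simp only [eval_mul, ha, hb, diffCurve, eval_sub, eval_C, derivative_sub, derivative_mul,
      eval_map_apply] at h6
    have h7 : (eval c (diffPoly k l)) ^ p ^ i = 0 := by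
      simpa [h.derivative_diffPoly] using h6
    rw [h.mem_critPts]
    simpa [diffPoly, sub_eq_zero] using eq_zero_of_pow_eq_zero h7
  rw [(IsAlgClosed.splits (resultant u v)).natDegree_eq_card_roots,
    ← Multiset.sum_count_eq_card (s := critPts k l) fun a ha =>
      hroots (Multiset.mem_toFinset.mpr ha)]
  refine Finset.sum_le_sum fun c hc => ?_
  rw [count_roots]
  exact h.rootMultiplicity_resultant_le hu hv huv hc

end infinity

section form

variable {k : Type*} [Field k] {p i l : ℕ}

theorem slopeHom_injective (k : Type*) [Field k] : Function.Injective (slopeHom k) := by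
  have h1 : ((Bivariate.swap (R := k)).toRingEquiv.toRingHom).comp (slopeHom k) =
      compRingHom (C X * X) := by
    refine ringHom_ext (fun P => ?_) ?_
    · simp [slopeHom, Bivariate.swap_map_C]
    · simp [slopeHom, Bivariate.swap_X, Bivariate.swap_Y]
  intro u v huv
  have h2 : u.comp (C X * X) = v.comp (C X * X) := by
    have hu := congrArg (fun f => f u) h1
    have hv := congrArg (fun f => f v) h1
    simp only [RingHom.comp_apply, huv, coe_compRingHom_apply] at hu hv
    exact hu.symm.trans hv
  ext1 n
  have h3 := congrArg (fun f => f.coeff n) h2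
  simp only [comp_C_mul_X_coeff] at h3
  exact mul_right_cancel₀ (pow_ne_zero n X_ne_zero) h3

theorem slopeHom_ne_zero {u : k[X][X]} (hu : u ≠ 0) : slopeHom k u ≠ 0 :=
  (map_ne_zero_iff _ (slopeHom_injective k)).mpr hu

theorem affMult_mul {u v : k[X][X]} (hu : u.Monic) (hv : v.Monic) (c z : k) :
    affMult (u * v) c z = affMult u c z + affMult v c z := by
  rw [affMult, Polynomial.map_mul, rootMultiplicity_mul ((hu.map _).mul (hv.map _)).ne_zero,
    affMult, affMult]

theorem infMult_mul {u v : k[X][X]} (hu : u.Monic) (hv : v.Monic) (ω : k) :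
    infMult (u * v) ω = infMult u ω + infMult v ω := by
  rw [infMult, map_mul, leadingCoeff_mul, rootMultiplicity_mul, infMult, infMult]
  exact mul_ne_zero (leadingCoeff_ne_zero.mpr (slopeHom_ne_zero hu.ne_zero))
    (leadingCoeff_ne_zero.mpr (slopeHom_ne_zero hv.ne_zero))

/-- The defect in Bézout's inequality `Admissible.bezout_le`. -/
def bezoutDefect (l : ℕ) (u v : k[X][X]) : ℤ :=
  u.natDegree * v.natDegree -
    (∑ c ∈ critPts k l, ∑ z ∈ critPts k l, (affMult u c z : ℤ) * affMult v c z +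
      ∑ ω ∈ nthRootsFinset l (1 : k), (infMult u ω : ℤ) * infMult v ω)

theorem bezoutDefect_mul_self {u v : k[X][X]} (hu : u.Monic) (hv : v.Monic) :
    bezoutDefect l (u * v) (u * v) =
      bezoutDefect l u u + bezoutDefect l v v + 2 * bezoutDefect l u v := by
  simp only [bezoutDefect, affMult_mul hu hv, infMult_mul hu hv, hu.natDegree_mul hv,
    Nat.cast_add, add_mul, mul_add, Finset.sum_add_distrib]
  simp only [mul_comm ((affMult v _ _ : ℕ) : ℤ) ((affMult u _ _ : ℕ) : ℤ),
    mul_comm ((infMult v _ : ℕ) : ℤ) ((infMult u _ : ℕ) : ℤ)]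
  ring

theorem Admissible.bezoutDefect_nonpos [IsAlgClosed k] [Fact p.Prime] [CharP k p]
    (h : Admissible p i l) {u v : k[X][X]} (hu : u.Monic) (hv : v.Monic)
    (huv : u * v ∣ diffCurve k (p ^ i * l + 1)) : bezoutDefect l u v ≤ 0 := by
  rw [bezoutDefect, sub_nonpos]
  exact_mod_cast h.bezout_le hu hv huv

theorem rootMultiplicity_pow_le_of_separable {P : k[X]} (hP : P.Separable) (n : ℕ) (z : k) :
    (P ^ n).rootMultiplicity z ≤ n := by
  classical
  rw [← count_roots, roots_pow, Multiset.count_nsmul, count_roots]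
  exact (Nat.mul_le_mul_left n (rootMultiplicity_le_one_of_separable hP z)).trans (mul_one n).le

theorem Admissible.infMult_diffCurve_le [Fact p.Prime] [CharP k p]
    (h : Admissible p i l) (ω : k) : infMult (diffCurve k (p ^ i * l + 1)) ω ≤ p ^ i := by
  set f := diffPoly k (p ^ i * l + 1) with hf
  have hq := h.le
  have hl := h.three_le
  have h1 : slopeHom k (diffCurve k (p ^ i * l + 1)) = (f.map C).comp (C X * X) - f.map C := by
    have h2 : ∀ P : k[X], slopeHom k (P.map C) = (P.map C).comp (C X * X) := by
      intro P
      simp only [slopeHom, coe_eval₂RingHom, eval₂_map, comp]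
      congr 1
      ext
      simp
    rw [diffCurve, map_sub, h2]
    simp [slopeHom, hf]
  have h2 : ∀ n, (slopeHom k (diffCurve k (p ^ i * l + 1))).coeff n =
      C (f.coeff n) * (X ^ n - 1) := by
    intro n
    rw [h1, coeff_sub, comp_C_mul_X_coeff, coeff_map]
    ring
  have h3 : (slopeHom k (diffCurve k (p ^ i * l + 1))).coeff (p ^ i * l) = X ^ (p ^ i * l) - 1 := by
    have := h.monic_diffPoly (k := k)
    have h5 : f.coeff (p ^ i * l) = 1 := by
      rw [← this.2]
      exact this.1.coeff_natDegree
    rw [h2, h5, C_1, one_mul]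
  have hne : (X ^ (p ^ i * l) - 1 : k[X]) ≠ 0 := by
    rw [← C_1]
    exact X_pow_sub_C_ne_zero (Nat.mul_pos (by omega) (by omega)) 1
  have h4 : (slopeHom k (diffCurve k (p ^ i * l + 1))).leadingCoeff = (X ^ l - 1) ^ p ^ i := by
    have : (slopeHom k (diffCurve k (p ^ i * l + 1))).natDegree = p ^ i * l := by
      refine le_antisymm ?_ (le_natDegree_of_ne_zero (h3 ▸ hne))
      rw [natDegree_le_iff_coeff_eq_zero]
      intro n hn
      rw [h2, coeff_eq_zero_of_natDegree_lt (by rw [hf, h.monic_diffPoly.2]; exact hn), C_0,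
        zero_mul]
    rw [leadingCoeff, this, h3, sub_pow_char_pow, one_pow, ← pow_mul, mul_comm]
  rw [infMult, h4]
  refine rootMultiplicity_pow_le_of_separable ?_ _ _
  rw [← C_1]
  exact separable_X_pow_sub_C 1 (h.natCast_ne_zero k) one_ne_zero

theorem Admissible.affMult_diffCurve_le [Fact p.Prime] [CharP k p]
    (h : Admissible p i l) (c : k) {z : k} (hz : z ∈ critPts k l) :
    affMult (diffCurve k (p ^ i * l + 1)) c z ≤ p ^ i + 1 := by
  have h1 : derivative ((diffCurve k (p ^ i * l + 1)).map (evalRingHom c)) =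
      diffPoly k l ^ p ^ i := by
    rw [map_diffCurve, derivative_sub, derivative_C, sub_zero, h.derivative_diffPoly k]
  have h2 : (diffPoly k l).rootMultiplicity z ≤ 1 := by
    by_contra! h3
    rw [one_lt_rootMultiplicity_iff_isRoot h.diffPoly_ne_zero] at h3
    refine h.deriv_ne_zero (h.mem_critPts.mp hz) ?_
    have := h3.2
    simp only [diffPoly, derivative_sub, derivative_pow, derivative_add, derivative_X,
      derivative_one, IsRoot.def] at this
    simp at this
    linear_combination this
  have h4 : (diffPoly k l ^ p ^ i).rootMultiplicity z ≤ p ^ i := by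
    classical
    rw [← count_roots, roots_pow, Multiset.count_nsmul, count_roots]
    exact (Nat.mul_le_mul_left _ h2).trans (mul_one _).le
  have h5 := rootMultiplicity_sub_one_le_derivative_rootMultiplicity_of_ne_zero
    ((diffCurve k (p ^ i * l + 1)).map (evalRingHom c)) z
    (h1 ▸ pow_ne_zero _ h.diffPoly_ne_zero)
  rw [h1] at h5
  rw [affMult]
  omega

theorem Admissible.bezoutDefect_diffCurve_pos [Fact p.Prime] [CharP k p]
    (h : Admissible p i l) :
    0 < bezoutDefect l (diffCurve k (p ^ i * l + 1)) (diffCurve k (p ^ i * l + 1)) := by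
  have hl := h.three_le
  have hq := h.le
  set f := diffCurve k (p ^ i * l + 1) with hf
  have h1 : ∑ c ∈ critPts k l, ∑ z ∈ critPts k l, affMult f c z * affMult f c z ≤
      (l - 1) * ((l - 1) * ((p ^ i + 1) * (p ^ i + 1))) := by
    have h2 : ∀ c ∈ critPts k l, ∑ z ∈ critPts k l, affMult f c z * affMult f c z ≤
        (l - 1) * ((p ^ i + 1) * (p ^ i + 1)) := fun c _ =>
      (Finset.sum_le_card_nsmul _ _ _ fun z hz => Nat.mul_le_mul
        (h.affMult_diffCurve_le c hz) (h.affMult_diffCurve_le c hz)).trans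
        (Nat.mul_le_mul_right _ card_critPts_le)
    exact (Finset.sum_le_card_nsmul _ _ _ h2).trans (Nat.mul_le_mul_right _ card_critPts_le)
  have h2 : ∑ ω ∈ nthRootsFinset l (1 : k), infMult f ω * infMult f ω ≤
      l * (p ^ i * p ^ i) := by
    refine (Finset.sum_le_card_nsmul _ _ _ fun ω _ => Nat.mul_le_mul
      (h.infMult_diffCurve_le ω) (h.infMult_diffCurve_le ω)).trans (Nat.mul_le_mul_right _ ?_)
    classical
    rw [nthRootsFinset]
    exact (Multiset.toFinset_card_le _).trans (card_nthRoots l 1)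
  rw [bezoutDefect, h.natDegree_diffCurve, sub_pos]
  obtain ⟨m, rfl⟩ : ∃ m, l = m + 1 := ⟨l - 1, by omega⟩
  have h3 : m * (m * ((p ^ i + 1) * (p ^ i + 1))) + (m + 1) * (p ^ i * p ^ i) <
      (p ^ i * (m + 1)) * (p ^ i * (m + 1)) := by
    obtain ⟨r, hr⟩ := Nat.exists_eq_add_of_le hq
    rw [hr]
    have : 0 < m := by omega
    nlinarith [Nat.zero_le r, Nat.zero_le (m * r), Nat.zero_le (m * r * r), Nat.zero_le (m * m * r),
      Nat.zero_le (m * m)]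
  exact_mod_cast (Nat.add_le_add h1 h2).trans_lt h3

theorem Admissible.exists_irreducible [IsAlgClosed k] [Fact p.Prime] [CharP k p]
    (h : Admissible p i l) (n : ℕ) : ∀ u : k[X][X], u.natDegree ≤ n → u.Monic →
    u ∣ diffCurve k (p ^ i * l + 1) → 0 < bezoutDefect l u u →
    ∃ v : k[X][X], v.Monic ∧ Irreducible v ∧ v ∣ diffCurve k (p ^ i * l + 1) ∧
      0 < bezoutDefect l v v := by
  induction n with
  | zero =>
    intro u hn hu hd hpos
    have := h.bezoutDefect_nonpos hu hu
    obtain rfl : u = 1 := hu.natDegree_eq_zero.mp (by omega)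
    exact absurd (this (by simp)) (not_le.mpr hpos)
  | succ n ih =>
    intro u hn hu hd hpos
    have hu1 : u ≠ 1 := by
      rintro rfl
      exact absurd (h.bezoutDefect_nonpos hu hu (by simp)) (not_le.mpr hpos)
    by_cases hirr : Irreducible u
    · exact ⟨u, hu, hirr, hd, hpos⟩
    · rw [hu.irreducible_iff_natDegree] at hirr
      push Not at hirr
      obtain ⟨a, b, ha, hb, rfl, ha0, hb0⟩ := hirr hu1
      rw [ha.natDegree_mul hb] at hn
      rw [bezoutDefect_mul_self ha hb] at hpos
      have := h.bezoutDefect_nonpos ha hb hd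
      by_cases hapos : 0 < bezoutDefect l a a
      · exact ih a (by omega) ha ((dvd_mul_right a b).trans hd) hapos
      · exact ih b (by omega) hb ((dvd_mul_left b a).trans hd) (by omega)

end form

section frobenius

variable {k : Type*} [Field k] {p i l : ℕ}

theorem affMult_map (φ : k →+* k) (u : k[X][X]) (c z : k) :
    affMult (u.map (mapRingHom φ)) (φ c) (φ z) = affMult u c z := by
  have h : (evalRingHom (φ c)).comp (mapRingHom φ) = φ.comp (evalRingHom c) := by
    ext <;> simp
  rw [affMult, map_map, h, ← map_map, ← eq_rootMultiplicity_map φ.injective, affMult]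

theorem infMult_map (φ : k →+* k) (u : k[X][X]) (ω : k) :
    infMult (u.map (mapRingHom φ)) (φ ω) = infMult u ω := by
  have h : (slopeHom k).comp (mapRingHom (mapRingHom φ)) =
      (mapRingHom (mapRingHom φ)).comp (slopeHom k) := by
    refine ringHom_ext (fun P => ?_) ?_
    · simp only [slopeHom, RingHom.comp_apply, coe_mapRingHom, map_C, coe_eval₂RingHom, eval₂_C,
        map_map]
      congr 1
      ext : 1
      simp
    · simp [slopeHom]
  have h2 : slopeHom k (u.map (mapRingHom φ)) = (slopeHom k u).map (mapRingHom φ) :=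
    congrArg (fun f => f u) h
  rw [infMult, h2, leadingCoeff_map_of_injective (map_injective φ φ.injective), coe_mapRingHom,
    ← eq_rootMultiplicity_map φ.injective, infMult]

theorem _root_.Finset.sum_comp_of_mapsTo_of_injective {α M : Type*} [AddCommMonoid M]
    {s : Finset α} {φ : α → α} (hφ : Function.Injective φ) (hs : ∀ a ∈ s, φ a ∈ s) (f : α → M) :
    ∑ a ∈ s, f (φ a) = ∑ a ∈ s, f a := by
  classical
  have h : s.image φ = s := Finset.eq_of_subset_of_card_le
    (Finset.image_subset_iff.mpr hs) (Finset.card_image_of_injective s hφ).ge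
  conv_rhs => rw [← h, Finset.sum_image hφ.injOn]

theorem Admissible.bezoutDefect_map [CharP k p] (h : Admissible p i l) (φ : k →+* k)
    (u : k[X][X]) : bezoutDefect l (u.map (mapRingHom φ)) (u.map (mapRingHom φ)) =
      bezoutDefect l u u := by
  have h1 : ∀ c ∈ critPts k l, φ c ∈ critPts k l := by
    intro c hc
    rw [h.mem_critPts] at hc ⊢
    rw [← map_one φ, ← map_add, ← map_pow, hc, map_pow]
  have hl := h.three_le
  have h2 : ∀ ω ∈ nthRootsFinset l (1 : k), φ ω ∈ nthRootsFinset l (1 : k) := by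
    intro ω hω
    rw [mem_nthRootsFinset (by omega)] at hω ⊢
    rw [← map_pow, hω, map_one]
  rw [bezoutDefect, bezoutDefect, natDegree_map_eq_of_injective (map_injective φ φ.injective),
    ← Finset.sum_comp_of_mapsTo_of_injective φ.injective h1,
    ← Finset.sum_comp_of_mapsTo_of_injective φ.injective h2]
  simp only [infMult_map]
  congr 2
  refine Finset.sum_congr rfl fun c _ => ?_
  rw [← Finset.sum_comp_of_mapsTo_of_injective φ.injective h1]
  simp only [affMult_map]

theorem bezoutDefect_add_le {u v : k[X][X]} (huv : u.natDegree = v.natDegree) :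
    bezoutDefect l u u + bezoutDefect l v v ≤ 2 * bezoutDefect l u v := by
  have h : ∀ a b : ℤ, 2 * (a * b) ≤ a * a + b * b := fun a b => by nlinarith [sq_nonneg (a - b)]
  have h1 : ∑ c ∈ critPts k l, ∑ z ∈ critPts k l, 2 * ((affMult u c z : ℤ) * affMult v c z) ≤
      ∑ c ∈ critPts k l, ∑ z ∈ critPts k l, ((affMult u c z : ℤ) * affMult u c z +
        (affMult v c z : ℤ) * affMult v c z) :=
    Finset.sum_le_sum fun c _ => Finset.sum_le_sum fun z _ => h _ _
  have h2 : ∑ ω ∈ nthRootsFinset l (1 : k), 2 * ((infMult u ω : ℤ) * infMult v ω) ≤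
      ∑ ω ∈ nthRootsFinset l (1 : k), ((infMult u ω : ℤ) * infMult u ω +
        (infMult v ω : ℤ) * infMult v ω) :=
    Finset.sum_le_sum fun ω _ => h _ _
  simp only [Finset.sum_add_distrib, ← Finset.mul_sum] at h1 h2
  simp only [bezoutDefect, huv]
  linarith

theorem Admissible.map_frobenius_eq [IsAlgClosed k] [Fact p.Prime] [CharP k p]
    (h : Admissible p i l) {u : k[X][X]} (hu : u.Monic) (hirr : Irreducible u)
    (hd : u ∣ diffCurve k (p ^ i * l + 1)) (hpos : 0 < bezoutDefect l u u) (φ : k →+* k) :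
    u.map (mapRingHom φ) = u := by
  have hdeg : (u.map (mapRingHom φ)).natDegree = u.natDegree :=
    natDegree_map_eq_of_injective (map_injective φ φ.injective) _
  have hm : (u.map (mapRingHom φ)).Monic := hu.map _
  have hd' : u.map (mapRingHom φ) ∣ diffCurve k (p ^ i * l + 1) := by
    have := Polynomial.map_dvd (mapRingHom φ) hd
    rwa [map_diffCurve, coe_mapRingHom, map_X, show diffPoly k[X] (p ^ i * l + 1) -
      C ((X + 1) ^ (p ^ i * l + 1) - X ^ (p ^ i * l + 1)) = diffCurve k (p ^ i * l + 1) by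
        rw [diffCurve, map_diffPoly]; rfl] at this
  by_contra hne
  have hmul : u.map (mapRingHom φ) * u ∣ diffCurve k (p ^ i * l + 1) := by
    obtain ⟨w, hw⟩ := hd'
    rw [hw] at hd ⊢
    rcases hirr.prime.dvd_or_dvd hd with h1 | h1
    · exact absurd (eq_of_monic_of_dvd_of_natDegree_le hu hm h1 hdeg.le) hne
    · exact mul_dvd_mul_left _ h1
  have h1 := h.bezoutDefect_nonpos hm hu hmul
  have h2 := bezoutDefect_add_le (l := l) hdeg
  rw [h.bezoutDefect_map] at h2
  omega

theorem exists_map_eq_of_map_frobenius_eq [Fact p.Prime] [CharP k p] [Algebra (ZMod p) k]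
    {u : k[X][X]} (hu : u.map (mapRingHom (frobenius k p)) = u) :
    ∃ u₀ : (ZMod p)[X][X], u₀.map (mapRingHom (algebraMap (ZMod p) k)) = u := by
  have hp : 1 < p := (Fact.out : p.Prime).one_lt
  have h1 : ∀ a : k, a ^ p = a → a ∈ (algebraMap (ZMod p) k).range := by
    intro a ha
    refine (GaloisField.splits_zmod_X_pow_sub_X p).mem_range_of_isRoot
      (FiniteField.X_pow_card_sub_X_ne_zero (ZMod p) hp) ?_
    simp [ha]
  rw [← mem_lifts, lifts_iff_coeff_lifts]
  intro n
  change u.coeff n ∈ (mapRingHom (algebraMap (ZMod p) k)).range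
  rw [RingHom.mem_range]
  change ∃ x, map (algebraMap (ZMod p) k) x = u.coeff n
  rw [← mem_lifts, lifts_iff_coeff_lifts]
  intro m
  refine h1 _ ?_
  have := congrArg (fun f => (f.coeff n).coeff m) hu
  simpa [frobenius_def] using this

theorem Admissible.exists_map_irreducible [IsAlgClosed k] [Fact p.Prime] [CharP k p]
    [Algebra (ZMod p) k] (h : Admissible p i l) :
    ∃ u : (ZMod p)[X][X], u.Monic ∧ Irreducible (u.map (mapRingHom (algebraMap (ZMod p) k))) ∧
      u ∣ diffCurve (ZMod p) (p ^ i * l + 1) ∧ ¬ u ∣ X - C X := by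
  obtain ⟨v, hv, hirr, hd, hpos⟩ := h.exists_irreducible (k := k) _ _ le_rfl h.monic_diffCurve
    dvd_rfl h.bezoutDefect_diffCurve_pos
  obtain ⟨u, rfl⟩ := exists_map_eq_of_map_frobenius_eq
    (h.map_frobenius_eq hv hirr hd hpos (frobenius k p))
  have hinj : Function.Injective (mapRingHom (algebraMap (ZMod p) k)) :=
    map_injective _ (algebraMap (ZMod p) k).injective
  have hu : u.Monic := monic_of_injective hinj hv
  refine ⟨u, hu, hirr, ?_, fun hdvd => ?_⟩
  · rw [← map_dvd_map _ hinj hu, map_diffCurve, coe_mapRingHom, map_X,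
      show diffPoly k[X] (p ^ i * l + 1) - C ((X + 1) ^ (p ^ i * l + 1) - X ^ (p ^ i * l + 1)) =
        diffCurve k (p ^ i * l + 1) by rw [diffCurve, map_diffPoly]; rfl]
    exact hd
  · have h1 := Polynomial.map_dvd (mapRingHom (algebraMap (ZMod p) k)) hdvd
    simp only [Polynomial.map_sub, map_X, map_C, coe_mapRingHom] at h1
    have h2 := eq_of_monic_of_associated hv (monic_X_sub_C X)
      ((hirr.dvd_irreducible_iff_associated (irreducible_X_sub_C X)).mp h1)
    rw [h2] at hpos
    have h3 : infMult (X - C X : k[X][X]) 1 = 1 := by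
      have h4 : slopeHom k (X - C X) = C (X - C 1) * X := by
        simp [slopeHom, sub_mul]
      rw [infMult, h4, leadingCoeff_mul, leadingCoeff_C, leadingCoeff_X, mul_one,
        rootMultiplicity_X_sub_C_self]
    have hl := h.three_le
    have h5 : (1 : ℤ) ≤ ∑ ω ∈ nthRootsFinset l (1 : k),
        (infMult (X - C X : k[X][X]) ω : ℤ) * infMult (X - C X : k[X][X]) ω := by
      refine le_trans ?_ (Finset.single_le_sum (a := (1 : k))
        (fun _ _ => mul_nonneg (Int.natCast_nonneg _) (Int.natCast_nonneg _)) ?_)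
      · rw [h3]; norm_num
      · rw [mem_nthRootsFinset (by omega), one_pow]
    have h6 : (0 : ℤ) ≤ ∑ c ∈ critPts k l, ∑ z ∈ critPts k l,
        (affMult (X - C X : k[X][X]) c z : ℤ) * affMult (X - C X : k[X][X]) c z := by positivity
    rw [bezoutDefect, natDegree_X_sub_C] at hpos
    push_cast at hpos
    linarith

end frobenius

theorem map_equivMvPolynomial {R S : Type*} [CommRing R] [CommRing S] (φ : R →+* S)
    (u : R[X][X]) : MvPolynomial.map φ (Bivariate.equivMvPolynomial R u) =
      Bivariate.equivMvPolynomial S (u.map (mapRingHom φ)) := by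
  have h : (MvPolynomial.map φ).comp (Bivariate.equivMvPolynomial R).toRingEquiv.toRingHom =
      (Bivariate.equivMvPolynomial S).toRingEquiv.toRingHom.comp
        (mapRingHom (mapRingHom φ)) := by
    refine ringHom_ext' (ringHom_ext (fun a => ?_) ?_) ?_ <;> simp
  exact congrArg (fun f => f u) h

theorem diffCurve_eq_of_equivMvPolynomial {R : Type*} [CommRing R] {t : ℕ}
    {g : MvPolynomial (Fin 2) R}
    (hg : (MvPolynomial.X 0 + 1) ^ t - MvPolynomial.X 0 ^ t - (MvPolynomial.X 1 + 1) ^ t +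
      MvPolynomial.X 1 ^ t = (MvPolynomial.X 0 - MvPolynomial.X 1) * g) :
    diffCurve R t = (X - C X) * (Bivariate.equivMvPolynomial R).symm g := by
  have h := congrArg (Bivariate.equivMvPolynomial R).symm hg
  simp only [map_sub, map_add, map_mul, map_pow, map_one, Bivariate.equivMvPolynomial_symm_X_0,
    Bivariate.equivMvPolynomial_symm_X_1] at h
  rw [diffCurve, map_diffPoly]
  simp only [diffPoly, C_sub, C_pow, C_add, C_1]
  linear_combination -h

theorem Admissible.of_lt {p i l : ℕ} (hi : 1 ≤ i) (hl : 3 ≤ l) (hlp : ¬ p ∣ l)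
    (hdvd : l ∣ p ^ i - 1) (hlt : l < p ^ i - 1) : Admissible p i l := by
  refine ⟨hi, hl, hlp, hdvd, ?_⟩
  obtain ⟨m, hm⟩ := hdvd
  rcases m with _ | _ | m
  · omega
  · omega
  · rw [mul_add, mul_add] at hm
    omega

end Polynomial

/-- Case (B.2): suppose `t = p^i·ℓ + 1` with `ℓ ∣ p^i - 1` and `ℓ < p^i - 1`.
Then `g_t` has an absolutely irreducible factor over `F_p`. -/
theorem gt_has_abs_irred_factor_case_B2
    (p t : ℕ) [Fact p.Prime] (hp2 : p ≠ 2) (ht : 3 ≤ t) (hpt : ¬ p ∣ t)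
    (g : MvPolynomial (Fin 2) (ZMod p))
    (hg : ((X 0 + 1) ^ t - X 0 ^ t - (X 1 + 1) ^ t + X 1 ^ t : MvPolynomial (Fin 2) (ZMod p))
        = (X 0 - X 1) * g)
    (i l : ℕ) (hi : 1 ≤ i) (hl3 : 3 ≤ l) (hlodd : Odd l) (hlp : ¬ p ∣ l)
    (htval : t = p ^ i * l + 1)
    (hdvd : l ∣ p ^ i - 1) (hlt : l < p ^ i - 1) :
    ∃ h : MvPolynomial (Fin 2) (ZMod p), 0 < h.totalDegree ∧ h ∣ g ∧
      Irreducible (MvPolynomial.map (algebraMap (ZMod p) (AlgebraicClosure (ZMod p))) h) := by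
  subst htval
  have h := Polynomial.Admissible.of_lt hi hl3 hlp hdvd hlt
  obtain ⟨u, hu, hirr, hd, hnd⟩ :=
    h.exists_map_irreducible (k := AlgebraicClosure (ZMod p))
  have hirr' : Irreducible u := hu.irreducible_of_irreducible_map _ u hirr
  have hprime := hirr'.prime
  rw [Polynomial.diffCurve_eq_of_equivMvPolynomial hg] at hd
  have hg' := (hprime.dvd_or_dvd hd).resolve_left hnd
  have hmap : Irreducible (MvPolynomial.map (algebraMap (ZMod p) (AlgebraicClosure (ZMod p)))
      (Polynomial.Bivariate.equivMvPolynomial (ZMod p) u)) := by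
    rw [Polynomial.map_equivMvPolynomial]
    exact (MulEquiv.irreducible_iff (Polynomial.Bivariate.equivMvPolynomial _)).mpr hirr
  refine ⟨Polynomial.Bivariate.equivMvPolynomial (ZMod p) u, ?_, ?_, hmap⟩
  · rw [Nat.pos_iff_ne_zero, Ne, totalDegree_eq_zero_iff_eq_C]
    intro h0
    rw [h0, map_C] at hmap
    have hne : algebraMap (ZMod p) (AlgebraicClosure (ZMod p))
        (coeff 0 (Polynomial.Bivariate.equivMvPolynomial (ZMod p) u)) ≠ 0 := by
      intro h1
      rw [h1, C_0] at hmap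
      exact not_irreducible_zero hmap
    exact hmap.not_isUnit ((IsUnit.mk0 _ hne).map C)
  · have h1 := map_dvd (Polynomial.Bivariate.equivMvPolynomial (ZMod p)) hg'
    rwa [AlgEquiv.apply_symm_apply] at h1
end
end
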